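/- (Sobolevskii; independence of the integrability exponent.) If A ∈ MR_p(X_0) for some p ∈ (1,∞), then A ∈ MR_q(X_0) for every q ∈ (1,∞). Consequently, membership of A in MR_{p,μ}(X_0) is independent of both p ∈ (1,∞) and μ ∈ (1/p,1]. -/

import Mathlib

open MeasureTheory Set

noncomputable section

/-- Membership in the weighted space `L_{p,μ}(s;X)`: `f` is (a.e.) strongly measurable on `s`
and `t ↦ t^(1-μ) f t` is `p`-integrable on `s`. -/
def MemWLp {X : Type*} [NormedAddCommGroup X] (p μ : ℝ) (s : Set ℝ) (f : ℝ → X) : Prop :=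
  AEStronglyMeasurable f (volume.restrict s) ∧
    IntegrableOn (fun t : ℝ => (t ^ (1 - μ) * ‖f t‖) ^ p) s

/-- The norm of the weighted space `L_{p,μ}(s;X)`. -/
def wLpNorm {X : Type*} [NormedAddCommGroup X] (p μ : ℝ) (s : Set ℝ) (f : ℝ → X) : ℝ :=
  (∫ t in s, (t ^ (1 - μ) * ‖f t‖) ^ p) ^ (1 / p)

/-- `g` is the weak (distributional) derivative of `u` on the open set `s ⊆ ℝ`;
in particular `u, g ∈ L_{1,loc}(s;X)`. -/
def IsWeakDeriv {X : Type*} [NormedAddCommGroup X] [NormedSpace ℂ X]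
    (s : Set ℝ) (u g : ℝ → X) : Prop :=
  LocallyIntegrableOn u s ∧ LocallyIntegrableOn g s ∧
    ∀ φ : ℝ → ℝ, ContDiff ℝ (⊤ : ℕ∞) φ → HasCompactSupport φ → tsupport φ ⊆ s →
      (∫ t in s, deriv φ t • u t) = -∫ t in s, φ t • g t

/-- `v : s → X` has trace `x` at `t = 0`: it has a representative `w` which is continuous
on `{0} ∪ s` with `w 0 = x`. -/
def HasTrace {X : Type*} [NormedAddCommGroup X] (s : Set ℝ) (v : ℝ → X) (x : X) : Prop :=
  ∃ w : ℝ → X, ContinuousOn w (insert 0 s) ∧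
    (∀ᵐ t ∂(volume.restrict s), w t = v t) ∧ w 0 = x

variable {X₀ X₁ : Type*} [NormedAddCommGroup X₀] [NormedSpace ℂ X₀] [CompleteSpace X₀]
  [NormedAddCommGroup X₁] [NormedSpace ℂ X₁] [CompleteSpace X₁]

/-- The graph norm of `A` (with respect to the embedding `ι : X₁ → X₀`) is equivalent to
the norm of `X₁`. -/
def GraphNormEquiv (ι A : X₁ →L[ℂ] X₀) : Prop :=
  ∃ c₁ > (0 : ℝ), ∃ c₂ > (0 : ℝ), ∀ x : X₁,
    c₁ * ‖x‖ ≤ ‖ι x‖ + ‖A x‖ ∧ ‖ι x‖ + ‖A x‖ ≤ c₂ * ‖x‖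

/-- Membership (of the pair `(u, u')`, `u'` being the weak derivative of `u`) in the maximal
regularity class `E_{1,μ}(s) = W^1_{p,μ}(s;X₀) ∩ L_{p,μ}(s;X₁)`, where `ι : X₁ → X₀` is the
embedding. -/
def MemE (p μ : ℝ) (s : Set ℝ) (ι : X₁ →L[ℂ] X₀) (u : ℝ → X₁) (u' : ℝ → X₀) : Prop :=
  MemWLp p μ s u ∧ MemWLp p μ s (fun t => ι (u t)) ∧ MemWLp p μ s u' ∧
    IsWeakDeriv s (fun t => ι (u t)) u'

/-- The norm of the maximal regularity class `E_{1,μ}(s)`. -/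
def eNorm (p μ : ℝ) (s : Set ℝ) (u : ℝ → X₁) (u' : ℝ → X₀) : ℝ :=
  (wLpNorm p μ s u ^ p + wLpNorm p μ s u' ^ p) ^ (1 / p)

/-- `(u, u')` (with `u'` the weak derivative of `u`) solves the linear problem
`u̇ + A u = f` a.e. on `s`, `u(0) = x`, in the class `E_{1,μ}(s)`. -/
def IsLinSol (p μ : ℝ) (s : Set ℝ) (ι A : X₁ →L[ℂ] X₀) (f : ℝ → X₀) (x : X₀)
    (u : ℝ → X₁) (u' : ℝ → X₀) : Prop :=
  MemE p μ s ι u u' ∧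
    (∀ᵐ t ∂(volume.restrict s), u' t + A (u t) = f t) ∧
    HasTrace s (fun t => ι (u t)) x

/-- `A` has maximal `L_{p,μ}`-regularity, `A ∈ MR_{p,μ}(X₀)`: for every
`f ∈ L_{p,μ}(ℝ₊;X₀)` there is a solution `u ∈ W^1_{p,μ}(ℝ₊;X₀) ∩ L_{p,μ}(ℝ₊;X₁)` of
`u̇ + A u = f`, `u(0) = 0`, and it is unique (up to a.e. equality). -/
def MRw (p μ : ℝ) (ι A : X₁ →L[ℂ] X₀) : Prop :=
  ∀ f : ℝ → X₀, MemWLp p μ (Set.Ioi 0) f →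
    (∃ u u', IsLinSol p μ (Set.Ioi 0) ι A f 0 u u') ∧
    ∀ u₁ u₁' u₂ u₂', IsLinSol p μ (Set.Ioi 0) ι A f 0 u₁ u₁' →
      IsLinSol p μ (Set.Ioi 0) ι A f 0 u₂ u₂' →
      ∀ᵐ t ∂(volume.restrict (Set.Ioi 0)), u₁ t = u₂ t

/-- `x` belongs to the trace space `X_{γ,μ} = {u(0) : u ∈ E_{1,μ}}`. -/
def InTrace (p μ : ℝ) (ι : X₁ →L[ℂ] X₀) (x : X₀) : Prop :=
  ∃ u u', MemE p μ (Set.Ioi 0) ι u u' ∧ HasTrace (Set.Ioi 0) (fun t => ι (u t)) x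

/-- The trace norm `‖x‖_{X_{γ,μ}} = inf {‖u‖_{E_{1,μ}} : u ∈ E_{1,μ}, u(0) = x}`. -/
def traceNorm (p μ : ℝ) (ι : X₁ →L[ℂ] X₀) (x : X₀) : ℝ :=
  sInf {r : ℝ | ∃ u u', MemE p μ (Set.Ioi 0) ι u u' ∧
    HasTrace (Set.Ioi 0) (fun t => ι (u t)) x ∧ r = eNorm p μ (Set.Ioi 0) u u'}


set_option linter.all false

/-- Rising sun lemma, purely topological form. -/
lemma rs_top (G : ℝ → ℝ) (hG : Continuous G)
    (hbot : ∀ c : ℝ, ∃ N : ℝ, ∀ y ≤ N, c < G y) (htop : ∀ c : ℝ, ∀ x : ℝ, ∃ y > x, G y < c) :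
    ∃ O : Set ℝ, IsOpen O ∧ (∀ x ∉ O, ∀ y < x, G x ≤ G y) ∧
      ∃ J : Set (ℝ × ℝ), J.Countable ∧ (∀ j ∈ J, j.1 < j.2 ∧ j.1 ∉ O ∧ G j.1 = G j.2) ∧
        J.PairwiseDisjoint (fun j => Ioo j.1 j.2) ∧ O = ⋃ j ∈ J, Ioo j.1 j.2 := by
  set O : Set ℝ := {x | ∃ y < x, G y < G x} with hO
  have hOopen : IsOpen O := by
    have : O = ⋃ y, (Ioi y ∩ G ⁻¹' (Ioi (G y))) := by
      ext x; simp [hO]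
    rw [this]
    exact isOpen_iUnion fun y => isOpen_Ioi.inter (isOpen_Ioi.preimage hG)
  have hnot : ∀ x, x ∉ O ↔ ∀ y < x, G x ≤ G y := by
    intro x; simp [hO]
  -- argmin
  have argmin : ∀ x, ∃ z ≤ x, (∀ y ≤ x, G z ≤ G y) := by
    intro x
    obtain ⟨N, hN⟩ := hbot (G x)
    have hNx : N < x := by
      by_contra h
      exact lt_irrefl _ (hN x (not_lt.1 h))
    obtain ⟨z, hz, hzmin⟩ := (isCompact_Icc (a := N) (b := x)).exists_isMinOn
      ⟨x, hNx.le, le_rfl⟩ hG.continuousOn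
    refine ⟨z, hz.2, fun y hy => ?_⟩
    by_cases h : N ≤ y
    · exact hzmin ⟨h, hy⟩
    · exact (hzmin ⟨hNx.le, le_rfl⟩).trans (hN y (not_le.1 h).le).le
  have hleft : ∀ x, ∃ z ≤ x, z ∉ O := by
    intro x
    obtain ⟨z, hz, h⟩ := argmin x
    exact ⟨z, hz, (hnot z).2 fun y hy => h y (hy.le.trans hz)⟩
  have hright : ∀ x, ∃ z ≥ x, z ∉ O := by
    intro x
    obtain ⟨z, hz, h⟩ := argmin x
    obtain ⟨b, hb, hGb⟩ := htop (G z) x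
    obtain ⟨w, hw, h'⟩ := argmin b
    refine ⟨w, ?_, (hnot w).2 fun y hy => h' y (hy.le.trans hw)⟩
    by_contra hc
    have h1 := h w (not_le.1 hc).le
    have h2 := h' b le_rfl
    linarith
  set J : Set (ℝ × ℝ) := {j | j.1 < j.2 ∧ j.1 ∉ O ∧ j.2 ∉ O ∧ Ioo j.1 j.2 ⊆ O} with hJ
  have hdisj : J.PairwiseDisjoint (fun j => Ioo j.1 j.2) := by
    rintro ⟨a, b⟩ ⟨hab, ha, hb, hs⟩ ⟨c, d⟩ ⟨hcd, hc, hd, hs'⟩ hne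
    simp only at *
    refine Set.disjoint_left.2 ?_
    rintro x ⟨hx1, hx2⟩ ⟨hx3, hx4⟩
    simp only at *
    apply hne
    have h1 : a = c := by
      rcases lt_trichotomy a c with h | h | h
      · exact absurd (hs ⟨h, by linarith⟩) hc
      · exact h
      · exact absurd (hs' ⟨h, by linarith⟩) ha
    have h2 : b = d := by
      rcases lt_trichotomy b d with h | h | h
      · exact absurd (hs' ⟨by linarith, h⟩) hb
      · exact h
      · exact absurd (hs ⟨by linarith, h⟩) hd
    rw [h1, h2]
  refine ⟨O, hOopen, fun x hx => (hnot x).1 hx, J, ?_, ?_, hdisj, ?_⟩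
  · exact hdisj.countable_of_isOpen (fun _ _ => isOpen_Ioo) (fun j hj => nonempty_Ioo.2 hj.1)
  · rintro ⟨a, b⟩ ⟨hab, ha, hb, hs⟩
    refine ⟨hab, ha, le_antisymm ?_ ((hnot b).1 hb a hab)⟩
    by_contra hlt
    simp only [not_le] at hlt hab
    have hev : ∀ᶠ x in nhdsWithin b (Iio b), G x < G a :=
      (hG.continuousAt.eventually_lt_const hlt).filter_mono nhdsWithin_le_nhds
    obtain ⟨x, hx, hxa, hxb⟩ := (hev.and (Ioo_mem_nhdsLT hab)).exists
    obtain ⟨z, hz, hzmin⟩ := (isCompact_Icc (a := a) (b := x)).exists_isMinOn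
      ⟨x, hxa.le, le_rfl⟩ hG.continuousOn
    have hzx : G z ≤ G x := hzmin ⟨hxa.le, le_rfl⟩
    have hza : a ≠ z := by rintro rfl; linarith
    have hza' : a < z := lt_of_le_of_ne hz.1 hza
    have : z ∈ O := hs ⟨hza', hz.2.trans_lt hxb⟩
    refine (hnot z).2 (fun y hy => ?_) this
    by_cases h : a ≤ y
    · exact hzmin ⟨h, hy.le.trans hz.2⟩
    · have := (hnot a).1 ha y (not_le.1 h)
      linarith
  · ext x
    simp only [mem_iUnion, exists_prop]
    constructor
    · intro hx
      have hcl : IsClosed Oᶜ := hOopen.isClosed_compl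
      obtain ⟨l, hl, hlO⟩ := hleft x
      obtain ⟨r, hr, hrO⟩ := hright x
      have hA : sSup (Oᶜ ∩ Iic x) ∈ Oᶜ ∩ Iic x :=
        (hcl.inter isClosed_Iic).csSup_mem ⟨l, hlO, hl⟩ ⟨x, fun y hy => hy.2⟩
      have hB : sInf (Oᶜ ∩ Ici x) ∈ Oᶜ ∩ Ici x :=
        (hcl.inter isClosed_Ici).csInf_mem ⟨r, hrO, hr⟩ ⟨x, fun y hy => hy.2⟩
      have hAx : sSup (Oᶜ ∩ Iic x) < x :=
        lt_of_le_of_ne hA.2 (fun h => hA.1 (by rw [h]; exact hx))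
      have hBx : x < sInf (Oᶜ ∩ Ici x) :=
        lt_of_le_of_ne hB.2 (fun h => hB.1 (by rw [← h]; exact hx))
      refine ⟨(sSup (Oᶜ ∩ Iic x), sInf (Oᶜ ∩ Ici x)), ⟨hAx.trans hBx, hA.1, hB.1, ?_⟩, hAx, hBx⟩
      rintro y ⟨hy1, hy2⟩
      by_contra hyO
      rcases le_total y x with h | h
      · exact absurd (le_csSup ⟨x, fun y hy => hy.2⟩ (⟨hyO, h⟩ : y ∈ Oᶜ ∩ Iic x)) (not_le.2 hy1)
      · exact absurd (csInf_le ⟨x, fun y hy => hy.2⟩ (⟨hyO, h⟩ : y ∈ Oᶜ ∩ Ici x)) (not_le.2 hy2)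
    · rintro ⟨j, hj, hx⟩
      exact hj.2.2.2 hx

/-- Rising sun decomposition for a nonnegative integrable function. -/
lemma rs_main (a : ℝ → ℝ) (ha : Integrable a) (ha0 : ∀ x, 0 ≤ a x) (l : ℝ) (hl : 0 < l) :
    ∃ O : Set ℝ, IsOpen O ∧ (∀ x ∉ O, ∀ y < x, ∫ s in Ioc y x, a s ≤ l * (x - y)) ∧
      (∀ᵐ x, x ∉ O → a x ≤ l) ∧
      ∃ J : Set (ℝ × ℝ), J.Countable ∧
        (∀ j ∈ J, j.1 < j.2 ∧ j.1 ∉ O ∧ ∫ s in Ioo j.1 j.2, a s = l * (j.2 - j.1)) ∧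
        J.PairwiseDisjoint (fun j => Ioo j.1 j.2) ∧ O = ⋃ j ∈ J, Ioo j.1 j.2 := by
  have hii : ∀ x y, IntervalIntegrable a volume x y := fun x y => ha.intervalIntegrable
  set G : ℝ → ℝ := fun x => (∫ s in (0:ℝ)..x, a s) - l * x with hGdef
  have hdiff : ∀ x y, y ≤ x → G x - G y = (∫ s in Ioc y x, a s) - l * (x - y) := by
    intro x y h
    rw [← intervalIntegral.integral_of_le h,
      ← intervalIntegral.integral_interval_sub_left (hii 0 x) (hii 0 y)]
    simp only [hGdef]; ring
  have hGc : Continuous G := by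
    refine (intervalIntegral.continuous_primitive hii 0).sub (by fun_prop)
  set I := ∫ s, a s with hI
  have hbd : ∀ x, |∫ s in (0:ℝ)..x, a s| ≤ I := by
    intro x
    calc |∫ s in (0:ℝ)..x, a s| ≤ ∫ s in uIoc 0 x, ‖a s‖ := by
          simpa using intervalIntegral.norm_integral_le_integral_norm_uIoc (f := a) (a := 0) (b := x) (μ := volume)
      _ = ∫ s in uIoc 0 x, a s := by
          congr 1; ext s; simp [abs_of_nonneg (ha0 s)]
      _ ≤ I := setIntegral_le_integral ha (Filter.Eventually.of_forall ha0)
  obtain ⟨O, hO, hO1, J, hJ1, hJ2, hJ3, hJ4⟩ := rs_top G hGc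
    (by
      intro c
      refine ⟨-(c + I + 1) / l, fun y hy => ?_⟩
      have := (abs_le.1 (hbd y)).1
      rw [le_div_iff₀ hl] at hy
      simp only [hGdef]; nlinarith)
    (by
      intro c x
      refine ⟨max (x + 1) ((I - c + 1) / l), lt_of_lt_of_le (by linarith) (le_max_left _ _), ?_⟩
      have h2 := le_max_right (x + 1) ((I - c + 1) / l)
      have := (abs_le.1 (hbd (max (x + 1) ((I - c + 1) / l)))).2
      rw [div_le_iff₀ hl] at h2
      simp only [hGdef]; nlinarith)
  have hO1' : ∀ x ∉ O, ∀ y < x, ∫ s in Ioc y x, a s ≤ l * (x - y) := by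
    intro x hx y hy
    have h1 := hO1 x hx y hy
    have h2 := hdiff x y hy.le
    linarith
  refine ⟨O, hO, hO1', ?_, J, hJ1, ?_, hJ3, hJ4⟩
  · filter_upwards [_root_.LocallyIntegrable.ae_hasDerivAt_integral ha.locallyIntegrable] with x hx hxO
    have h := (hasDerivAt_iff_tendsto_slope_left_right.1 (hx 0)).1
    refine le_of_tendsto h ?_
    filter_upwards [self_mem_nhdsWithin] with y hy
    have hy' : y < x := hy
    have h1 := hO1 x hxO y hy'
    simp only [hGdef] at h1
    rw [slope_comm, slope_def_field, div_le_iff₀ (by linarith)]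
    nlinarith
  · intro j hj
    obtain ⟨h1, h2, h3⟩ := hJ2 j hj
    refine ⟨h1, h2, ?_⟩
    have := hdiff j.2 j.1 h1.le
    rw [← integral_Ioc_eq_integral_Ioo]
    linarith


lemma rs_full (a : ℝ → ℝ) (ha : Integrable a) (ham : Measurable a) (ha0 : ∀ x, 0 ≤ a x)
    (l : ℝ) (hl : 0 < l) :
    ∃ O : Set ℝ, IsOpen O ∧ (∀ x ∉ O, ∀ y < x, ∫ s in Ioc y x, a s ≤ l * (x - y)) ∧
      (∀ᵐ x, x ∉ O → a x ≤ l) ∧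
      volume O ≤ ENNReal.ofReal (2 / l) * ∫⁻ x in {x | l / 2 < a x}, ENNReal.ofReal (a x) ∧
      volume O < ⊤ ∧
      ∃ J : Set (ℝ × ℝ), J.Countable ∧
        (∀ j ∈ J, j.1 < j.2 ∧ j.1 ∉ O ∧ ∫ s in Ioo j.1 j.2, a s = l * (j.2 - j.1)) ∧
        J.PairwiseDisjoint (fun j => Ioo j.1 j.2) ∧ O = ⋃ j ∈ J, Ioo j.1 j.2 := by
  obtain ⟨O, hO, h1, h2, J, hJc, hJ, hJd, hJO⟩ := rs_main a ha ha0 l hl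
  have hlO : ENNReal.ofReal l * volume O = ∫⁻ x in O, ENNReal.ofReal (a x) := by
    rw [hJO, measure_biUnion hJc hJd (fun _ _ => measurableSet_Ioo),
      lintegral_biUnion hJc (fun _ _ => measurableSet_Ioo) hJd, ← ENNReal.tsum_mul_left]
    congr 1; ext j
    obtain ⟨h3, h4, h5⟩ := hJ j j.2
    rw [← ofReal_integral_eq_lintegral_ofReal ha.integrableOn
      (Filter.Eventually.of_forall ha0), h5, Real.volume_Ioo, ENNReal.ofReal_mul hl.le]
  have hafin : ∫⁻ x, ENNReal.ofReal (a x) < ⊤ := by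
    rw [← ofReal_integral_eq_lintegral_ofReal ha (Filter.Eventually.of_forall ha0)]
    exact ENNReal.ofReal_lt_top
  have hl0 : ENNReal.ofReal l ≠ 0 := by simpa using hl
  have hOfin : volume O < ⊤ := by
    by_contra h
    have h' : volume O = ⊤ := by simpa using h
    rw [h', ENNReal.mul_top hl0] at hlO
    have := (setLIntegral_le_lintegral O fun x => ENNReal.ofReal (a x)).trans_lt hafin
    rw [← hlO] at this
    simp at this
  refine ⟨O, hO, h1, h2, ?_, hOfin, J, hJc, hJ, hJd, hJO⟩
  have hms : MeasurableSet {x | l / 2 < a x} := measurableSet_lt measurable_const ham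
  have key : ENNReal.ofReal l * volume O ≤
      (∫⁻ x in {x | l / 2 < a x}, ENNReal.ofReal (a x)) + ENNReal.ofReal (l / 2) * volume O := by
    rw [hlO]
    calc ∫⁻ x in O, ENNReal.ofReal (a x)
        ≤ ∫⁻ x in O, ({x | l / 2 < a x}.indicator (fun x => ENNReal.ofReal (a x)) x
            + ENNReal.ofReal (l / 2)) := by
          refine lintegral_mono fun x => ?_
          by_cases h : l / 2 < a x
          · simp [indicator, h]
          · simp only [indicator, mem_ofPred_eq, h, if_false, zero_add]
            exact ENNReal.ofReal_le_ofReal (not_lt.1 h)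
      _ = (∫⁻ x in O, {x | l / 2 < a x}.indicator (fun x => ENNReal.ofReal (a x)) x)
            + ENNReal.ofReal (l / 2) * volume O := by
          rw [lintegral_add_right _ measurable_const]; simp
      _ ≤ _ := by
          refine add_le_add ?_ le_rfl
          rw [← lintegral_indicator hms]
          exact setLIntegral_le_lintegral _ _
  have e1 : ENNReal.ofReal l * volume O =
      ENNReal.ofReal (l / 2) * volume O + ENNReal.ofReal (l / 2) * volume O := by
    rw [← add_mul, ← ENNReal.ofReal_add (by positivity) (by positivity)]; congr 2; ring
  rw [e1] at key
  have hfin2 : ENNReal.ofReal (l / 2) * volume O ≠ ⊤ :=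
    ENNReal.mul_ne_top ENNReal.ofReal_ne_top hOfin.ne
  have key2 := (ENNReal.add_le_add_iff_right hfin2).1 key
  calc volume O = ENNReal.ofReal (2 / l) * (ENNReal.ofReal (l / 2) * volume O) := by
        rw [← mul_assoc, ← ENNReal.ofReal_mul (by positivity)]
        have : 2 / l * (l / 2) = 1 := by field_simp
        rw [this]; simp
    _ ≤ _ := by gcongr

lemma lc_pt1 (b c q r : ℝ) (hb : 0 ≤ b) (hc : 0 < c) (hr : 0 < r) (hrq : r < q) :
    ∫⁻ l in Ioi (0:ℝ), {l : ℝ | c * l < b}.indicator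
      (fun l => ENNReal.ofReal (l ^ (q - 1 - r)) * ENNReal.ofReal (b ^ r)) l
     ≤ ENNReal.ofReal (c ^ (-(q - r)) / (q - r)) * ENNReal.ofReal (b ^ q) := by
  have hset : {l : ℝ | c * l < b} = Iio (b / c) := by
    ext l; simp [lt_div_iff₀ hc, mul_comm]
  have hbc : 0 ≤ b / c := by positivity
  rw [hset, lintegral_indicator measurableSet_Iio, Measure.restrict_restrict measurableSet_Iio,
    Iio_inter_Ioi, lintegral_mul_const _ (by fun_prop)]
  have hint : IntegrableOn (fun l : ℝ => l ^ (q - 1 - r)) (Ioo 0 (b / c)) := by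
    rw [← integrableOn_Ioc_iff_integrableOn_Ioo, ← intervalIntegrable_iff_integrableOn_Ioc_of_le hbc]
    exact intervalIntegral.intervalIntegrable_rpow' (by linarith)
  rw [← ofReal_integral_eq_lintegral_ofReal hint
    ((ae_restrict_iff' measurableSet_Ioo).2 (Filter.Eventually.of_forall fun l hl =>
      Real.rpow_nonneg hl.1.le _)), ← integral_Ioc_eq_integral_Ioo,
    ← intervalIntegral.integral_of_le hbc, integral_rpow (Or.inl (by linarith)),
    ← ENNReal.ofReal_mul' (by positivity), ← ENNReal.ofReal_mul' (by positivity)]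
  apply ENNReal.ofReal_le_ofReal
  have e : q - 1 - r + 1 = q - r := by ring
  rw [e, Real.zero_rpow (by linarith), sub_zero, Real.div_rpow hb hc.le]
  rcases hb.eq_or_lt with rfl | hb'
  · rw [Real.zero_rpow (by linarith), Real.zero_rpow (by linarith), Real.zero_rpow (by linarith)]
    simp
  · apply le_of_eq
    rw [Real.rpow_neg hc.le, show b ^ q = b ^ (q - r) * b ^ r by
      rw [← Real.rpow_add hb']; ring_nf]
    field_simp

lemma lc_pt2 (b q r : ℝ) (hb : 0 ≤ b) (hq : 0 < q) (hrq : q < r) :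
    ∫⁻ l in Ioi (0:ℝ), {l : ℝ | b ≤ l}.indicator
      (fun l => ENNReal.ofReal (l ^ (q - 1 - r)) * ENNReal.ofReal (b ^ r)) l
     ≤ ENNReal.ofReal (1 / (r - q)) * ENNReal.ofReal (b ^ q) := by
  rcases hb.eq_or_lt with rfl | hb'
  · rw [Real.zero_rpow (by linarith : r ≠ 0)]
    simp
  have hset : {l : ℝ | b ≤ l} = Ici b := by ext l; simp
  rw [hset, lintegral_indicator measurableSet_Ici, Measure.restrict_restrict measurableSet_Ici,
    inter_eq_left.2 (show Ici b ⊆ Ioi 0 from fun x hx => lt_of_lt_of_le hb' (mem_Ici.1 hx)), lintegral_mul_const _ (by fun_prop),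
    setLIntegral_congr (Ioi_ae_eq_Ici (a := b) (μ := volume)).symm]
  have hint : IntegrableOn (fun l : ℝ => l ^ (q - 1 - r)) (Ioi b) :=
    integrableOn_Ioi_rpow_of_lt (by linarith) hb'
  rw [← ofReal_integral_eq_lintegral_ofReal hint
    ((ae_restrict_iff' measurableSet_Ioi).2 (Filter.Eventually.of_forall fun l (hl : b < l) =>
      Real.rpow_nonneg (hb'.trans hl).le _)), integral_Ioi_rpow_of_lt (by linarith) hb',
    ← ENNReal.ofReal_mul' (by positivity), ← ENNReal.ofReal_mul' (by positivity)]
  apply ENNReal.ofReal_le_ofReal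
  have e : q - 1 - r + 1 = q - r := by ring
  apply le_of_eq
  rw [e, show b ^ q = b ^ (q - r) * b ^ r by rw [← Real.rpow_add hb']; ring_nf]
  have h1 : q - r ≠ 0 := by linarith
  have h2 : r - q ≠ 0 := by linarith
  field_simp
  ring

lemma lc_gen (a : ℝ → ℝ) (ham : Measurable a) (q r : ℝ) (E : Set (ℝ × ℝ)) (hE : MeasurableSet E)
    (K : ENNReal)
    (h : ∀ x, ∫⁻ l in Ioi (0:ℝ), {l : ℝ | (l, x) ∈ E}.indicator
      (fun l => ENNReal.ofReal (l ^ (q - 1 - r)) * ENNReal.ofReal (a x ^ r)) l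
     ≤ K * ENNReal.ofReal (a x ^ q)) :
    ∫⁻ l in Ioi (0:ℝ), (ENNReal.ofReal (l ^ (-r)) *
      ∫⁻ x in {x | (l, x) ∈ E}, ENNReal.ofReal (a x ^ r)) * ENNReal.ofReal (l ^ (q - 1))
     ≤ K * ∫⁻ x, ENNReal.ofReal (a x ^ q) := by
  have hsl : ∀ l, MeasurableSet {x | (l, x) ∈ E} := fun l => measurable_prodMk_left hE
  calc _ = ∫⁻ l in Ioi (0:ℝ), ∫⁻ x, E.indicator (fun z => ENNReal.ofReal (z.1 ^ (q - 1 - r))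
            * ENNReal.ofReal (a z.2 ^ r)) (l, x) := by
        refine setLIntegral_congr_fun measurableSet_Ioi fun l (hl : 0 < l) => ?_
        rw [← lintegral_indicator (hsl l), mul_right_comm, ← ENNReal.ofReal_mul (by positivity),
          ← Real.rpow_add hl, ← lintegral_const_mul _
            ((by fun_prop : Measurable fun x => ENNReal.ofReal (a x ^ r)).indicator (hsl l))]
        refine lintegral_congr fun x => ?_
        by_cases hx : (l, x) ∈ E
        · simp only [indicator, mem_ofPred_eq, hx, if_true]; congr 3; ring
        · simp [indicator, hx]
    _ = ∫⁻ x, ∫⁻ l in Ioi (0:ℝ), E.indicator (fun z => ENNReal.ofReal (z.1 ^ (q - 1 - r))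
            * ENNReal.ofReal (a z.2 ^ r)) (l, x) := by
        rw [lintegral_lintegral_swap]
        refine Measurable.aemeasurable ?_
        exact (Measurable.indicator (by fun_prop) hE)
    _ ≤ ∫⁻ x, K * ENNReal.ofReal (a x ^ q) := lintegral_mono fun x => h x
    _ = _ := by rw [lintegral_const_mul _ (by fun_prop)]

lemma lc1 (a : ℝ → ℝ) (ham : Measurable a) (ha0 : ∀ x, 0 ≤ a x) (c q r : ℝ) (hc : 0 < c)
    (hr : 0 < r) (hrq : r < q) :
    ∫⁻ l in Ioi (0:ℝ), (ENNReal.ofReal (l ^ (-r)) *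
      ∫⁻ x in {x | c * l < a x}, ENNReal.ofReal (a x ^ r)) * ENNReal.ofReal (l ^ (q - 1))
     ≤ ENNReal.ofReal (c ^ (-(q - r)) / (q - r)) * ∫⁻ x, ENNReal.ofReal (a x ^ q) :=
  lc_gen a ham q r {z | c * z.1 < a z.2} (measurableSet_lt (by fun_prop) (by fun_prop)) _
    (fun x => lc_pt1 (a x) c q r (ha0 x) hc hr hrq)

lemma lc2 (a : ℝ → ℝ) (ham : Measurable a) (ha0 : ∀ x, 0 ≤ a x) (q r : ℝ) (hq : 0 < q)
    (hrq : q < r) :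
    ∫⁻ l in Ioi (0:ℝ), (ENNReal.ofReal (l ^ (-r)) *
      ∫⁻ x in {x | a x ≤ l}, ENNReal.ofReal (a x ^ r)) * ENNReal.ofReal (l ^ (q - 1))
     ≤ ENNReal.ofReal (1 / (r - q)) * ∫⁻ x, ENNReal.ofReal (a x ^ q) :=
  lc_gen a ham q r {z | a z.2 ≤ z.1} (measurableSet_le (by fun_prop) (by fun_prop)) _
    (fun x => lc_pt2 (a x) q r (ha0 x) hq hrq)

lemma lc0 (F : ℝ → ℝ) (hF : AEMeasurable F) (hF0 : ∀ x, 0 ≤ F x) (q L : ℝ) (hq : 0 < q)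
    (hL : 0 < L) :
    ∫⁻ x, ENNReal.ofReal (F x ^ q) = ENNReal.ofReal (L ^ q * q) *
      ∫⁻ l in Ioi (0:ℝ), volume {x | L * l < F x} * ENNReal.ofReal (l ^ (q - 1)) := by
  have h := lintegral_rpow_eq_lintegral_meas_lt_mul volume (f := fun x => F x / L)
    (Filter.Eventually.of_forall fun x => div_nonneg (hF0 x) hL.le) (hF.div_const L) hq
  have e : ∀ l, {x | l < F x / L} = {x | L * l < F x} := by
    intro l; ext x; simp [lt_div_iff₀ hL, mul_comm]
  simp only [e] at h
  rw [ENNReal.ofReal_mul (by positivity), mul_assoc, ← h, ← lintegral_const_mul' _ _ ENNReal.ofReal_ne_top]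
  refine lintegral_congr fun x => ?_
  rw [← ENNReal.ofReal_mul (by positivity), Real.div_rpow (hF0 x) hL.le]
  congr 1
  have : L ^ q ≠ 0 := by positivity
  field_simp


section
variable {X : Type*} [NormedAddCommGroup X] [NormedSpace ℝ X]

lemma rpow_add_le' {a b p : ℝ} (ha : 0 ≤ a) (hb : 0 ≤ b) (hp : 1 ≤ p) :
    (a + b) ^ p ≤ 2 ^ (p - 1) * (a ^ p + b ^ p) := by
  have := NNReal.rpow_add_le_mul_rpow_add_rpow ⟨a, ha⟩ ⟨b, hb⟩ hp
  exact_mod_cast this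

/-- Convolution with an operator family. -/
noncomputable def cv (S : ℝ → X →L[ℝ] X) (g : ℝ → X) (t : ℝ) : X := ∫ s, S (t - s) (g s)

/-- Nice sources. -/
structure Nice (g : ℝ → X) : Prop where
  sm : StronglyMeasurable g
  int : Integrable g
  bdd : ∃ B : ℝ, ∀ t, ‖g t‖ ≤ B
  neg : ∀ t ≤ 0, g t = 0

/-- Bounded semigroup with kernel estimates. -/
structure SGData (R : X →L[ℝ] X) (S : ℝ → X →L[ℝ] X) (M C p : ℝ) : Prop where
  hM : 0 ≤ M
  hC : 0 ≤ C
  hp : 1 < p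
  neg : ∀ t < 0, S t = 0
  bd : ∀ t x, ‖S t x‖ ≤ M * ‖x‖
  sg : ∀ s t, 0 ≤ s → 0 ≤ t → ∀ x, S (s + t) x = S s (S t x)
  cont : ∀ x, ContinuousOn (fun t => S t x) (Ici 0)
  dec : ∀ t > 0, ∀ x, ‖S t x‖ ≤ C / t * ‖R x‖
  smooth : ∀ s t, 0 < s → s ≤ t → ∀ x, ‖S t x - S s x‖ ≤ C * (t - s) / s ^ 2 * ‖R x‖
  lp : ∀ g, Nice g → ∫⁻ t, ENNReal.ofReal (‖cv S g t‖ ^ p) ≤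
    ENNReal.ofReal C * ∫⁻ t, ENNReal.ofReal (‖R (g t)‖ ^ p)

lemma Nice.indicator {g : ℝ → X} (hg : Nice g) {s : Set ℝ} (hs : MeasurableSet s) :
    Nice (s.indicator g) := by
  obtain ⟨B, hB⟩ := hg.bdd
  refine ⟨hg.sm.indicator hs, hg.int.indicator hs, ⟨B, fun t => ?_⟩, fun t ht => ?_⟩
  · exact (norm_indicator_le_norm_self _ _).trans (hB t)
  · simp [Set.indicator, hg.neg t ht]

lemma cont_joint {S : ℝ → X →L[ℝ] X} {M : ℝ} (bd : ∀ t x, ‖S t x‖ ≤ M * ‖x‖)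
    (cont : ∀ x, ContinuousOn (fun t => S t x) (Ici 0)) :
    Continuous (fun z : ℝ × X => S (max z.1 0) z.2) := by
  have h1 : ∀ x, Continuous (fun t : ℝ => S (max t 0) x) := fun x =>
    (cont x).comp_continuous (by fun_prop) (fun t => mem_Ici.2 (le_max_right _ _))
  have hM : 0 ≤ max M 0 := le_max_right _ _
  rw [continuous_iff_continuousAt]
  rintro ⟨t, x⟩
  have h2 : Filter.Tendsto (fun z : ℝ × X => S (max z.1 0) x) (nhds (t, x))
      (nhds (S (max t 0) x)) := ((h1 x).comp continuous_fst).continuousAt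
  have h3 : Filter.Tendsto (fun z : ℝ × X => S (max z.1 0) (z.2 - x)) (nhds (t, x)) (nhds 0) := by
    refine squeeze_zero_norm (a := fun z : ℝ × X => max M 0 * ‖z.2 - x‖) (fun z => ?_) ?_
    · exact (bd _ _).trans (by gcongr; exact le_max_left _ _)
    · have : Continuous (fun z : ℝ × X => max M 0 * ‖z.2 - x‖) := by fun_prop
      simpa using this.tendsto (t, x)
  have := h2.add h3
  simpa [ContinuousAt] using this

lemma sm_joint {S : ℝ → X →L[ℝ] X} {M : ℝ} (bd : ∀ t x, ‖S t x‖ ≤ M * ‖x‖)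
    (cont : ∀ x, ContinuousOn (fun t => S t x) (Ici 0)) (neg : ∀ t < 0, S t = 0)
    {g : ℝ → X} (hg : StronglyMeasurable g) :
    StronglyMeasurable (fun z : ℝ × ℝ => S (z.1 - z.2) (g z.2)) := by
  have h0 : StronglyMeasurable (fun z : ℝ × ℝ => (z.1 - z.2, g z.2)) :=
    (by fun_prop : Continuous fun z : ℝ × ℝ => z.1 - z.2).stronglyMeasurable.prodMk
      (hg.comp_measurable measurable_snd)
  have h := (cont_joint bd cont).comp_stronglyMeasurable h0
  have hs : MeasurableSet {z : ℝ × ℝ | z.2 ≤ z.1} := measurableSet_le measurable_snd measurable_fst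
  have := h.indicator hs
  convert this using 1
  ext z
  by_cases hz : z.2 ≤ z.1
  · simp [Set.indicator, hz]
  · simp [Set.indicator, hz, neg (z.1 - z.2) (by linarith [not_le.1 hz])]

namespace SGData
variable {R : X →L[ℝ] X} {S : ℝ → X →L[ℝ] X} {M C p : ℝ} [CompleteSpace X] (D : SGData R S M C p)
include D

lemma integrable {g : ℝ → X} (hg : Nice g) (t : ℝ) : Integrable (fun s => S (t - s) (g s)) := by
  refine (hg.int.norm.const_mul M).mono'
    ((sm_joint D.bd D.cont D.neg hg.sm).comp_measurable
      (measurable_prodMk_left (x := t))).aestronglyMeasurable ?_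
  exact Filter.Eventually.of_forall fun s => D.bd _ _

lemma cv_sm {g : ℝ → X} (hg : Nice g) : StronglyMeasurable (cv S g) :=
  (sm_joint D.bd D.cont D.neg hg.sm).integral_prod_right'

lemma cv_bdd {g : ℝ → X} (hg : Nice g) (t : ℝ) : ‖cv S g t‖ ≤ M * ∫ s, ‖g s‖ := by
  rw [← integral_const_mul]
  exact norm_integral_le_of_norm_le (hg.int.norm.const_mul M)
    (Filter.Eventually.of_forall fun s => D.bd _ _)

lemma cv_add {g h : ℝ → X} (hg : Nice g) (hh : Nice h) (t : ℝ) :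
    cv S (fun s => g s + h s) t = cv S g t + cv S h t := by
  simp only [cv, map_add]
  exact integral_add (D.integrable hg t) (D.integrable hh t)

lemma cv_congr {g h : ℝ → X} {t : ℝ} (hgh : ∀ s ≤ t, g s = h s) : cv S g t = cv S h t := by
  simp only [cv]
  congr 1; ext s
  by_cases hs : s ≤ t
  · rw [hgh s hs]
  · simp [D.neg (t - s) (by linarith [not_le.1 hs])]

lemma cv_neg {g : ℝ → X} (hg : Nice g) {t : ℝ} (ht : t ≤ 0) : cv S g t = 0 := by
  rw [D.cv_congr (h := fun _ => 0) (fun s hs => hg.neg s (hs.trans ht))]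
  simp [cv]

lemma Rg_meas {g : ℝ → X} (hg : Nice g) : Measurable (fun t => ‖R (g t)‖) :=
  (R.continuous.comp_stronglyMeasurable hg.sm).norm.measurable

lemma Rg_rpow_int {g : ℝ → X} (hg : Nice g) {q : ℝ} (hq : 1 ≤ q) :
    Integrable (fun t => ‖R (g t)‖ ^ q) := by
  obtain ⟨B, hB⟩ := hg.bdd
  have hB0 : 0 ≤ B := (norm_nonneg _).trans (hB 0)
  have hRB : ∀ t, ‖R (g t)‖ ≤ ‖R‖ * B := fun t =>
    (R.le_opNorm _).trans (by gcongr; exact hB t)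
  refine ((R.integrable_comp hg.int).norm.const_mul ((‖R‖ * B) ^ (q - 1))).mono'
    ((D.Rg_meas hg).pow_const q).aestronglyMeasurable (Filter.Eventually.of_forall fun t => ?_)
  rw [Real.norm_of_nonneg (by positivity)]
  rcases (norm_nonneg (R (g t))).eq_or_lt with h | h
  · rw [← h, Real.zero_rpow (by linarith)]; simp
  · have : ‖R (g t)‖ ^ q = ‖R (g t)‖ ^ (q - 1) * ‖R (g t)‖ := by
      rw [← Real.rpow_add_one h.ne']; ring_nf
    rw [this]
    gcongr ?_ * _
    exact Real.rpow_le_rpow h.le (hRB t) (by linarith)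

lemma F_int {g : ℝ → X} (hg : Nice g) : Integrable (fun t => ‖cv S g t‖ ^ p) := by
  refine ⟨((D.cv_sm hg).norm.measurable.pow_const p).aestronglyMeasurable, ?_⟩
  rw [hasFiniteIntegral_iff_ofReal (Filter.Eventually.of_forall fun t => by positivity)]
  refine (D.lp g hg).trans_lt (ENNReal.mul_lt_top ENNReal.ofReal_lt_top ?_)
  have := (D.Rg_rpow_int hg D.hp.le).2
  rwa [hasFiniteIntegral_iff_ofReal (Filter.Eventually.of_forall fun t => by positivity)] at this

lemma lp_real {g : ℝ → X} (hg : Nice g) :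
    ∫ t, ‖cv S g t‖ ^ p ≤ C * ∫ t, ‖R (g t)‖ ^ p := by
  have h := D.lp g hg
  rw [← ofReal_integral_eq_lintegral_ofReal (D.F_int hg)
    (Filter.Eventually.of_forall fun t => by positivity),
    ← ofReal_integral_eq_lintegral_ofReal (D.Rg_rpow_int hg D.hp.le)
    (Filter.Eventually.of_forall fun t => by positivity), ← ENNReal.ofReal_mul D.hC] at h
  exact (ENNReal.ofReal_le_ofReal_iff (mul_nonneg D.hC (integral_nonneg fun t => by positivity))).1 h

/-- Local part of the good-lambda inequality, on one interval. -/
lemma good_local {g : ℝ → X} (hg : Nice g) {l γ α β : ℝ} (hl : 0 < l) (hγ : 0 < γ) (hγ1 : γ ≤ 1)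
    (hαβ : α < β)
    (hF : ∀ y < α, ∫ s in Ioc y α, ‖cv S g s‖ ^ p ≤ l ^ p * (α - y))
    (E : Set ℝ) (hE : IsOpen E)
    (hEa : ∀ x ∉ E, ∀ y < x, ∫ s in Ioc y x, ‖R (g s)‖ ^ p ≤ (γ * l) ^ p * (x - y))
    (L : ℝ) (hL : (L - 1) ^ p = M ^ p * 2 ^ (p - 1) * (1 + 2 * C)) (hL1 : 1 ≤ L) :
    volume {t | t ∈ Ioo α β ∧ t ∉ E ∧ L * l < ‖cv S g t‖}
      ≤ ENNReal.ofReal (2 * C * γ ^ p) * ENNReal.ofReal (β - α) := by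
  have hp0 : 0 < p := by linarith [D.hp]
  by_cases hne : (Eᶜ ∩ Icc α β).Nonempty
  swap
  · have : {t | t ∈ Ioo α β ∧ t ∉ E ∧ L * l < ‖cv S g t‖} = ∅ := by
      rw [eq_empty_iff_forall_notMem]
      rintro t ⟨h1, h2, -⟩
      exact hne ⟨t, h2, h1.1.le, h1.2.le⟩
    rw [this]; simp
  have hcpt : IsCompact (Eᶜ ∩ Icc α β) := isCompact_Icc.inter_left hE.isClosed_compl
  obtain ⟨x₁, hx₁, hmax⟩ := hcpt.exists_isGreatest hne
  have hmax' : ∀ t ∈ Ioo α β, t ∉ E → t ≤ x₁ := fun t ht htE => hmax ⟨htE, ht.1.le, ht.2.le⟩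
  set h := β - α with hh
  have hpos : 0 < h := by rw [hh]; linarith
  set t₀ := α - h with ht₀
  have hx1a : α ≤ x₁ := hx₁.2.1
  have hx1b : x₁ ≤ β := hx₁.2.2
  set g₁ : ℝ → X := (Ioc t₀ x₁).indicator g with hg₁
  set g₂ : ℝ → X := (Iic t₀).indicator g with hg₂
  have hn₁ : Nice g₁ := hg.indicator measurableSet_Ioc
  have hn₂ : Nice g₂ := hg.indicator measurableSet_Iic
  have hsplit : ∀ t ≤ x₁, cv S g t = cv S g₁ t + cv S g₂ t := by
    intro t ht
    rw [← D.cv_add hn₁ hn₂]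
    apply D.cv_congr
    intro s hs
    by_cases h1 : s ≤ t₀
    · simp [hg₁, hg₂, indicator, h1, not_lt.2 h1]
    · simp [hg₁, hg₂, indicator, h1, not_le.1 h1, hs.trans ht]
  have hy₁ : ∫ t, ‖cv S g₁ t‖ ^ p ≤ C * (2 * γ ^ p * l ^ p * h) := by
    refine (D.lp_real hn₁).trans (mul_le_mul_of_nonneg_left ?_ D.hC)
    have e : (fun t => ‖R (g₁ t)‖ ^ p) = (Ioc t₀ x₁).indicator (fun t => ‖R (g t)‖ ^ p) := by
      ext t
      by_cases ht : t ∈ Ioc t₀ x₁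
      · simp only [hg₁, indicator, ht, if_true]
      · simp only [hg₁, indicator, ht, if_false, map_zero, norm_zero, Real.zero_rpow hp0.ne']
    rw [e, integral_indicator measurableSet_Ioc]
    refine (hEa x₁ hx₁.1 t₀ (by linarith)).trans ?_
    rw [Real.mul_rpow hγ.le hl.le]
    have h3 : 0 ≤ γ ^ p * l ^ p := by positivity
    have h4 : x₁ - t₀ ≤ 2 * h := by linarith
    nlinarith
  -- semigroup evolution of the second part
  have hevo : ∀ r t, t₀ ≤ r → r ≤ t → cv S g₂ t = S (t - r) (cv S g₂ r) := by
    intro r t hr hrt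
    simp only [cv]
    rw [← ContinuousLinearMap.integral_comp_comm _ (D.integrable hn₂ r)]
    congr 1; ext s
    by_cases hs : s ≤ t₀
    · rw [← D.sg _ _ (by linarith) (by linarith)]; congr 2; ring
    · simp [hg₂, indicator, hs]
  have hF' : ∫ s in Ioc t₀ α, ‖cv S g s‖ ^ p ≤ l ^ p * h := by
    refine (hF t₀ (by linarith)).trans (le_of_eq (by rw [ht₀]; ring))
  have hy₂ : ∀ t, α < t → ‖cv S g₂ t‖ ≤ (L - 1) * l := by
    intro t ht
    have hpt : ∀ r ∈ Ioc t₀ α, ‖cv S g₂ t‖ ^ p ≤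
        M ^ p * 2 ^ (p - 1) * (‖cv S g r‖ ^ p + ‖cv S g₁ r‖ ^ p) := by
      intro r hr
      have h1 : ‖cv S g₂ t‖ ≤ M * (‖cv S g r‖ + ‖cv S g₁ r‖) := by
        rw [hevo r t hr.1.le (by linarith [hr.2])]
        refine (D.bd _ _).trans (mul_le_mul_of_nonneg_left ?_ D.hM)
        have : cv S g₂ r = cv S g r - cv S g₁ r := by
          rw [hsplit r (by linarith [hr.2])]; abel
        rw [this]; exact norm_sub_le _ _
      calc ‖cv S g₂ t‖ ^ p ≤ (M * (‖cv S g r‖ + ‖cv S g₁ r‖)) ^ p :=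
            Real.rpow_le_rpow (norm_nonneg _) h1 hp0.le
        _ = M ^ p * (‖cv S g r‖ + ‖cv S g₁ r‖) ^ p := Real.mul_rpow D.hM (by positivity)
        _ ≤ M ^ p * (2 ^ (p - 1) * (‖cv S g r‖ ^ p + ‖cv S g₁ r‖ ^ p)) := by
            have := D.hM
            gcongr
            exact rpow_add_le' (norm_nonneg _) (norm_nonneg _) D.hp.le
        _ = _ := by ring
    have hint : ∫ r in Ioc t₀ α, ‖cv S g₂ t‖ ^ p ≤ ∫ r in Ioc t₀ α,
        M ^ p * 2 ^ (p - 1) * (‖cv S g r‖ ^ p + ‖cv S g₁ r‖ ^ p) := by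
      refine setIntegral_mono_on (by simp) ?_ measurableSet_Ioc hpt
      exact (((D.F_int hg).add (D.F_int hn₁)).const_mul _).integrableOn
    rw [integral_const_mul, integral_add (D.F_int hg).integrableOn (D.F_int hn₁).integrableOn] at hint
    have hle : ∫ r in Ioc t₀ α, ‖cv S g₁ r‖ ^ p ≤ C * (2 * γ ^ p * l ^ p * h) :=
      (setIntegral_le_integral (D.F_int hn₁)
        (Filter.Eventually.of_forall fun t => by positivity)).trans hy₁
    have hγp : γ ^ p ≤ 1 := Real.rpow_le_one hγ.le hγ1 hp0.le
    have hlp : 0 < l ^ p := by positivity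
    have hMp : 0 ≤ M ^ p * 2 ^ (p - 1) := by have := D.hM; positivity
    have hconst : ∫ r in Ioc t₀ α, ‖cv S g₂ t‖ ^ p = h * ‖cv S g₂ t‖ ^ p := by
      have : α - t₀ = h := by rw [ht₀]; ring
      rw [setIntegral_const]; simp [this, hpos.le]
    rw [hconst] at hint
    have hC := D.hC
    have h5 : h * ‖cv S g₂ t‖ ^ p ≤ h * ((L - 1) * l) ^ p := by
      refine hint.trans ?_
      rw [Real.mul_rpow (by linarith) hl.le, hL]
      calc _ ≤ M ^ p * 2 ^ (p - 1) * (l ^ p * h + C * (2 * 1 * l ^ p * h)) := by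
            gcongr
            refine hle.trans ?_
            gcongr
        _ = _ := by ring
    have h6 := le_of_mul_le_mul_left h5 hpos
    exact (Real.rpow_le_rpow_iff (norm_nonneg _) (mul_nonneg (by linarith) hl.le) hp0).1 h6
  calc volume {t | t ∈ Ioo α β ∧ t ∉ E ∧ L * l < ‖cv S g t‖}
      ≤ volume {t | ENNReal.ofReal (l ^ p) ≤ ENNReal.ofReal (‖cv S g₁ t‖ ^ p)} := by
        apply measure_mono
        rintro t ⟨h1, h2, h3⟩
        apply ENNReal.ofReal_le_ofReal
        apply Real.rpow_le_rpow hl.le _ hp0.le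
        rw [hsplit t (hmax' t h1 h2)] at h3
        have h4 := hy₂ t h1.1
        have h5 := norm_add_le (cv S g₁ t) (cv S g₂ t)
        nlinarith
    _ ≤ (∫⁻ t, ENNReal.ofReal (‖cv S g₁ t‖ ^ p)) / ENNReal.ofReal (l ^ p) := by
        refine meas_ge_le_lintegral_div ?_ (by simp; positivity) ENNReal.ofReal_ne_top
        exact ((D.cv_sm hn₁).norm.measurable.pow_const p).ennreal_ofReal.aemeasurable
    _ ≤ ENNReal.ofReal (C * (2 * γ ^ p * l ^ p * h)) / ENNReal.ofReal (l ^ p) := by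
        gcongr
        rw [← ofReal_integral_eq_lintegral_ofReal (D.F_int hn₁)
          (Filter.Eventually.of_forall fun t => by positivity)]
        exact ENNReal.ofReal_le_ofReal hy₁
    _ = _ := by
        have hC := D.hC
        rw [← ENNReal.ofReal_div_of_pos (by positivity), ← ENNReal.ofReal_mul (by positivity)]
        congr 1
        have : l ^ p ≠ 0 := by positivity
        field_simp

end SGData
end


lemma lc_meas1 (a : ℝ → ℝ) (c q r : ℝ) (hc : 0 < c) :
    Measurable (fun l : ℝ => (ENNReal.ofReal (l ^ (-r)) *
      ∫⁻ x in {x | c * l < a x}, ENNReal.ofReal (a x ^ r)) * ENNReal.ofReal (l ^ (q - 1))) := by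
  have : Measurable (fun l : ℝ => ∫⁻ x in {x | c * l < a x}, ENNReal.ofReal (a x ^ r)) := by
    apply Antitone.measurable
    intro l l' hl
    apply lintegral_mono_set
    intro x hx
    have hx' : c * l' < a x := hx
    show c * l < a x
    nlinarith
  fun_prop

lemma lc_meas2 (a : ℝ → ℝ) (q r : ℝ) :
    Measurable (fun l : ℝ => (ENNReal.ofReal (l ^ (-r)) *
      ∫⁻ x in {x | a x ≤ l}, ENNReal.ofReal (a x ^ r)) * ENNReal.ofReal (l ^ (q - 1))) := by
  have : Measurable (fun l : ℝ => ∫⁻ x in {x | a x ≤ l}, ENNReal.ofReal (a x ^ r)) := by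
    apply Monotone.measurable
    intro l l' hl
    apply lintegral_mono_set
    intro x hx
    have hx' : a x ≤ l := hx
    show a x ≤ l'
    linarith
  fun_prop

section
variable {X : Type*} [NormedAddCommGroup X] [NormedSpace ℝ X]
namespace SGData
variable {R : X →L[ℝ] X} {S : ℝ → X →L[ℝ] X} {M C p : ℝ} [CompleteSpace X] (D : SGData R S M C p)
include D

lemma good_lam {g : ℝ → X} (hg : Nice g) {l γ : ℝ} (hl : 0 < l) (hγ : 0 < γ) (hγ1 : γ ≤ 1)
    (L : ℝ) (hL : (L - 1) ^ p = M ^ p * 2 ^ (p - 1) * (1 + 2 * C)) (hL1 : 1 ≤ L) :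
    volume {t | L * l < ‖cv S g t‖} ≤
      ENNReal.ofReal (2 * γ ^ (-p)) * (ENNReal.ofReal (l ^ (-p)) *
        ∫⁻ x in {x | γ / 2 * l < ‖R (g x)‖}, ENNReal.ofReal (‖R (g x)‖ ^ p)) +
      ENNReal.ofReal (4 * C * γ ^ p) * (ENNReal.ofReal (l ^ (-p)) *
        ∫⁻ x in {x | 1 / 2 * l < ‖cv S g x‖}, ENNReal.ofReal (‖cv S g x‖ ^ p)) := by
  have hp0 : 0 < p := by linarith [D.hp]
  have hC := D.hC
  obtain ⟨O, hO, hO1, hO2, hO3, hO4, J, hJc, hJ, hJd, hJO⟩ := rs_full (fun t => ‖cv S g t‖ ^ p)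
    (D.F_int hg) ((D.cv_sm hg).norm.measurable.pow_const p) (fun x => by positivity) (l ^ p)
    (by positivity)
  obtain ⟨E, hE, hE1, hE2, hE3, hE4, -⟩ := rs_full (fun t => ‖R (g t)‖ ^ p)
    (D.Rg_rpow_int hg D.hp.le) ((D.Rg_meas hg).pow_const p) (fun x => by positivity) ((γ * l) ^ p)
    (by positivity)
  have key : ∀ m b : ℝ, 0 < m → 0 ≤ b → m ^ p / 2 < b ^ p → m / 2 < b := by
    intro m b hm hb h
    by_contra hcon
    push Not at hcon
    have h1 : b ^ p ≤ (m / 2) ^ p := Real.rpow_le_rpow hb hcon hp0.le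
    rw [Real.div_rpow hm.le (by norm_num)] at h1
    have h2 : (2:ℝ) ≤ 2 ^ p := by
      conv_lhs => rw [← Real.rpow_one 2]
      exact Real.rpow_le_rpow_of_exponent_le (by norm_num) D.hp.le
    have h3 : m ^ p / 2 ^ p ≤ m ^ p / 2 := by gcongr
    linarith
  have hvE : volume E ≤ ENNReal.ofReal (2 * γ ^ (-p)) * (ENNReal.ofReal (l ^ (-p)) *
        ∫⁻ x in {x | γ / 2 * l < ‖R (g x)‖}, ENNReal.ofReal (‖R (g x)‖ ^ p)) := by
    refine hE3.trans ?_
    rw [← mul_assoc, ← ENNReal.ofReal_mul (by positivity)]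
    have e : 2 / (γ * l) ^ p = 2 * γ ^ (-p) * l ^ (-p) := by
      rw [Real.mul_rpow hγ.le hl.le, Real.rpow_neg hγ.le, Real.rpow_neg hl.le]; field_simp
    rw [e]
    refine mul_le_mul_right (lintegral_mono_set ?_) _
    intro x hx
    have := key (γ * l) _ (by positivity) (norm_nonneg _) hx
    show γ / 2 * l < ‖R (g x)‖
    linarith
  have hvO : volume O ≤ ENNReal.ofReal 2 * (ENNReal.ofReal (l ^ (-p)) *
        ∫⁻ x in {x | 1 / 2 * l < ‖cv S g x‖}, ENNReal.ofReal (‖cv S g x‖ ^ p)) := by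
    refine hO3.trans ?_
    rw [← mul_assoc, ← ENNReal.ofReal_mul (by positivity)]
    have e : 2 / l ^ p = 2 * l ^ (-p) := by
      rw [Real.rpow_neg hl.le]; field_simp
    rw [e]
    refine mul_le_mul_right (lintegral_mono_set ?_) _
    intro x hx
    have := key l _ (by positivity) (norm_nonneg _) hx
    show 1 / 2 * l < ‖cv S g x‖
    linarith
  have hcov : {t | L * l < ‖cv S g t‖} ⊆ ({x | ¬ (x ∉ O → ‖cv S g x‖ ^ p ≤ l ^ p)} ∪ E) ∪
      ⋃ j ∈ J, {t | t ∈ Ioo j.1 j.2 ∧ t ∉ E ∧ L * l < ‖cv S g t‖} := by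
    intro t ht
    have ht' : L * l < ‖cv S g t‖ := ht
    by_cases htE : t ∈ E
    · exact Or.inl (Or.inr htE)
    by_cases htO : t ∈ O
    · right
      rw [hJO] at htO
      simp only [mem_iUnion] at htO ⊢
      obtain ⟨j, hj, hjt⟩ := htO
      exact ⟨j, hj, hjt, htE, ht'⟩
    · left; left
      show ¬ (t ∉ O → ‖cv S g t‖ ^ p ≤ l ^ p)
      intro h
      have := (Real.rpow_le_rpow_iff (norm_nonneg _) hl.le hp0).1 (h htO)
      nlinarith
  have hcomp : volume (⋃ j ∈ J, {t | t ∈ Ioo j.1 j.2 ∧ t ∉ E ∧ L * l < ‖cv S g t‖}) ≤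
      ENNReal.ofReal (2 * C * γ ^ p) * volume O := by
    rw [hJO, measure_biUnion hJc hJd (fun _ _ => measurableSet_Ioo), ← ENNReal.tsum_mul_left]
    refine (measure_biUnion_le _ hJc _).trans (ENNReal.tsum_le_tsum fun j => ?_)
    obtain ⟨h1, h2, -⟩ := hJ j j.2
    rw [Real.volume_Ioo]
    exact D.good_local hg hl hγ hγ1 h1 (hO1 _ h2) E hE hE1 L hL hL1
  calc _ ≤ _ := measure_mono hcov
    _ ≤ (volume {x | ¬ (x ∉ O → ‖cv S g x‖ ^ p ≤ l ^ p)} + volume E) + _ :=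
      (measure_union_le _ _).trans (add_le_add_left (measure_union_le _ _) _)
    _ ≤ volume E + ENNReal.ofReal (2 * C * γ ^ p) * volume O := by
      rw [show volume {x | ¬ (x ∉ O → ‖cv S g x‖ ^ p ≤ l ^ p)} = 0 from ae_iff.1 hO2, zero_add]
      gcongr
    _ ≤ _ := by
      refine add_le_add hvE ?_
      calc _ ≤ ENNReal.ofReal (2 * C * γ ^ p) * (ENNReal.ofReal 2 * (ENNReal.ofReal (l ^ (-p)) *
        ∫⁻ x in {x | 1 / 2 * l < ‖cv S g x‖}, ENNReal.ofReal (‖cv S g x‖ ^ p))) := by gcongr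
        _ = _ := by
          rw [← mul_assoc, ← ENNReal.ofReal_mul (by positivity)]
          congr 2; ring

lemma lq_big {q : ℝ} (hq : p < q) : ∃ K : ℝ, ∀ g, Nice g →
    ∫⁻ t, ENNReal.ofReal (‖cv S g t‖ ^ q) ≤
      ENNReal.ofReal K * ∫⁻ t, ENNReal.ofReal (‖R (g t)‖ ^ q) := by
  have hp0 : 0 < p := by linarith [D.hp]
  have hq0 : 0 < q := hp0.trans hq
  have hC := D.hC
  have hM := D.hM
  set L : ℝ := 1 + (M ^ p * 2 ^ (p - 1) * (1 + 2 * C)) ^ (1 / p) with hLdef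
  have hL1 : 1 ≤ L := by
    have : 0 ≤ (M ^ p * 2 ^ (p - 1) * (1 + 2 * C)) ^ (1 / p) := by positivity
    linarith
  have hL : (L - 1) ^ p = M ^ p * 2 ^ (p - 1) * (1 + 2 * C) := by
    rw [hLdef, add_sub_cancel_left, ← Real.rpow_mul (by positivity), one_div,
      inv_mul_cancel₀ hp0.ne', Real.rpow_one]
  have hqp : 0 < q - p := by linarith
  set K₀ : ℝ := (L ^ q * q) * ((4 * C) * ((1 / 2) ^ (-(q - p)) / (q - p))) with hK₀
  have hK₀0 : 0 ≤ K₀ := by positivity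
  set γ : ℝ := (1 / (2 * (K₀ + 1))) ^ (1 / p) with hγd
  have hγ : 0 < γ := by positivity
  have hγp : γ ^ p = 1 / (2 * (K₀ + 1)) := by
    rw [hγd, ← Real.rpow_mul (by positivity), one_div p, inv_mul_cancel₀ hp0.ne', Real.rpow_one]
  have hγ1 : γ ≤ 1 := by
    apply Real.rpow_le_one (by positivity) _ (by positivity)
    rw [div_le_one (by positivity)]; linarith
  set K₁ : ℝ := (L ^ q * q) * ((2 * γ ^ (-p)) * ((γ / 2) ^ (-(q - p)) / (q - p))) with hK₁
  refine ⟨2 * K₁, fun g hg => ?_⟩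
  set I := ∫⁻ t, ENNReal.ofReal (‖cv S g t‖ ^ q) with hI
  set Ia := ∫⁻ t, ENNReal.ofReal (‖R (g t)‖ ^ q) with hIa
  have hIfin : I < ⊤ := by
    set B := M * ∫ s, ‖g s‖
    have hB : ∀ t, ‖cv S g t‖ ≤ B := D.cv_bdd hg
    have hB0 : 0 ≤ B := (norm_nonneg _).trans (hB 0)
    calc I ≤ ∫⁻ t, ENNReal.ofReal (B ^ (q - p)) * ENNReal.ofReal (‖cv S g t‖ ^ p) := by
          refine lintegral_mono fun t => ?_
          show _ ≤ ENNReal.ofReal (B ^ (q - p)) * ENNReal.ofReal (‖cv S g t‖ ^ p)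
          rw [← ENNReal.ofReal_mul (by positivity)]
          apply ENNReal.ofReal_le_ofReal
          rcases (norm_nonneg (cv S g t)).eq_or_lt with h | h
          · rw [← h, Real.zero_rpow hq0.ne', Real.zero_rpow hp0.ne']; simp
          · have : ‖cv S g t‖ ^ q = ‖cv S g t‖ ^ (q - p) * ‖cv S g t‖ ^ p := by
              rw [← Real.rpow_add h]; ring_nf
            rw [this]
            gcongr
            exact hB t
      _ = ENNReal.ofReal (B ^ (q - p)) * ∫⁻ t, ENNReal.ofReal (‖cv S g t‖ ^ p) :=
          lintegral_const_mul' _ _ ENNReal.ofReal_ne_top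
      _ < ⊤ := by
          refine ENNReal.mul_lt_top ENNReal.ofReal_lt_top ?_
          have := (D.F_int hg).2
          rwa [hasFiniteIntegral_iff_ofReal (Filter.Eventually.of_forall fun t => by positivity)] at this
  have hmain : I ≤ ENNReal.ofReal K₁ * Ia + ENNReal.ofReal (1 / 2) * I := by
    have h0 := lc0 (fun t => ‖cv S g t‖) (D.cv_sm hg).norm.measurable.aemeasurable
      (fun _ => norm_nonneg _) q L hq0 (by linarith)
    have h1 := lc1 (fun t => ‖R (g t)‖) (D.Rg_meas hg) (fun _ => norm_nonneg _) (γ / 2) q p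
      (by positivity) hp0 hq
    have h2 := lc1 (fun t => ‖cv S g t‖) (D.cv_sm hg).norm.measurable (fun _ => norm_nonneg _)
      (1 / 2) q p (by positivity) hp0 hq
    have m1 := lc_meas1 (fun t => ‖R (g t)‖) (γ / 2) q p (by positivity)
    have m2 := lc_meas1 (fun t => ‖cv S g t‖) (1 / 2) q p (by positivity)
    have hstep : ∫⁻ l in Ioi (0:ℝ), volume {x | L * l < ‖cv S g x‖} * ENNReal.ofReal (l ^ (q - 1))
        ≤ ENNReal.ofReal (2 * γ ^ (-p)) * (ENNReal.ofReal ((γ / 2) ^ (-(q - p)) / (q - p)) * Ia) +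
          ENNReal.ofReal (4 * C * γ ^ p) * (ENNReal.ofReal ((1 / 2) ^ (-(q - p)) / (q - p)) * I) := by
      refine le_trans ?_ (add_le_add (mul_le_mul_right h1 _) (mul_le_mul_right h2 _))
      rw [← lintegral_const_mul _ m1, ← lintegral_const_mul _ m2,
        ← lintegral_add_left (m1.const_mul _)]
      refine setLIntegral_mono' measurableSet_Ioi fun l hl => ?_
      have hl' : 0 < l := hl
      refine (mul_le_mul_left (D.good_lam hg hl' hγ hγ1 L hL hL1) _).trans (le_of_eq ?_)
      rw [add_mul, mul_assoc, mul_assoc (ENNReal.ofReal (4 * C * γ ^ p))]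
    have hLq : 0 ≤ L ^ q * q := by positivity
    calc I = _ := h0
      _ ≤ ENNReal.ofReal (L ^ q * q) * _ := mul_le_mul_right hstep _
      _ = ENNReal.ofReal K₁ * Ia + ENNReal.ofReal (K₀ * γ ^ p) * I := by
        rw [mul_add, ← mul_assoc, ← mul_assoc, ← mul_assoc, ← mul_assoc,
          ← ENNReal.ofReal_mul hLq, ← ENNReal.ofReal_mul (by positivity), ← ENNReal.ofReal_mul hLq,
          ← ENNReal.ofReal_mul (by positivity)]
        congr 3
        · rw [hK₁]; ring
        · rw [hK₀]; ring
      _ ≤ _ := by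
        gcongr
        rw [hγp, mul_one_div, div_le_div_iff₀ (by positivity) (by norm_num)]
        linarith
  have hfin : ENNReal.ofReal (1 / 2) * I ≠ ⊤ := ENNReal.mul_ne_top ENNReal.ofReal_ne_top hIfin.ne
  have hhalf : I = ENNReal.ofReal (1 / 2) * I + ENNReal.ofReal (1 / 2) * I := by
    rw [← add_mul, ← ENNReal.ofReal_add (by norm_num) (by norm_num)]; norm_num
  have h3 : ENNReal.ofReal (1 / 2) * I ≤ ENNReal.ofReal K₁ * Ia := by
    have hh := hmain
    nth_rw 1 [hhalf] at hh
    exact (ENNReal.add_le_add_iff_right hfin).1 hh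
  calc I = _ := hhalf
    _ ≤ ENNReal.ofReal K₁ * Ia + ENNReal.ofReal K₁ * Ia := add_le_add h3 h3
    _ = _ := by rw [← add_mul, ← ENNReal.ofReal_add (by positivity) (by positivity), two_mul]

end SGData
end


lemma tail_lint (c β h : ℝ) (hc : 0 ≤ c) (hh : 0 < h) :
    ∫⁻ t, (Ici (β + h)).indicator (fun t => ENNReal.ofReal (c * h ^ 2 / (t - β) ^ 2)) t =
      ENNReal.ofReal (c * h) := by
  have e : (fun t => (Ici (β + h)).indicator (fun t => ENNReal.ofReal (c * h ^ 2 / (t - β) ^ 2)) t)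
      = fun t => (fun t => (Ici h).indicator (fun t => ENNReal.ofReal (c * h ^ 2 / t ^ 2)) t) (t - β) := by
    ext t
    by_cases ht : β + h ≤ t
    · have : h ≤ t - β := by linarith
      simp [indicator, ht, this]
    · have : ¬ h ≤ t - β := by intro h'; exact ht (by linarith)
      simp [indicator, ht, this]
  rw [e, lintegral_sub_right_eq_self, lintegral_indicator measurableSet_Ici,
    setLIntegral_congr Ioi_ae_eq_Ici.symm]
  have e2 : ∫⁻ t in Ioi h, ENNReal.ofReal (c * h ^ 2 / t ^ 2) =
      ∫⁻ t in Ioi h, ENNReal.ofReal (c * h ^ 2 * t ^ (-2:ℝ)) := by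
    refine setLIntegral_congr_fun measurableSet_Ioi fun t ht => ?_
    have ht' : 0 < t := hh.trans ht
    rw [Real.rpow_neg ht'.le, Real.rpow_two]; rfl
  rw [e2, ← ofReal_integral_eq_lintegral_ofReal
    ((integrableOn_Ioi_rpow_of_lt (by norm_num) hh).const_mul _), integral_const_mul,
    integral_Ioi_rpow_of_lt (by norm_num) hh]
  · congr 1
    norm_num
    rw [Real.rpow_neg_one]; field_simp
  · refine (ae_restrict_mem measurableSet_Ioi).mono fun t ht => ?_
    have ht' : 0 < t := hh.trans ht
    simp only [Pi.zero_apply]; positivity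

section
variable {X : Type*} [NormedAddCommGroup X] [NormedSpace ℝ X]

lemma Nice.sub {g h : ℝ → X} (hg : Nice g) (hh : Nice h) : Nice (fun t => g t - h t) := by
  obtain ⟨B, hB⟩ := hg.bdd
  obtain ⟨B', hB'⟩ := hh.bdd
  refine ⟨hg.sm.sub hh.sm, hg.int.sub hh.int, ⟨B + B', fun t => ?_⟩, fun t ht => ?_⟩
  · exact (norm_sub_le _ _).trans (add_le_add (hB t) (hB' t))
  · simp [hg.neg t ht, hh.neg t ht]

namespace SGData
variable {R : X →L[ℝ] X} {S : ℝ → X →L[ℝ] X} {M C p : ℝ} [CompleteSpace X] (D : SGData R S M C p)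
include D

lemma cz_bad {w : ℝ → X} (hw : Nice w) {l : ℝ} (hl : 0 < l) (J : Set (ℝ × ℝ)) (hJc : J.Countable)
    (hJ : ∀ j ∈ J, j.1 < j.2) (hJd : J.PairwiseDisjoint (fun j => Ioo j.1 j.2))
    (h0 : ∀ t ∉ ⋃ j ∈ J, Ioo j.1 j.2, w t = 0)
    (h1 : ∀ j ∈ J, ∫ s in Ioo j.1 j.2, w s = 0)
    (h2 : ∀ j ∈ J, ∫ s in Ioo j.1 j.2, ‖R (w s)‖ ≤ 2 * l * (j.2 - j.1)) :
    volume {t | l < ‖cv S w t‖} ≤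
      ENNReal.ofReal (2 + 2 * C) * volume (⋃ j ∈ J, Ioo j.1 j.2) := by
  have hC := D.hC
  have : Countable J := hJc
  set k : J → ℝ → ENNReal := fun j t => (Ici (j.1.2 + (j.1.2 - j.1.1))).indicator
    (fun t => ENNReal.ofReal ((2 * C * l) * (j.1.2 - j.1.1) ^ 2 / (t - j.1.2) ^ 2)) t with hk
  have hkm : ∀ j, Measurable (k j) := by
    intro j
    exact Measurable.indicator (by fun_prop) measurableSet_Ici
  set U : Set ℝ := ⋃ j ∈ J, Ioo j.1 (j.2 + (j.2 - j.1)) with hU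
  have hvQ : volume (⋃ j ∈ J, Ioo j.1 j.2) = ∑' j : J, ENNReal.ofReal (j.1.2 - j.1.1) := by
    rw [measure_biUnion hJc hJd (fun _ _ => measurableSet_Ioo)]
    simp
  have hvU : volume U ≤ ENNReal.ofReal 2 * volume (⋃ j ∈ J, Ioo j.1 j.2) := by
    rw [hvQ, ← ENNReal.tsum_mul_left]
    refine (measure_biUnion_le _ hJc _).trans (ENNReal.tsum_le_tsum fun j => ?_)
    rw [Real.volume_Ioo, ← ENNReal.ofReal_mul (by norm_num)]
    apply ENNReal.ofReal_le_ofReal; linarith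
  have hpt : ∀ t ∉ U, ENNReal.ofReal ‖cv S w t‖ ≤ ∑' j : J, k j t := by
    intro t ht
    have hQm : MeasurableSet (⋃ j : J, Ioo j.1.1 j.1.2) :=
      MeasurableSet.iUnion fun _ => measurableSet_Ioo
    have e1 : cv S w t = ∫ s in ⋃ j : J, Ioo j.1.1 j.1.2, S (t - s) (w s) := by
      rw [cv, ← integral_indicator hQm]
      congr 1; ext s
      by_cases hs : s ∈ ⋃ j : J, Ioo j.1.1 j.1.2
      · rw [indicator_of_mem hs]
      · rw [indicator_of_notMem hs, h0 s (by simpa [iUnion_subtype] using hs), map_zero]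
    have hd : Pairwise (Function.onFun Disjoint fun j : J => Ioo j.1.1 j.1.2) := by
      intro i j hij
      exact hJd i.2 j.2 (fun h => hij (Subtype.ext h))
    have hsum := hasSum_integral_iUnion (fun j : J => measurableSet_Ioo) hd
      (D.integrable hw t).integrableOn
    rw [ofReal_norm_eq_enorm, e1, ← hsum.tsum_eq]
    refine (enorm_tsum_le_tsum_enorm).trans (ENNReal.tsum_le_tsum fun j => ?_)
    obtain ⟨⟨α, β⟩, hj⟩ := j
    have hαβ : α < β := hJ _ hj
    have ht' : ¬ (α < t ∧ t < β + (β - α)) := by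
      intro h
      apply ht
      simp only [hU, mem_iUnion]
      exact ⟨(α, β), hj, h⟩
    show ‖∫ s in Ioo α β, S (t - s) (w s)‖ₑ ≤ (Ici (β + (β - α))).indicator
      (fun t => ENNReal.ofReal ((2 * C * l) * (β - α) ^ 2 / (t - β) ^ 2)) t
    by_cases htb : β + (β - α) ≤ t
    · have hτ : 0 < t - β := by linarith
      rw [indicator_of_mem (mem_Ici.2 htb), ← ofReal_norm_eq_enorm]
      apply ENNReal.ofReal_le_ofReal
      have hz : ∫ s in Ioo α β, S (t - β) (w s) = 0 := by
        rw [ContinuousLinearMap.integral_comp_comm _ hw.int.integrableOn, h1 _ hj, map_zero]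
      have e2 : ∫ s in Ioo α β, S (t - s) (w s) =
          ∫ s in Ioo α β, (S (t - s) (w s) - S (t - β) (w s)) := by
        rw [integral_sub (D.integrable hw t).integrableOn
          ((S (t - β)).integrable_comp hw.int).integrableOn, hz, sub_zero]
      rw [e2]
      have hRi : Integrable (fun s => ‖R (w s)‖) := (R.integrable_comp hw.int).norm
      calc ‖∫ s in Ioo α β, (S (t - s) (w s) - S (t - β) (w s))‖
          ≤ ∫ s in Ioo α β, (C * (β - α) / (t - β) ^ 2) * ‖R (w s)‖ := by
            refine norm_integral_le_of_norm_le (hRi.const_mul _).integrableOn ?_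
            refine (ae_restrict_mem measurableSet_Ioo).mono fun s hs => ?_
            refine (D.smooth (t - β) (t - s) hτ (by linarith [hs.2]) (w s)).trans ?_
            rw [show t - s - (t - β) = β - s by ring]
            gcongr
            exact hs.1.le
        _ ≤ (C * (β - α) / (t - β) ^ 2) * (2 * l * (β - α)) := by
            rw [integral_const_mul]
            have : 0 < β - α := by linarith
            gcongr
            exact h2 _ hj
        _ = _ := by ring
    · have hta : t ≤ α := by
        by_contra hcon
        exact ht' ⟨not_le.1 hcon, not_le.1 htb⟩
      have : ∫ s in Ioo α β, S (t - s) (w s) = 0 := by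
        rw [← integral_zero ℝ X (μ := volume.restrict (Ioo α β))]
        refine setIntegral_congr_fun measurableSet_Ioo fun s hs => ?_
        simp [D.neg (t - s) (by linarith [hs.1])]
      rw [this]; simp
  have hint : ∫⁻ t, ∑' j : J, k j t = ENNReal.ofReal (2 * C * l) * volume (⋃ j ∈ J, Ioo j.1 j.2) := by
    rw [lintegral_tsum (fun j => (hkm j).aemeasurable), hvQ, ← ENNReal.tsum_mul_left]
    congr 1; ext j
    rw [← ENNReal.ofReal_mul (by positivity)]
    exact tail_lint _ _ _ (by positivity) (by linarith [hJ j j.2])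
  calc volume {t | l < ‖cv S w t‖}
      ≤ volume (U ∪ {t | ENNReal.ofReal l ≤ ∑' j : J, k j t}) := by
        apply measure_mono
        intro t ht
        by_cases htU : t ∈ U
        · exact Or.inl htU
        · right
          have ht' : l < ‖cv S w t‖ := ht
          exact (ENNReal.ofReal_le_ofReal ht'.le).trans (hpt t htU)
    _ ≤ volume U + volume {t | ENNReal.ofReal l ≤ ∑' j : J, k j t} := measure_union_le _ _
    _ ≤ ENNReal.ofReal 2 * volume (⋃ j ∈ J, Ioo j.1 j.2) +
        ENNReal.ofReal (2 * C * l) * volume (⋃ j ∈ J, Ioo j.1 j.2) / ENNReal.ofReal l := by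
        refine add_le_add hvU ?_
        rw [← hint]
        exact meas_ge_le_lintegral_div (Measurable.tsum hkm).aemeasurable
          (by simpa using hl) ENNReal.ofReal_ne_top
    _ = _ := by
        rw [ENNReal.mul_div_right_comm, ← ENNReal.ofReal_div_of_pos hl, ← add_mul,
          ← ENNReal.ofReal_add (by norm_num) (by positivity)]
        congr 3
        field_simp

lemma cz_weak {g : ℝ → X} (hg : Nice g) {l : ℝ} (hl : 0 < l) :
    volume {t | 2 * l < ‖cv S g t‖} ≤
      ENNReal.ofReal C * (ENNReal.ofReal (l ^ (-p)) *
        ∫⁻ x in {x | ‖R (g x)‖ ≤ l}, ENNReal.ofReal (‖R (g x)‖ ^ p)) +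
      ENNReal.ofReal (6 * C + 4) * (ENNReal.ofReal (l ^ (-(1:ℝ))) *
        ∫⁻ x in {x | 1 / 2 * l < ‖R (g x)‖}, ENNReal.ofReal (‖R (g x)‖ ^ (1:ℝ))) := by
  have hp0 : 0 < p := by linarith [D.hp]
  have hC := D.hC
  have hRi : Integrable (fun s => ‖R (g s)‖) := (R.integrable_comp hg.int).norm
  obtain ⟨O, hO, hO1, hO2, hO3, hO4, J, hJc, hJ, hJd, hJO⟩ := rs_full (fun t => ‖R (g t)‖)
    hRi (D.Rg_meas hg) (fun x => norm_nonneg _) l hl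
  -- right end points are not in `O`
  have hr : ∀ j ∈ J, j.2 ∉ O := by
    intro j hj hjO
    have hj12 := (hJ j hj).1
    have h := hjO
    rw [hJO] at h
    simp only [mem_iUnion] at h
    obtain ⟨i, hi, hi1, hi2⟩ := h
    by_cases hij : j = i
    · rw [hij] at hi2; exact lt_irrefl _ hi2
    · have hdis := hJd hj hi hij
      have hm : max i.1 j.1 < j.2 := max_lt hi1 hj12
      have h1 := le_max_left i.1 j.1
      have h2 := le_max_right i.1 j.1
      have hd2 : Disjoint (Ioo j.1 j.2) (Ioo i.1 i.2) := hdis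
      have hm1 : (max i.1 j.1 + j.2) / 2 ∈ Ioo j.1 j.2 := ⟨by linarith, by linarith⟩
      have hm2 : (max i.1 j.1 + j.2) / 2 ∈ Ioo i.1 i.2 := ⟨by linarith, by linarith⟩
      exact Set.disjoint_left.1 hd2 hm1 hm2
  have hpos : ∀ j ∈ J, 0 ≤ j.1 := by
    intro j hj
    by_contra hneg
    push Not at hneg
    obtain ⟨hj1, hj2, hj3⟩ := hJ j hj
    by_cases hj0 : j.2 ≤ 0
    · have : ∫ s in Ioo j.1 j.2, ‖R (g s)‖ = 0 := by
        rw [← integral_zero ℝ ℝ (μ := volume.restrict (Ioo j.1 j.2))]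
        refine setIntegral_congr_fun measurableSet_Ioo fun s hs => ?_
        simp [hg.neg s (by linarith [hs.2])]
      simp only [this] at hj3
      have : 0 < l * (j.2 - j.1) := mul_pos hl (by linarith)
      linarith
    · push Not at hj0
      have h1 := hO1 j.2 (hr j hj) 0 hj0
      have h2 : ∫ s in Ioo j.1 j.2, ‖R (g s)‖ ≤ ∫ s in Ioc 0 j.2, ‖R (g s)‖ := by
        rw [← integral_indicator measurableSet_Ioo, ← integral_indicator measurableSet_Ioc]
        refine integral_mono (hRi.indicator measurableSet_Ioo) (hRi.indicator measurableSet_Ioc)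
          fun s => ?_
        by_cases hs : s ≤ 0
        · simp [indicator, hg.neg s hs]
        · by_cases hs2 : s < j.2
          · simp [indicator, hs2.le, not_le.1 hs]
            split_ifs <;> simp
          · simp [indicator, hs2]
            split_ifs <;> simp
      have h3 : ∫ s in Ioo j.1 j.2, ‖R (g s)‖ = l * (j.2 - j.1) := hj3
      nlinarith
  have : Countable J := hJc
  obtain ⟨B, hB⟩ := hg.bdd
  have hB0 : 0 ≤ B := (norm_nonneg _).trans (hB 0)
  classical
  set av : J → X := fun j => (j.1.2 - j.1.1)⁻¹ • ∫ s in Ioo j.1.1 j.1.2, g s with hav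
  set k : ℝ → Option J := fun t => if h : ∃ j : J, t ∈ Ioo j.1.1 j.1.2 then some h.choose else none
    with hk
  have hk1 : ∀ j : J, ∀ t ∈ Ioo j.1.1 j.1.2, k t = some j := by
    intro j t ht
    have hex : ∃ j : J, t ∈ Ioo j.1.1 j.1.2 := ⟨j, ht⟩
    simp only [hk, hex, dif_pos, Option.some.injEq]
    by_contra hne
    exact Set.disjoint_left.1 (hJd hex.choose.2 j.2 (fun h => hne (Subtype.ext h)))
      hex.choose_spec ht
  have hk2 : ∀ j : J, ∀ t, k t = some j → t ∈ Ioo j.1.1 j.1.2 := by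
    intro j t ht
    by_cases hex : ∃ j : J, t ∈ Ioo j.1.1 j.1.2
    · simp only [hk, hex, dif_pos, Option.some.injEq] at ht
      rw [← ht]; exact hex.choose_spec
    · have hn : k t = none := dif_neg hex
      rw [hn] at ht; cases ht
  have hk3 : ∀ t, t ∉ O → k t = none := by
    intro t ht
    by_contra hne
    obtain ⟨j, hj⟩ := Option.ne_none_iff_exists'.1 hne
    apply ht
    rw [hJO]
    simp only [mem_iUnion]
    exact ⟨j.1, j.2, hk2 j t hj⟩
  letI : MeasurableSpace (Option J) := ⊤
  have hkm : Measurable k := by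
    have hsome : ∀ j : J, k ⁻¹' {some j} = Ioo j.1.1 j.1.2 := by
      intro j; ext t
      exact ⟨fun h => hk2 j t h, fun h => hk1 j t h⟩
    refine measurable_to_countable' fun o => ?_
    cases o with
    | some j => rw [hsome]; exact measurableSet_Ioo
    | none =>
      have : k ⁻¹' {none} = (⋃ j : J, Ioo j.1.1 j.1.2)ᶜ := by
        ext t
        simp only [mem_preimage, mem_singleton_iff, mem_compl_iff, mem_iUnion, not_exists]
        constructor
        · intro h j hj
          rw [hk1 j t hj] at h; simp at h
        · intro h
          by_contra hne
          obtain ⟨j, hj⟩ := Option.ne_none_iff_exists'.1 hne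
          exact h j (hk2 j t hj)
      rw [this]
      exact (MeasurableSet.iUnion fun _ => measurableSet_Ioo).compl
  set Φ : Option J → X := fun o => o.elim 0 av with hΦ
  have hΦsm : StronglyMeasurable (fun t => Φ (k t)) :=
    (StronglyMeasurable.of_discrete (f := Φ)).comp_measurable hkm
  set gg : ℝ → X := fun t => Oᶜ.indicator g t + Φ (k t) with hgg
  have hggQ : ∀ j : J, ∀ t ∈ Ioo j.1.1 j.1.2, gg t = av j := by
    intro j t ht
    have htO : t ∈ O := by rw [hJO]; simp only [mem_iUnion]; exact ⟨j.1, j.2, ht⟩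
    simp only [hgg, hk1 j t ht, hΦ, Option.elim_some, indicator_of_notMem (fun h : t ∈ Oᶜ => h htO),
      zero_add]
  have hggO : ∀ t ∉ O, gg t = g t := by
    intro t ht
    simp only [hgg, hk3 t ht, hΦ, Option.elim_none, indicator_of_mem (mem_compl ht), add_zero]
  have hmemO : ∀ t ∈ O, ∃ j : J, t ∈ Ioo j.1.1 j.1.2 := by
    intro t ht
    rw [hJO] at ht
    simp only [mem_iUnion] at ht
    obtain ⟨j, hj, h⟩ := ht
    exact ⟨⟨j, hj⟩, h⟩
  have hlen : ∀ j : J, 0 < j.1.2 - j.1.1 := fun j => by linarith [(hJ j j.2).1]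
  have havB : ∀ j, ‖av j‖ ≤ B := by
    intro j
    have := norm_setIntegral_le_of_norm_le_const (μ := volume) (s := Ioo j.1.1 j.1.2)
      (f := g) (C := B) (by simp) (fun s _ => hB s)
    rw [Real.volume_real_Ioo_of_le (by linarith [hlen j])] at this
    simp only [hav, norm_smul, norm_inv, Real.norm_of_nonneg (hlen j).le]
    rw [inv_mul_le_iff₀ (hlen j)]
    linarith
  have havR : ∀ j, ‖R (av j)‖ ≤ l := by
    intro j
    have : ‖∫ s in Ioo j.1.1 j.1.2, R (g s)‖ ≤ l * (j.1.2 - j.1.1) :=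
      (norm_integral_le_integral_norm _).trans (hJ j j.2).2.2.le
    simp only [hav, map_smul, norm_smul, norm_inv, Real.norm_of_nonneg (hlen j).le]
    rw [inv_mul_le_iff₀ (hlen j), ← ContinuousLinearMap.integral_comp_comm _ hg.int.integrableOn]
    linarith
  have hnn : Nice gg := by
    have hsm : StronglyMeasurable gg := (hg.sm.indicator hO.measurableSet.compl).add hΦsm
    have hbd : ∀ t, ‖gg t‖ ≤ B := by
      intro t
      by_cases ht : t ∈ O
      · obtain ⟨j, hj⟩ := hmemO t ht
        rw [hggQ j t hj]; exact havB j
      · rw [hggO t ht]; exact hB t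
    refine ⟨hsm, ?_, ⟨B, hbd⟩, ?_⟩
    · have hi : Integrable (fun t => ‖g t‖ + O.indicator (fun _ => B) t) :=
        hg.int.norm.add ((integrable_indicator_iff hO.measurableSet).2 (by simp [hO4]))
      refine hi.mono' hsm.aestronglyMeasurable (Filter.Eventually.of_forall fun t => ?_)
      by_cases ht : t ∈ O
      · rw [indicator_of_mem ht]; linarith [hbd t, norm_nonneg (g t)]
      · rw [indicator_of_notMem ht, hggO t ht, add_zero]
    · intro t ht
      have : t ∉ O := by
        intro h
        obtain ⟨j, hj⟩ := hmemO t h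
        linarith [hj.1, hpos j j.2]
      rw [hggO t this, hg.neg t ht]
  set w : ℝ → X := fun t => g t - gg t with hw
  have hwn : Nice w := hg.sub hnn
  have hbad : volume {t | l < ‖cv S w t‖} ≤ ENNReal.ofReal (2 + 2 * C) * volume O := by
    have := D.cz_bad hwn hl J hJc (fun j hj => (hJ j hj).1) hJd
      (by
        intro t ht
        rw [← hJO] at ht
        simp [hw, hggO t ht])
      (by
        intro j hj
        have e : ∫ s in Ioo j.1 j.2, gg s = ∫ s in Ioo j.1 j.2, g s := by
          rw [setIntegral_congr_fun measurableSet_Ioo (fun s hs => hggQ ⟨j, hj⟩ s hs),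
            setIntegral_const, Real.volume_real_Ioo_of_le (hJ j hj).1.le]
          simp only [hav]
          rw [smul_inv_smul₀ (hlen ⟨j, hj⟩).ne']
        simp only [hw]
        rw [integral_sub hg.int.integrableOn hnn.int.integrableOn, e, sub_self])
      (by
        intro j hj
        calc ∫ s in Ioo j.1 j.2, ‖R (w s)‖ ≤ ∫ s in Ioo j.1 j.2, (‖R (g s)‖ + l) := by
              refine setIntegral_mono_on (R.integrable_comp hwn.int).norm.integrableOn
                (hRi.integrableOn.add (by simp)) measurableSet_Ioo fun s hs => ?_
              simp only [hw, map_sub]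
              refine (norm_sub_le _ _).trans (add_le_add le_rfl ?_)
              rw [hggQ ⟨j, hj⟩ s hs]; exact havR _
          _ = l * (j.2 - j.1) + l * (j.2 - j.1) := by
              rw [integral_add hRi.integrableOn (by simp), (hJ j hj).2.2, setIntegral_const,
                Real.volume_real_Ioo_of_le (hJ j hj).1.le, smul_eq_mul]; ring
          _ ≤ _ := by linarith)
    rwa [← hJO] at this
  have hgood : volume {t | l < ‖cv S gg t‖} ≤ ENNReal.ofReal C * (ENNReal.ofReal (l ^ (-p)) *
        ∫⁻ x in {x | ‖R (g x)‖ ≤ l}, ENNReal.ofReal (‖R (g x)‖ ^ p)) +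
        ENNReal.ofReal C * volume O := by
    have hms : MeasurableSet {x | ‖R (g x)‖ ≤ l} := measurableSet_le (D.Rg_meas hg) measurable_const
    have hRgg : ∫⁻ t, ENNReal.ofReal (‖R (gg t)‖ ^ p) ≤
        (∫⁻ x in {x | ‖R (g x)‖ ≤ l}, ENNReal.ofReal (‖R (g x)‖ ^ p)) +
          ENNReal.ofReal (l ^ p) * volume O := by
      rw [← lintegral_indicator hms, ← lintegral_indicator_const hO.measurableSet,
        ← lintegral_add_left (((D.Rg_meas hg).pow_const p).ennreal_ofReal.indicator hms)]
      refine lintegral_mono_ae ?_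
      filter_upwards [hO2] with t ht
      by_cases htO : t ∈ O
      · rw [indicator_of_mem htO]
        obtain ⟨j, hj⟩ := hmemO t htO
        rw [hggQ j t hj]
        refine le_trans ?_ le_add_self
        apply ENNReal.ofReal_le_ofReal
        exact Real.rpow_le_rpow (norm_nonneg _) (havR j) hp0.le
      · rw [hggO t htO, indicator_of_mem (show t ∈ {x | ‖R (g x)‖ ≤ l} from ht htO)]
        exact le_self_add
    calc volume {t | l < ‖cv S gg t‖}
        ≤ volume {t | ENNReal.ofReal (l ^ p) ≤ ENNReal.ofReal (‖cv S gg t‖ ^ p)} := by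
          apply measure_mono
          intro t ht
          have ht' : l < ‖cv S gg t‖ := ht
          exact ENNReal.ofReal_le_ofReal (Real.rpow_le_rpow hl.le ht'.le hp0.le)
      _ ≤ (∫⁻ t, ENNReal.ofReal (‖cv S gg t‖ ^ p)) / ENNReal.ofReal (l ^ p) := by
          refine meas_ge_le_lintegral_div ?_ (by simp; positivity) ENNReal.ofReal_ne_top
          exact ((D.cv_sm hnn).norm.measurable.pow_const p).ennreal_ofReal.aemeasurable
      _ = ENNReal.ofReal (l ^ (-p)) * (∫⁻ t, ENNReal.ofReal (‖cv S gg t‖ ^ p)) := by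
          rw [div_eq_mul_inv, ← ENNReal.ofReal_inv_of_pos (by positivity), ← Real.rpow_neg hl.le,
            mul_comm]
      _ ≤ ENNReal.ofReal (l ^ (-p)) * (ENNReal.ofReal C *
          ((∫⁻ x in {x | ‖R (g x)‖ ≤ l}, ENNReal.ofReal (‖R (g x)‖ ^ p)) +
          ENNReal.ofReal (l ^ p) * volume O)) := by
          gcongr
          exact (D.lp gg hnn).trans (mul_le_mul_right hRgg _)
      _ = _ := by
          have e : ENNReal.ofReal (l ^ (-p)) * ENNReal.ofReal (l ^ p) = 1 := by
            rw [← ENNReal.ofReal_mul (by positivity), ← Real.rpow_add hl]; simp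
          calc _ = ENNReal.ofReal C * (ENNReal.ofReal (l ^ (-p)) *
                  ∫⁻ x in {x | ‖R (g x)‖ ≤ l}, ENNReal.ofReal (‖R (g x)‖ ^ p)) +
                ENNReal.ofReal C * ((ENNReal.ofReal (l ^ (-p)) * ENNReal.ofReal (l ^ p)) *
                  volume O) := by ring
            _ = _ := by rw [e, one_mul]
  have hvO : volume O ≤ ENNReal.ofReal 2 * (ENNReal.ofReal (l ^ (-(1:ℝ))) *
        ∫⁻ x in {x | 1 / 2 * l < ‖R (g x)‖}, ENNReal.ofReal (‖R (g x)‖ ^ (1:ℝ))) := by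
    refine hO3.trans (le_of_eq ?_)
    rw [← mul_assoc, ← ENNReal.ofReal_mul (by positivity)]
    simp only [Real.rpow_one]
    rw [Real.rpow_neg_one]
    congr 3
    ext x
    show l / 2 < _ ↔ 1 / 2 * l < _
    rw [show 1 / 2 * l = l / 2 by ring]
  calc volume {t | 2 * l < ‖cv S g t‖}
      ≤ volume ({t | l < ‖cv S gg t‖} ∪ {t | l < ‖cv S w t‖}) := by
        apply measure_mono
        intro t ht
        have ht' : 2 * l < ‖cv S g t‖ := ht
        have e : cv S g t = cv S gg t + cv S w t := by
          rw [← D.cv_add hnn hwn]; simp [hw]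
        rw [e] at ht'
        have := norm_add_le (cv S gg t) (cv S w t)
        by_cases h : l < ‖cv S gg t‖
        · exact Or.inl h
        · exact Or.inr (show l < _ by linarith)
    _ ≤ _ := measure_union_le _ _
    _ ≤ _ := add_le_add hgood hbad
    _ = ENNReal.ofReal C * (ENNReal.ofReal (l ^ (-p)) *
        ∫⁻ x in {x | ‖R (g x)‖ ≤ l}, ENNReal.ofReal (‖R (g x)‖ ^ p)) +
        ENNReal.ofReal (3 * C + 2) * volume O := by
        rw [add_assoc, ← add_mul, ← ENNReal.ofReal_add hC (by positivity)]
        congr 3; ring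
    _ ≤ _ := by
        refine add_le_add le_rfl ((mul_le_mul_right hvO _).trans (le_of_eq ?_))
        rw [← mul_assoc, ← ENNReal.ofReal_mul (by positivity)]
        congr 2; ring

lemma lq_small {q : ℝ} (hq1 : 1 < q) (hq : q < p) : ∃ K : ℝ, ∀ g, Nice g →
    ∫⁻ t, ENNReal.ofReal (‖cv S g t‖ ^ q) ≤
      ENNReal.ofReal K * ∫⁻ t, ENNReal.ofReal (‖R (g t)‖ ^ q) := by
  have hq0 : 0 < q := by linarith
  have hC := D.hC
  have hqp : 0 < p - q := by linarith
  have hq1' : 0 < q - 1 := by linarith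
  refine ⟨(2 ^ q * q) * (C * (1 / (p - q)) + (6 * C + 4) * ((1 / 2) ^ (-(q - 1)) / (q - 1))),
    fun g hg => ?_⟩
  set Ia := ∫⁻ t, ENNReal.ofReal (‖R (g t)‖ ^ q) with hIa
  have h0 := lc0 (fun t => ‖cv S g t‖) (D.cv_sm hg).norm.measurable.aemeasurable
    (fun _ => norm_nonneg _) q 2 hq0 (by norm_num)
  have h1 := lc2 (fun t => ‖R (g t)‖) (D.Rg_meas hg) (fun _ => norm_nonneg _) q p hq0 hq
  have h2 := lc1 (fun t => ‖R (g t)‖) (D.Rg_meas hg) (fun _ => norm_nonneg _)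
    (1 / 2) q 1 (by positivity) one_pos hq1
  have m1 := lc_meas2 (fun t => ‖R (g t)‖) q p
  have m2 := lc_meas1 (fun t => ‖R (g t)‖) (1 / 2) q 1 (by positivity)
  have hstep : ∫⁻ l in Ioi (0:ℝ), volume {x | 2 * l < ‖cv S g x‖} * ENNReal.ofReal (l ^ (q - 1))
      ≤ ENNReal.ofReal C * (ENNReal.ofReal (1 / (p - q)) * Ia) +
        ENNReal.ofReal (6 * C + 4) * (ENNReal.ofReal ((1 / 2) ^ (-(q - 1)) / (q - 1)) * Ia) := by
    refine le_trans ?_ (add_le_add (mul_le_mul_right h1 _) (mul_le_mul_right h2 _))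
    rw [← lintegral_const_mul _ m1, ← lintegral_const_mul _ m2,
      ← lintegral_add_left (m1.const_mul _)]
    refine setLIntegral_mono' measurableSet_Ioi fun l hl => ?_
    have hl' : 0 < l := hl
    refine (mul_le_mul_left (D.cz_weak hg hl') _).trans (le_of_eq ?_)
    rw [add_mul, mul_assoc, mul_assoc (ENNReal.ofReal (6 * C + 4))]
  calc _ = _ := h0
    _ ≤ ENNReal.ofReal (2 ^ q * q) * _ := mul_le_mul_right hstep _
    _ = _ := by
      rw [← mul_assoc, ← mul_assoc, ← add_mul, ← ENNReal.ofReal_mul (by positivity),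
        ← ENNReal.ofReal_mul (by positivity), ← ENNReal.ofReal_add (by positivity) (by positivity),
        ← mul_assoc, ← ENNReal.ofReal_mul (by positivity)]

lemma lq_all {q : ℝ} (hq1 : 1 < q) : ∃ K : ℝ, ∀ g, Nice g →
    ∫⁻ t, ENNReal.ofReal (‖cv S g t‖ ^ q) ≤
      ENNReal.ofReal K * ∫⁻ t, ENNReal.ofReal (‖R (g t)‖ ^ q) := by
  rcases lt_trichotomy q p with h | h | h
  · exact D.lq_small hq1 h
  · subst h; exact ⟨C, D.lp⟩
  · exact D.lq_big h

end SGData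
end


lemma hardy_w (q δ : ℝ) (hq : 1 < q) (hδ : δ < 1 - 1 / q) :
    ∃ K : ℝ, ∀ a : ℝ → ENNReal, Measurable a →
      ∫⁻ t in Ioi (0:ℝ), (ENNReal.ofReal (t ^ (δ - 1)) * ∫⁻ s in Ioo 0 t, a s) ^ q ≤
      ENNReal.ofReal K * ∫⁻ t in Ioi (0:ℝ), (ENNReal.ofReal (t ^ δ) * a t) ^ q := by
  have hq0 : 0 < q := by linarith
  set q' := q.conjExponent with hq'
  have hc : q.HolderConjugate q' := Real.HolderConjugate.conjExponent hq
  have hq'0 : 0 < q' := hc.symm.pos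
  obtain ⟨η, hη1, hη2⟩ := exists_between hδ
  have hinv : q⁻¹ + q'⁻¹ = 1 := hc.inv_add_inv_eq_one
  set c := 1 - η * q' with hcd
  have hc0 : 0 < c := by
    have h1 : η < q'⁻¹ := by rw [one_div] at hη2; linarith
    have h2 : η * q' < 1 := by
      calc η * q' < q'⁻¹ * q' := by gcongr
        _ = 1 := inv_mul_cancel₀ hq'0.ne'
    linarith
  have hqq : q / q' = q - 1 := by
    have : q'⁻¹ = 1 - q⁻¹ := by linarith
    rw [div_eq_mul_inv, this]; field_simp
  have hmul : q' * (q - 1) = q := by rw [← hqq]; field_simp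
  set d := (η - δ) * q with hd
  have hd0 : 0 < d := mul_pos (by linarith) hq0
  set K := c ^ (-(q - 1)) / d with hK
  refine ⟨K, fun a ha => ?_⟩
  have hker : ∀ t > 0, ∫⁻ s in Ioo 0 t, ENNReal.ofReal (s ^ (-η)) ^ q' =
      ENNReal.ofReal (t ^ c / c) := by
    intro t ht
    have e : ∫⁻ s in Ioo 0 t, ENNReal.ofReal (s ^ (-η)) ^ q' =
        ∫⁻ s in Ioc 0 t, ENNReal.ofReal (s ^ (-η * q')) := by
      rw [setLIntegral_congr Ioo_ae_eq_Ioc]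
      refine setLIntegral_congr_fun measurableSet_Ioc fun s hs => ?_
      have hs0 : 0 < s := hs.1
      show ENNReal.ofReal (s ^ (-η)) ^ q' = ENNReal.ofReal (s ^ (-η * q'))
      rw [ENNReal.ofReal_rpow_of_pos (by positivity), ← Real.rpow_mul hs0.le]
    have hii := intervalIntegral.intervalIntegrable_rpow' (a := 0) (b := t) (r := -η * q')
      (by linarith)
    rw [e, ← ofReal_integral_eq_lintegral_ofReal
      ((intervalIntegrable_iff_integrableOn_Ioc_of_le ht.le).1 hii),
      ← intervalIntegral.integral_of_le ht.le, integral_rpow (Or.inl (by linarith))]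
    · have : -η * q' + 1 = c := by rw [hcd]; ring
      rw [this, Real.zero_rpow hc0.ne', sub_zero]
    · refine (ae_restrict_mem measurableSet_Ioc).mono fun s hs => ?_
      exact Real.rpow_nonneg hs.1.le _
  set b : ℝ → ENNReal := fun s => (a s * ENNReal.ofReal (s ^ η)) ^ q with hb
  have hbm : Measurable b := by fun_prop
  have hpt : ∀ t > 0, (ENNReal.ofReal (t ^ (δ - 1)) * ∫⁻ s in Ioo 0 t, a s) ^ q ≤
      ENNReal.ofReal (c ^ (-(q - 1)) * t ^ (-d - 1)) * ∫⁻ s in Ioo 0 t, b s := by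
    intro t ht
    have h1 : ∫⁻ s in Ioo 0 t, a s ≤ (∫⁻ s in Ioo 0 t, b s) ^ (1 / q) *
        (ENNReal.ofReal (t ^ c / c)) ^ (1 / q') := by
      rw [← hker t ht]
      refine le_trans (le_of_eq ?_) (ENNReal.lintegral_mul_le_Lp_mul_Lq _ hc
        (f := fun s => a s * ENNReal.ofReal (s ^ η)) (g := fun s => ENNReal.ofReal (s ^ (-η)))
        (by fun_prop) (by fun_prop))
      refine setLIntegral_congr_fun measurableSet_Ioo fun s hs => ?_
      have hs0 : 0 < s := hs.1
      show a s = a s * ENNReal.ofReal (s ^ η) * ENNReal.ofReal (s ^ (-η))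
      rw [mul_assoc, ← ENNReal.ofReal_mul (by positivity), ← Real.rpow_add hs0]
      simp
    calc _ ≤ (ENNReal.ofReal (t ^ (δ - 1)) * ((∫⁻ s in Ioo 0 t, b s) ^ (1 / q) *
        (ENNReal.ofReal (t ^ c / c)) ^ (1 / q'))) ^ q := by gcongr
      _ = ENNReal.ofReal (t ^ (δ - 1)) ^ q * ((∫⁻ s in Ioo 0 t, b s) *
        (ENNReal.ofReal (t ^ c / c)) ^ (q - 1)) := by
          rw [ENNReal.mul_rpow_of_nonneg _ _ hq0.le, ENNReal.mul_rpow_of_nonneg _ _ hq0.le,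
            ← ENNReal.rpow_mul, ← ENNReal.rpow_mul, one_div, inv_mul_cancel₀ hq0.ne',
            ENNReal.rpow_one, ← hqq]
          congr 3
          field_simp
      _ = _ := by
          rw [ENNReal.ofReal_rpow_of_pos (by positivity), ENNReal.ofReal_rpow_of_pos (by positivity),
            mul_comm (∫⁻ s in Ioo 0 t, b s), ← mul_assoc, ← ENNReal.ofReal_mul (by positivity)]
          congr 2
          rw [Real.div_rpow (by positivity) hc0.le, ← Real.rpow_mul ht.le, ← Real.rpow_mul ht.le,
            Real.rpow_neg hc0.le, div_eq_mul_inv, ← mul_assoc, ← Real.rpow_add ht, mul_comm]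
          congr 2
          rw [hcd, hd, sub_mul (1:ℝ), mul_assoc η, hmul]; ring
  have hkey : ∀ s > 0, ∫⁻ t in Ioi s, ENNReal.ofReal (c ^ (-(q - 1)) * t ^ (-d - 1)) =
      ENNReal.ofReal (K * s ^ (-d)) := by
    intro s hs
    rw [← ofReal_integral_eq_lintegral_ofReal
      ((integrableOn_Ioi_rpow_of_lt (by linarith) hs).const_mul _), integral_const_mul,
      integral_Ioi_rpow_of_lt (by linarith) hs]
    · congr 1
      rw [hK, show -d - 1 + 1 = -d by ring]
      field_simp
    · refine (ae_restrict_mem measurableSet_Ioi).mono fun t ht => ?_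
      have ht' : 0 < t := hs.trans ht
      simp only [Pi.zero_apply]; positivity
  calc _ ≤ ∫⁻ t in Ioi (0:ℝ), ENNReal.ofReal (c ^ (-(q - 1)) * t ^ (-d - 1)) *
        ∫⁻ s in Ioo 0 t, b s := setLIntegral_mono' measurableSet_Ioi fun t ht => hpt t ht
    _ = ∫⁻ t in Ioi (0:ℝ), ∫⁻ s in Ioi (0:ℝ), {z : ℝ × ℝ | z.2 < z.1}.indicator (fun z =>
        ENNReal.ofReal (c ^ (-(q - 1)) * z.1 ^ (-d - 1)) * b z.2) (t, s) := by
        congr 1; ext t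
        rw [← lintegral_const_mul _ hbm]
        have e : Ioo 0 t = Iio t ∩ Ioi 0 := by ext s; simp [and_comm]
        rw [e, ← Measure.restrict_restrict measurableSet_Iio, ← lintegral_indicator measurableSet_Iio]
        congr 1
    _ = ∫⁻ s in Ioi (0:ℝ), ∫⁻ t in Ioi (0:ℝ), {z : ℝ × ℝ | z.2 < z.1}.indicator (fun z =>
        ENNReal.ofReal (c ^ (-(q - 1)) * z.1 ^ (-d - 1)) * b z.2) (t, s) := by
        apply lintegral_lintegral_swap
        apply Measurable.aemeasurable
        apply Measurable.indicator _ (measurableSet_lt measurable_snd measurable_fst)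
        fun_prop
    _ = ∫⁻ s in Ioi (0:ℝ), ENNReal.ofReal K * (ENNReal.ofReal (s ^ δ) * a s) ^ q := by
        refine setLIntegral_congr_fun measurableSet_Ioi fun s hs => ?_
        have hs0 : 0 < s := hs
        have e : ∫⁻ t in Ioi (0:ℝ), {z : ℝ × ℝ | z.2 < z.1}.indicator (fun z =>
            ENNReal.ofReal (c ^ (-(q - 1)) * z.1 ^ (-d - 1)) * b z.2) (t, s) =
            ∫⁻ t in Ioi s, ENNReal.ofReal (c ^ (-(q - 1)) * t ^ (-d - 1)) * b s := by
          have e' : Ioi s = Ioi s ∩ Ioi 0 := by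
            ext t; simp; intro h; linarith
          rw [e', ← Measure.restrict_restrict measurableSet_Ioi,
            ← lintegral_indicator (s := Ioi s) measurableSet_Ioi]
          congr 1
        rw [e, lintegral_mul_const _ (by fun_prop), hkey s hs0, hb]
        simp only
        rw [ENNReal.mul_rpow_of_nonneg _ _ hq0.le, ENNReal.mul_rpow_of_nonneg _ _ hq0.le,
          ENNReal.ofReal_rpow_of_pos (by positivity), ENNReal.ofReal_rpow_of_pos (by positivity),
          ENNReal.ofReal_mul (by positivity), ← Real.rpow_mul hs0.le, ← Real.rpow_mul hs0.le]
        have e2 : s ^ (δ * q) = s ^ (-d) * s ^ (η * q) := by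
          rw [← Real.rpow_add hs0]; congr 1; rw [hd]; ring
        rw [e2, ENNReal.ofReal_mul (by positivity)]
        ring
    _ = _ := lintegral_const_mul' _ _ ENNReal.ofReal_ne_top

section
variable {X : Type*} [NormedAddCommGroup X] [NormedSpace ℝ X]
namespace SGData
variable {R : X →L[ℝ] X} {S : ℝ → X →L[ℝ] X} {M C p : ℝ} [CompleteSpace X] (D : SGData R S M C p)
include D

lemma lw_all {q δ : ℝ} (hq1 : 1 < q) (hδ0 : 0 ≤ δ) (hδ : δ < 1 - 1 / q) :
    ∃ K : ℝ, 0 ≤ K ∧ ∀ g, Nice g → (∃ T, ∀ t > T, g t = 0) →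
    ∫⁻ t in Ioi (0:ℝ), ENNReal.ofReal ((t ^ δ * ‖cv S g t‖) ^ q) ≤
      ENNReal.ofReal K * ∫⁻ t in Ioi (0:ℝ), ENNReal.ofReal ((t ^ δ * ‖R (g t)‖) ^ q) := by
  have hq0 : 0 < q := by linarith
  have hC := D.hC
  obtain ⟨K₁, hK₁⟩ := D.lq_all hq1
  obtain ⟨K₂, hK₂⟩ := hardy_w q δ hq1 hδ
  have hδ1 : δ ≤ 1 := by
    have : 0 < 1 / q := by positivity
    linarith
  refine ⟨2 ^ (q - 1) * (|K₁| + C ^ q * |K₂|), by positivity, fun g hg ⟨T, hT⟩ => ?_⟩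
  obtain ⟨B, hB⟩ := hg.bdd
  have hB0 : 0 ≤ B := (norm_nonneg _).trans (hB 0)
  set h : ℝ → X := fun s => s ^ δ • g s with hh
  have hpow : ∀ s, ‖h s‖ ≤ |T| ^ δ * ‖g s‖ := by
    intro s
    by_cases hs : s ≤ 0
    · simp [hh, hg.neg s hs]
    by_cases hs2 : T < s
    · simp [hh, hT s hs2]
    push Not at hs hs2
    simp only [hh, norm_smul]
    gcongr
    rw [Real.norm_of_nonneg (by positivity)]
    exact Real.rpow_le_rpow hs.le (hs2.trans (le_abs_self T)) hδ0
  have hsm : StronglyMeasurable h :=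
    (Measurable.stronglyMeasurable (by fun_prop : Measurable fun s : ℝ => s ^ δ)).smul hg.sm
  have hn : Nice h := by
    refine ⟨hsm, (hg.int.norm.const_mul (|T| ^ δ)).mono' hsm.aestronglyMeasurable
      (Filter.Eventually.of_forall hpow), ⟨|T| ^ δ * B, fun t => (hpow t).trans ?_⟩, fun t ht => ?_⟩
    · gcongr; exact hB t
    · simp [hh, hg.neg t ht]
  have hRi : Integrable (fun s => ‖R (g s)‖) := (R.integrable_comp hg.int).norm
  have hsplit : ∀ t > 0, t ^ δ * ‖cv S g t‖ ≤ ‖cv S h t‖ +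
      C * (t ^ (δ - 1) * ∫ s in Ioo 0 t, ‖R (g s)‖) := by
    intro t ht
    have e : t ^ δ • cv S g t = cv S h t + ∫ s, (t ^ δ - s ^ δ) • S (t - s) (g s) := by
      have i1 : Integrable (fun s => t ^ δ • S (t - s) (g s)) := (D.integrable hg t).smul (t ^ δ)
      have i2 : Integrable (fun s => s ^ δ • S (t - s) (g s)) := by
        have := D.integrable hn t
        simpa [hh, map_smul] using this
      simp only [sub_smul]
      rw [integral_sub i1 i2, integral_smul]
      simp only [cv, hh, map_smul]
      abel
    have e' : t ^ δ * ‖cv S g t‖ = ‖t ^ δ • cv S g t‖ := by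
      rw [norm_smul, Real.norm_of_nonneg (by positivity)]
    rw [e', e]
    refine (norm_add_le _ _).trans (add_le_add le_rfl ?_)
    rw [← integral_indicator measurableSet_Ioo, ← integral_const_mul, ← integral_const_mul]
    refine norm_integral_le_of_norm_le (((hRi.indicator measurableSet_Ioo).const_mul _).const_mul _)
      (Filter.Eventually.of_forall fun s => ?_)
    have hnn : 0 ≤ C * (t ^ (δ - 1) * (Ioo 0 t).indicator (fun s => ‖R (g s)‖) s) := by
      have : 0 ≤ (Ioo 0 t).indicator (fun s => ‖R (g s)‖) s := indicator_nonneg (fun _ _ => norm_nonneg _) s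
      positivity
    rcases lt_trichotomy s t with hst | hst | hst
    · by_cases hs0 : s ≤ 0
      · simp only [hg.neg s hs0, map_zero, smul_zero, norm_zero]; exact hnn
      push Not at hs0
      rw [indicator_of_mem (show s ∈ Ioo 0 t from ⟨hs0, hst⟩), norm_smul]
      have h1 : s ^ δ ≤ t ^ δ := Real.rpow_le_rpow hs0.le hst.le hδ0
      have h2 : t ^ δ - s ^ δ ≤ t ^ (δ - 1) * (t - s) := by
        have h3 : s / t ≤ (s / t) ^ δ := by
          conv_lhs => rw [← Real.rpow_one (s / t)]
          exact Real.rpow_le_rpow_of_exponent_ge (by positivity) ((div_le_one ht).2 hst.le) hδ1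
        rw [Real.div_rpow hs0.le ht.le, le_div_iff₀ (by positivity)] at h3
        rw [Real.rpow_sub_one ht.ne']
        have : s / t * t ^ δ = t ^ δ / t * s := by ring
        have : t ^ δ / t * (t - s) = t ^ δ - t ^ δ / t * s := by field_simp
        linarith
      rw [Real.norm_of_nonneg (by linarith)]
      have hts : 0 < t - s := by linarith
      calc _ ≤ (t ^ (δ - 1) * (t - s)) * (C / (t - s) * ‖R (g s)‖) := by
            gcongr
            exact D.dec _ hts _
        _ = _ := by field_simp
    · subst hst; simp only [sub_self, zero_smul, norm_zero]; exact hnn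
    · rw [D.neg (t - s) (by linarith)]
      simp only [ContinuousLinearMap.zero_apply, smul_zero, norm_zero]; exact hnn
  have hRm : Measurable (fun s => ENNReal.ofReal ‖R (g s)‖) := (D.Rg_meas hg).ennreal_ofReal
  have hrw : ∀ t > 0, ENNReal.ofReal ((t ^ δ * ‖R (g t)‖) ^ q) =
      (ENNReal.ofReal (t ^ δ) * ENNReal.ofReal ‖R (g t)‖) ^ q := by
    intro t ht
    rw [← ENNReal.ofReal_mul (by positivity), ENNReal.ofReal_rpow_of_nonneg (by positivity) hq0.le]
  have hI1 : ∫⁻ t in Ioi (0:ℝ), ENNReal.ofReal (‖cv S h t‖ ^ q) ≤ ENNReal.ofReal |K₁| *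
      ∫⁻ t in Ioi (0:ℝ), ENNReal.ofReal ((t ^ δ * ‖R (g t)‖) ^ q) := by
    refine (setLIntegral_le_lintegral _ _).trans ((hK₁ h hn).trans ?_)
    refine mul_le_mul' (ENNReal.ofReal_le_ofReal (le_abs_self _)) ?_
    rw [← lintegral_indicator measurableSet_Ioi]
    refine lintegral_mono fun t => ?_
    by_cases ht : 0 < t
    · rw [indicator_of_mem (mem_Ioi.2 ht)]
      simp only [hh, map_smul, norm_smul]
      rw [Real.norm_of_nonneg (by positivity)]
    · simp [hh, hg.neg t (not_lt.1 ht), Real.zero_rpow hq0.ne']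
  have hI2 : ∫⁻ t in Ioi (0:ℝ), ENNReal.ofReal ((t ^ (δ - 1) * ∫ s in Ioo 0 t, ‖R (g s)‖) ^ q) ≤
      ENNReal.ofReal |K₂| *
      ∫⁻ t in Ioi (0:ℝ), ENNReal.ofReal ((t ^ δ * ‖R (g t)‖) ^ q) := by
    rw [setLIntegral_congr_fun measurableSet_Ioi hrw]
    refine le_trans (le_of_eq ?_) ((hK₂ _ hRm).trans
      (mul_le_mul_left (ENNReal.ofReal_le_ofReal (le_abs_self _)) _))
    refine setLIntegral_congr_fun measurableSet_Ioi fun t ht => ?_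
    have ht' : 0 < t := ht
    have hi0 : 0 ≤ ∫ s in Ioo 0 t, ‖R (g s)‖ := integral_nonneg fun _ => norm_nonneg _
    rw [← ofReal_integral_eq_lintegral_ofReal hRi.integrableOn
      (Filter.Eventually.of_forall fun _ => norm_nonneg _), ← ENNReal.ofReal_mul (by positivity),
      ENNReal.ofReal_rpow_of_nonneg (by positivity) hq0.le]
  have hcvm : Measurable (fun t => ENNReal.ofReal (‖cv S h t‖ ^ q)) :=
    ((D.cv_sm hn).norm.measurable.pow_const q).ennreal_ofReal
  calc ∫⁻ t in Ioi (0:ℝ), ENNReal.ofReal ((t ^ δ * ‖cv S g t‖) ^ q)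
      ≤ ∫⁻ t in Ioi (0:ℝ), ENNReal.ofReal (2 ^ (q - 1)) * (ENNReal.ofReal (‖cv S h t‖ ^ q) +
        ENNReal.ofReal (C ^ q) *
          ENNReal.ofReal ((t ^ (δ - 1) * ∫ s in Ioo 0 t, ‖R (g s)‖) ^ q)) := by
        refine setLIntegral_mono' measurableSet_Ioi fun t ht => ?_
        have ht' : 0 < t := ht
        have hi0 : 0 ≤ ∫ s in Ioo 0 t, ‖R (g s)‖ := integral_nonneg fun _ => norm_nonneg _
        rw [← ENNReal.ofReal_mul (by positivity), ← ENNReal.ofReal_add (by positivity) (by positivity),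
          ← ENNReal.ofReal_mul (by positivity), ← Real.mul_rpow hC (by positivity)]
        apply ENNReal.ofReal_le_ofReal
        exact (Real.rpow_le_rpow (by positivity) (hsplit t ht') hq0.le).trans
          (rpow_add_le' (norm_nonneg _) (by positivity) hq1.le)
    _ = ENNReal.ofReal (2 ^ (q - 1)) * ((∫⁻ t in Ioi (0:ℝ), ENNReal.ofReal (‖cv S h t‖ ^ q)) +
        ENNReal.ofReal (C ^ q) * ∫⁻ t in Ioi (0:ℝ),
          ENNReal.ofReal ((t ^ (δ - 1) * ∫ s in Ioo 0 t, ‖R (g s)‖) ^ q)) := by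
        rw [lintegral_const_mul' _ _ ENNReal.ofReal_ne_top, lintegral_add_left hcvm,
          lintegral_const_mul' _ _ ENNReal.ofReal_ne_top]
    _ ≤ ENNReal.ofReal (2 ^ (q - 1)) * (ENNReal.ofReal |K₁| *
      (∫⁻ t in Ioi (0:ℝ), ENNReal.ofReal ((t ^ δ * ‖R (g t)‖) ^ q)) +
        ENNReal.ofReal (C ^ q) * (ENNReal.ofReal |K₂| *
      ∫⁻ t in Ioi (0:ℝ), ENNReal.ofReal ((t ^ δ * ‖R (g t)‖) ^ q))) := by
        gcongr
    _ = _ := by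
        rw [ENNReal.ofReal_mul (by positivity), ENNReal.ofReal_add (by positivity) (by positivity),
          ENNReal.ofReal_mul (by positivity)]
        ring

end SGData
end


section
variable {X : Type*} [NormedAddCommGroup X] [NormedSpace ℝ X]

/-- Abstract maximal regularity for the bounded inverse `R`. -/
structure MRR (R : X →L[ℝ] X) (p C : ℝ) : Prop where
  hp : 1 < p
  hC : 0 ≤ C
  inj : Function.Injective R
  dr : DenseRange R
  ex : ∀ f : ℝ → X, MemLp f (ENNReal.ofReal p) (volume.restrict (Ioi 0)) →
    ∃ y : ℝ → X, MemLp y (ENNReal.ofReal p) (volume.restrict (Ioi 0)) ∧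
      (∀ᵐ t ∂(volume.restrict (Ioi 0)), R (y t) = ∫ s in (0:ℝ)..t, (f s - y s)) ∧
      ∫⁻ t in Ioi (0:ℝ), ENNReal.ofReal (‖y t‖ ^ p) ≤
        ENNReal.ofReal C * ∫⁻ t in Ioi (0:ℝ), ENNReal.ofReal (‖f t‖ ^ p)
  un : ∀ y : ℝ → X, MemLp y (ENNReal.ofReal p) (volume.restrict (Ioi 0)) →
    (∀ᵐ t ∂(volume.restrict (Ioi 0)), R (y t) = -∫ s in (0:ℝ)..t, y s) →
    ∀ᵐ t ∂(volume.restrict (Ioi 0)), y t = 0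

lemma mp_shift (h : ℝ) : MeasurePreserving (fun t : ℝ => t - h)
    (volume.restrict (Ioi h)) (volume.restrict (Ioi 0)) := by
  have h1 := (measurePreserving_sub_right (volume : Measure ℝ) h).restrict_preimage
    (s := Ioi (0:ℝ)) measurableSet_Ioi
  have e : (fun t : ℝ => t - h) ⁻¹' Ioi 0 = Ioi h := by ext t; simp
  rwa [e] at h1

lemma ii_of_memLp {p : ℝ} (hp : 1 < p) {f : ℝ → X}
    (hf : MemLp f (ENNReal.ofReal p) (volume.restrict (Ioi 0))) {a b : ℝ} (ha : 0 ≤ a) (hb : 0 ≤ b) :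
    IntervalIntegrable f volume a b := by
  have key : ∀ a b : ℝ, 0 ≤ a → IntegrableOn f (Ioc a b) := by
    intro a b ha
    have h1 : MemLp f (ENNReal.ofReal p) (volume.restrict (Ioc a b)) :=
      hf.mono_measure (Measure.restrict_mono (fun t ht => mem_Ioi.2 (ha.trans_lt ht.1)) le_rfl)
    have : IsFiniteMeasure (volume.restrict (Ioc a b)) := ⟨by simp⟩
    exact h1.integrable (by
      rw [← ENNReal.ofReal_one]; exact ENNReal.ofReal_le_ofReal hp.le)
  exact ⟨key a b ha, key b a hb⟩

lemma memLp_exp {p : ℝ} (hp : 1 < p) (x : X) :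
    MemLp (fun t : ℝ => Real.exp (-t) • x) (ENNReal.ofReal p) (volume.restrict (Ioi 0)) := by
  have hp0 : 0 < p := by linarith
  refine (memLp_norm_rpow_iff (q := ENNReal.ofReal p) ?_ ?_ ?_).1 ?_
  · exact (Continuous.aestronglyMeasurable (by fun_prop))
  · simpa using hp0
  · simp
  · rw [ENNReal.div_self (by simpa using hp0) (by simp), memLp_one_iff_integrable,
      ENNReal.toReal_ofReal hp0.le]
    have e : (fun t : ℝ => ‖Real.exp (-t) • x‖ ^ p) = fun t => Real.exp (-p * t) * ‖x‖ ^ p := by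
      ext t
      rw [norm_smul, Real.mul_rpow (by positivity) (by positivity),
        Real.norm_of_nonneg (Real.exp_pos _).le, ← Real.exp_mul]
      ring_nf
    rw [e]
    exact (exp_neg_integrableOn_Ioi 0 hp0).mul_const _

namespace MRR
variable [CompleteSpace X] {R : X →L[ℝ] X} {p C : ℝ} (D : MRR R p C)
include D

lemma orbit (x : X) : ∃ σ : ℝ → X, MemLp σ (ENNReal.ofReal p) (volume.restrict (Ioi 0)) ∧
    ∀ᵐ t ∂(volume.restrict (Ioi 0)), R (σ t) = R x - ∫ s in (0:ℝ)..t, σ s := by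
  obtain ⟨y, hy, hy2, -⟩ := D.ex _ (memLp_exp D.hp (R x - x))
  refine ⟨fun t => Real.exp (-t) • x + y t, (memLp_exp D.hp x).add hy, ?_⟩
  filter_upwards [hy2, ae_restrict_mem measurableSet_Ioi] with t ht ht0
  have ht0' : (0:ℝ) ≤ t := le_of_lt ht0
  have ex : ∀ v : X, ∫ s in (0:ℝ)..t, Real.exp (-s) • v = (1 - Real.exp (-t)) • v := by
    intro v
    rw [intervalIntegral.integral_smul_const]
    congr 1
    rw [intervalIntegral.integral_comp_neg (fun s => Real.exp s)]
    simp
  have hii : ∀ v : X, IntervalIntegrable (fun s : ℝ => Real.exp (-s) • v) volume 0 t := fun v =>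
    Continuous.intervalIntegrable (by fun_prop) _ _
  have hyi : IntervalIntegrable y volume 0 t := ii_of_memLp D.hp hy le_rfl ht0'
  rw [intervalIntegral.integral_sub (hii _) hyi, ex] at ht
  rw [intervalIntegral.integral_add (hii _) hyi, ex, map_add, map_smul, ht]
  module

lemma lu_aux {z : ℝ → X} (hz : Integrable z) {h : ℝ} (hh : 0 < h)
    (he : ∀ᵐ t ∂(volume.restrict (Ioc 0 h)), R (z t) = -∫ s in (0:ℝ)..t, z s) :
    ∀ᵐ t ∂(volume.restrict (Ioc 0 h)), z t = 0 := by
  have hii : ∀ a b, IntervalIntegrable z volume a b := fun a b => hz.intervalIntegrable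
  set J : ℝ → X := fun t => ∫ s in (0:ℝ)..t, z s with hJ
  have hJc : Continuous J := intervalIntegral.continuous_primitive hii 0
  have hRJ : ∀ t ∈ Icc 0 h, R (J t) = -∫ s in (0:ℝ)..t, J s := by
    intro t ht
    simp only [hJ]
    rw [← ContinuousLinearMap.intervalIntegral_comp_comm _ (hii 0 t),
      ← intervalIntegral.integral_neg]
    apply intervalIntegral.integral_congr_ae
    have := (ae_restrict_iff' measurableSet_Ioc).1 he
    filter_upwards [this] with s hs hs'
    rw [uIoc_of_le ht.1] at hs'
    exact hs ⟨hs'.1, hs'.2.trans ht.2⟩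
  obtain ⟨σ, hσ, hσ2⟩ := D.orbit (J h)
  set w : ℝ → X := fun t => (Iic h).indicator J t + (Ioi h).indicator (fun t => σ (t - h)) t with hw
  have hw1 : ∀ t ≤ h, w t = J t := by
    intro t ht; simp [hw, ht, not_lt.2 ht]
  have hw2 : ∀ t > h, w t = σ (t - h) := by
    intro t ht; simp [hw, ht, not_le.2 ht]
  have hwm : MemLp w (ENNReal.ofReal p) (volume.restrict (Ioi 0)) := by
    refine MemLp.add ?_ ?_
    · rw [memLp_indicator_iff_restrict measurableSet_Iic, Measure.restrict_restrict measurableSet_Iic]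
      have e : Iic h ∩ Ioi 0 = Ioc 0 h := by ext t; simp [and_comm]
      rw [e]
      have : IsFiniteMeasure (volume.restrict (Ioc 0 h)) := ⟨by simp⟩
      obtain ⟨B, hB⟩ := isCompact_Icc.exists_bound_of_continuousOn (s := Icc 0 h) hJc.continuousOn
      refine MemLp.of_bound hJc.aestronglyMeasurable B ?_
      exact (ae_restrict_mem measurableSet_Ioc).mono fun t ht => hB t ⟨ht.1.le, ht.2⟩
    · rw [memLp_indicator_iff_restrict measurableSet_Ioi, Measure.restrict_restrict measurableSet_Ioi]
      have e : Ioi h ∩ Ioi 0 = Ioi h := by ext t; simp; intro h'; linarith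
      rw [e]
      exact hσ.comp_measurePreserving (mp_shift h)
  have hii2 : ∀ t ≥ 0, IntervalIntegrable w volume 0 t := fun t ht =>
    ii_of_memLp D.hp hwm le_rfl ht
  have hw0 := D.un w hwm (by
    have hae : ∀ᵐ t ∂(volume.restrict (Ioi h)), R (σ (t - h)) = R (J h) - ∫ s in (0:ℝ)..(t - h), σ s :=
      (mp_shift h).quasiMeasurePreserving.ae hσ2
    rw [ae_restrict_iff' measurableSet_Ioi] at hae ⊢
    filter_upwards [hae] with t ht ht0
    have ht0' : (0:ℝ) < t := ht0
    by_cases hth : t ≤ h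
    · rw [hw1 t hth, hRJ t ⟨ht0'.le, hth⟩]
      congr 1
      refine intervalIntegral.integral_congr fun s hs => ?_
      rw [uIcc_of_le ht0'.le] at hs
      exact (hw1 s (hs.2.trans hth)).symm
    · push Not at hth
      rw [hw2 t hth, ht hth, hRJ h ⟨hh.le, le_rfl⟩,
        ← intervalIntegral.integral_add_adjacent_intervals (hii2 h hh.le)
          (ii_of_memLp D.hp hwm hh.le ht0'.le)]
      have e1 : ∫ s in (0:ℝ)..h, w s = ∫ s in (0:ℝ)..h, J s := by
        refine intervalIntegral.integral_congr fun s hs => ?_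
        rw [uIcc_of_le hh.le] at hs
        exact hw1 s hs.2
      have e2 : ∫ s in h..t, w s = ∫ s in (0:ℝ)..(t - h), σ s := by
        have := intervalIntegral.integral_comp_sub_right (a := h) (b := t) σ h
        rw [sub_self] at this
        rw [← this]
        apply intervalIntegral.integral_congr_ae
        refine Filter.Eventually.of_forall fun s hs => ?_
        rw [uIoc_of_le hth.le] at hs
        exact hw2 s hs.1
      rw [e1, e2]; abel)
  -- hence J = 0 on (0,h), and R z = 0
  have hJ0 : ∀ᵐ t ∂(volume.restrict (Ioc 0 h)), J t = 0 := by
    rw [ae_restrict_iff' measurableSet_Ioi] at hw0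
    rw [ae_restrict_iff' measurableSet_Ioc]
    filter_upwards [hw0] with t ht ht'
    rw [← hw1 t ht'.2]; exact ht ht'.1
  filter_upwards [hJ0, he] with t h1 h2
  apply D.inj
  rw [h2, map_zero]
  simp only [hJ] at h1
  rw [h1, neg_zero]

lemma lu {z : ℝ → X} {h : ℝ} (hh : 0 < h) (hz : IntegrableOn z (Ioc 0 h))
    (he : ∀ᵐ t ∂(volume.restrict (Ioc 0 h)), R (z t) = -∫ s in (0:ℝ)..t, z s) :
    ∀ᵐ t ∂(volume.restrict (Ioc 0 h)), z t = 0 := by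
  have h1 := D.lu_aux (z := (Ioc 0 h).indicator z) ((integrable_indicator_iff measurableSet_Ioc).2 hz)
    hh (by
      filter_upwards [he, ae_restrict_mem measurableSet_Ioc] with t ht ht'
      rw [indicator_of_mem ht', ht]
      congr 1
      apply intervalIntegral.integral_congr_ae
      refine Filter.Eventually.of_forall fun s hs => ?_
      rw [uIoc_of_le ht'.1.le] at hs
      rw [indicator_of_mem (show s ∈ Ioc 0 h from ⟨hs.1, hs.2.trans ht'.2⟩)])
  filter_upwards [h1, ae_restrict_mem measurableSet_Ioc] with t ht ht'
  rwa [indicator_of_mem ht'] at ht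

lemma ll {f y : ℝ → X} {h : ℝ} (hh : 0 < h) (hy : IntegrableOn y (Ioc 0 h))
    (hf : MemLp f (ENNReal.ofReal p) (volume.restrict (Ioc 0 h)))
    (he : ∀ᵐ t ∂(volume.restrict (Ioc 0 h)), R (y t) = ∫ s in (0:ℝ)..t, (f s - y s)) :
    ∫⁻ t in Ioc 0 h, ENNReal.ofReal (‖y t‖ ^ p) ≤
      ENNReal.ofReal C * ∫⁻ t in Ioc 0 h, ENNReal.ofReal (‖f t‖ ^ p) := by
  have hp0 : 0 < p := by linarith [D.hp]
  have hsub : Ioc 0 h ∩ Ioi (0:ℝ) = Ioc 0 h := inter_eq_left.2 (fun t ht => ht.1)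
  have hF : MemLp ((Ioc 0 h).indicator f) (ENNReal.ofReal p) (volume.restrict (Ioi 0)) := by
    rw [memLp_indicator_iff_restrict measurableSet_Ioc, Measure.restrict_restrict measurableSet_Ioc,
      hsub]
    exact hf
  obtain ⟨Y, hY, hY2, hY3⟩ := D.ex _ hF
  have hYi : IntegrableOn Y (Ioc 0 h) :=
    (intervalIntegrable_iff_integrableOn_Ioc_of_le hh.le).1 (ii_of_memLp D.hp hY le_rfl hh.le)
  have : IsFiniteMeasure (volume.restrict (Ioc 0 h)) := ⟨by simp⟩
  have hfi : IntegrableOn f (Ioc 0 h) := hf.integrable (by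
    rw [← ENNReal.ofReal_one]; exact ENNReal.ofReal_le_ofReal D.hp.le)
  have hz := D.lu hh (z := fun t => y t - Y t) (hy.sub hYi) (by
    have hY2' := ae_restrict_of_ae_restrict_of_subset (s := Ioc 0 h) (fun t ht => ht.1) hY2
    filter_upwards [hY2', he, ae_restrict_mem measurableSet_Ioc] with t h1 h2 ht
    have hi : ∀ {u : ℝ → X}, IntegrableOn u (Ioc 0 h) → IntervalIntegrable u volume 0 t := by
      intro u hu
      rw [intervalIntegrable_iff_integrableOn_Ioc_of_le ht.1.le]
      exact hu.mono_set (Ioc_subset_Ioc_right ht.2)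
    have e : ∫ s in (0:ℝ)..t, ((Ioc 0 h).indicator f s - Y s) = ∫ s in (0:ℝ)..t, (f s - Y s) := by
      apply intervalIntegral.integral_congr_ae
      refine Filter.Eventually.of_forall fun s hs => ?_
      rw [uIoc_of_le ht.1.le] at hs
      rw [indicator_of_mem (show s ∈ Ioc 0 h from ⟨hs.1, hs.2.trans ht.2⟩)]
    rw [map_sub, h1, h2, e, intervalIntegral.integral_sub (hi hfi) (hi hy),
      intervalIntegral.integral_sub (hi hfi) (hi hYi), intervalIntegral.integral_sub (hi hy) (hi hYi)]
    abel)
  calc ∫⁻ t in Ioc 0 h, ENNReal.ofReal (‖y t‖ ^ p)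
      = ∫⁻ t in Ioc 0 h, ENNReal.ofReal (‖Y t‖ ^ p) := by
        apply lintegral_congr_ae
        filter_upwards [hz] with t ht
        rw [sub_eq_zero.1 ht]
    _ ≤ ∫⁻ t in Ioi (0:ℝ), ENNReal.ofReal (‖Y t‖ ^ p) := lintegral_mono_set (fun t ht => ht.1)
    _ ≤ _ := hY3
    _ = _ := by
        congr 1
        rw [← hsub, ← Measure.restrict_restrict measurableSet_Ioc,
          ← lintegral_indicator measurableSet_Ioc]
        congr 1; ext t
        by_cases ht : t ∈ Ioc 0 h
        · rw [hsub, indicator_of_mem ht, indicator_of_mem ht]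
        · rw [hsub, indicator_of_notMem ht, indicator_of_notMem ht]; simp [Real.zero_rpow hp0.ne']

end MRR
end


section
variable {X : Type*} [NormedAddCommGroup X] [NormedSpace ℝ X]

lemma avg_aux {b : ℝ → ℝ} (hb : ∀ t, 0 ≤ b t) {p K N h : ℝ} (hp : 1 < p)
    (hK : 0 ≤ K) (hN : 0 ≤ N) (hh : 0 < h)
    (H : ∫⁻ t in Ioc 0 h, ENNReal.ofReal (b t ^ p) ≤ ENNReal.ofReal (K * h * N ^ p)) :
    ∫⁻ t in Ioc 0 h, ENNReal.ofReal (b t) ≤ ENNReal.ofReal ((1 + K) * N * h) := by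
  have key : ∀ c > N, ∫⁻ t in Ioc 0 h, ENNReal.ofReal (b t) ≤ ENNReal.ofReal ((1 + K) * c * h) := by
    intro c hc
    have hc0 : 0 < c := hN.trans_lt hc
    have pt : ∀ t, b t ≤ c + c * (c ^ p)⁻¹ * b t ^ p := by
      intro t
      have hbt := hb t
      have e : c * (c ^ p)⁻¹ * b t ^ p = c * (b t / c) ^ p := by
        rw [Real.div_rpow hbt hc0.le]; ring
      rw [e]
      rcases le_total (b t) c with h1 | h1
      · have : 0 ≤ c * (b t / c) ^ p := by positivity
        linarith
      · have h2 : 1 ≤ b t / c := by rwa [le_div_iff₀ hc0, one_mul]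
        have h3 : b t / c ≤ (b t / c) ^ p := Real.self_le_rpow_of_one_le h2 hp.le
        have : c * (b t / c) ≤ c * (b t / c) ^ p := by gcongr
        rw [mul_div_cancel₀ _ hc0.ne'] at this
        linarith
    calc ∫⁻ t in Ioc 0 h, ENNReal.ofReal (b t)
        ≤ ∫⁻ t in Ioc 0 h, (ENNReal.ofReal c +
            ENNReal.ofReal (c * (c ^ p)⁻¹) * ENNReal.ofReal (b t ^ p)) := by
          refine lintegral_mono fun t => ?_
          rw [← ENNReal.ofReal_mul (by positivity), ← ENNReal.ofReal_add hc0.le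
            (by have := hb t; positivity)]
          exact ENNReal.ofReal_le_ofReal (pt t)
      _ ≤ ENNReal.ofReal (c * h) + ENNReal.ofReal (c * (c ^ p)⁻¹) * ENNReal.ofReal (K * h * N ^ p) := by
          rw [lintegral_add_left measurable_const, lintegral_const_mul' _ _ ENNReal.ofReal_ne_top]
          refine add_le_add (le_of_eq ?_) (mul_le_mul_right H _)
          simp [ENNReal.ofReal_mul hc0.le]
      _ ≤ ENNReal.ofReal ((1 + K) * c * h) := by
          rw [← ENNReal.ofReal_mul (by positivity), ← ENNReal.ofReal_add (by positivity)
            (by positivity)]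
          refine ENNReal.ofReal_le_ofReal ?_
          have h1 : N ^ p ≤ c ^ p := Real.rpow_le_rpow hN hc.le (by linarith)
          have h2 : (c ^ p)⁻¹ * N ^ p ≤ 1 := by
            rw [inv_mul_le_iff₀ (by positivity)]; linarith
          have : c * K * h * ((c ^ p)⁻¹ * N ^ p) ≤ c * K * h * 1 := by gcongr
          nlinarith
  have hT : Filter.Tendsto (fun c : ℝ => ENNReal.ofReal ((1 + K) * c * h)) (nhdsWithin N (Ioi N))
      (nhds (ENNReal.ofReal ((1 + K) * N * h))) := by
    have : Continuous (fun c : ℝ => ENNReal.ofReal ((1 + K) * c * h)) :=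
      ENNReal.continuous_ofReal.comp (by fun_prop)
    exact (this.tendsto N).mono_left nhdsWithin_le_nhds
  exact ge_of_tendsto hT (eventually_nhdsWithin_of_forall key)

lemma avg_int {v : ℝ → X} {p K N h : ℝ} (hp : 1 < p)
    (hK : 0 ≤ K) (hN : 0 ≤ N) (hh : 0 < h)
    (hv : AEStronglyMeasurable v (volume.restrict (Ioc 0 h)))
    (H : ∫⁻ t in Ioc 0 h, ENNReal.ofReal (‖v t‖ ^ p) ≤ ENNReal.ofReal (K * h * N ^ p)) :
    ∫ t in (0:ℝ)..h, ‖v t‖ ≤ (1 + K) * N * h := by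
  have h1 := avg_aux (b := fun t => ‖v t‖) (fun t => norm_nonneg _) hp hK hN hh H
  rw [intervalIntegral.integral_of_le hh.le, integral_eq_lintegral_of_nonneg_ae
    (Filter.Eventually.of_forall fun t => norm_nonneg _) hv.norm]
  refine ENNReal.toReal_le_of_le_ofReal (by positivity) h1

lemma triangle_int [CompleteSpace X] {σ : ℝ → X} {h : ℝ} (hh : 0 ≤ h) (hσ : IntegrableOn σ (Ioc 0 h)) :
    ∫ s in (0:ℝ)..h, ∫ r in (0:ℝ)..s, σ r = ∫ r in (0:ℝ)..h, (h - r) • σ r := by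
  rw [intervalIntegral.integral_of_le hh, intervalIntegral.integral_of_le hh]
  have hfin : IsFiniteMeasure (volume.restrict (Ioc 0 h)) := ⟨by simp⟩
  have e1 : ∫ s in Ioc 0 h, ∫ r in (0:ℝ)..s, σ r =
      ∫ s in Ioc 0 h, ∫ r in Ioc 0 h, (Iic s).indicator σ r := by
    refine setIntegral_congr_fun measurableSet_Ioc fun s hs => ?_
    rw [intervalIntegral.integral_of_le hs.1.le, setIntegral_indicator measurableSet_Iic]
    congr 2
    ext r; simp only [mem_inter_iff, mem_Ioc, mem_Iic]
    constructor
    · rintro ⟨a, b⟩; exact ⟨⟨a, b.trans hs.2⟩, b⟩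
    · rintro ⟨⟨a, b⟩, c⟩; exact ⟨a, c⟩
  have hint : Integrable (Function.uncurry fun s r => (Iic s).indicator σ r)
      ((volume.restrict (Ioc 0 h)).prod (volume.restrict (Ioc 0 h))) := by
    have h0 : Integrable (fun z : ℝ × ℝ => σ z.2)
      ((volume.restrict (Ioc 0 h)).prod (volume.restrict (Ioc 0 h))) := hσ.comp_snd _
    have hs : MeasurableSet {z : ℝ × ℝ | z.2 ≤ z.1} := measurableSet_le measurable_snd measurable_fst
    refine (h0.indicator hs).congr (Filter.Eventually.of_forall fun z => ?_)
    simp [Function.uncurry, Set.indicator]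
  rw [e1, integral_integral_swap hint]
  refine setIntegral_congr_fun measurableSet_Ioc fun r hr => ?_
  have e2 : (fun s => (Iic s).indicator σ r) = (Ici r).indicator (fun _ => σ r) := by
    ext s; simp [Set.indicator]
  simp only [e2]
  rw [setIntegral_indicator measurableSet_Ici, setIntegral_const]
  have : Ioc 0 h ∩ Ici r = Icc r h := by
    ext s; simp only [mem_inter_iff, mem_Ioc, mem_Icc, mem_Ici]
    constructor
    · rintro ⟨⟨a, b⟩, c⟩; exact ⟨c, b⟩
    · rintro ⟨a, b⟩; exact ⟨⟨hr.1.trans_le a, b⟩, a⟩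
  rw [this]; simp [measureReal_def, ENNReal.toReal_ofReal (sub_nonneg.2 hr.2)]

namespace MRR
variable [CompleteSpace X] {R : X →L[ℝ] X} {p C : ℝ} (D : MRR R p C)
include D

/-- auxiliary constant -/
lemma est1 {σ : ℝ → X} {x : X} {h : ℝ} (hh : 0 < h) (hσ : IntegrableOn σ (Ioc 0 h))
    (he : ∀ᵐ t ∂(volume.restrict (Ioc 0 h)), R (σ t) = R x - ∫ s in (0:ℝ)..t, σ s) :
    ∫⁻ t in Ioc 0 h, ENNReal.ofReal (‖σ t‖ ^ p) ≤
      ENNReal.ofReal ((2 ^ (p - 1) * (1 + C)) * h * ‖x‖ ^ p) := by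
  have hC := D.hC
  have hfin : IsFiniteMeasure (volume.restrict (Ioc 0 h)) := ⟨by simp⟩
  have hc : IntegrableOn (fun _ : ℝ => x) (Ioc 0 h) := integrable_const _
  have h1 := D.ll hh (y := fun t => x - σ t) (f := fun _ => x) (hc.sub hσ) (memLp_const x) (by
    filter_upwards [he] with t ht
    rw [map_sub, ht]; simp)
  have h2 : ∫⁻ t in Ioc 0 h, ENNReal.ofReal (‖x‖ ^ p) = ENNReal.ofReal (‖x‖ ^ p * h) := by
    simp [ENNReal.ofReal_mul (by positivity : 0 ≤ ‖x‖ ^ p)]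
  rw [h2] at h1
  calc ∫⁻ t in Ioc 0 h, ENNReal.ofReal (‖σ t‖ ^ p)
      ≤ ∫⁻ t in Ioc 0 h, ENNReal.ofReal (2 ^ (p - 1)) *
          (ENNReal.ofReal (‖x‖ ^ p) + ENNReal.ofReal (‖x - σ t‖ ^ p)) := by
        refine lintegral_mono fun t => ?_
        rw [← ENNReal.ofReal_add (by positivity) (by positivity), ← ENNReal.ofReal_mul (by positivity)]
        refine ENNReal.ofReal_le_ofReal ?_
        refine le_trans ?_ (rpow_add_le' (norm_nonneg _) (norm_nonneg _) D.hp.le)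
        refine Real.rpow_le_rpow (norm_nonneg _) ?_ (by linarith [D.hp])
        have := norm_sub_le x (x - σ t)
        simpa using this
    _ = ENNReal.ofReal (2 ^ (p - 1)) * (ENNReal.ofReal (‖x‖ ^ p * h) +
          ∫⁻ t in Ioc 0 h, ENNReal.ofReal (‖x - σ t‖ ^ p)) := by
        rw [lintegral_const_mul' _ _ ENNReal.ofReal_ne_top, lintegral_add_left measurable_const, h2]
    _ ≤ ENNReal.ofReal (2 ^ (p - 1)) * (ENNReal.ofReal (‖x‖ ^ p * h) +
          ENNReal.ofReal C * ENNReal.ofReal (‖x‖ ^ p * h)) := by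
        exact mul_le_mul_right (add_le_add le_rfl h1) _
    _ = _ := by
        rw [← ENNReal.ofReal_mul hC, ← ENNReal.ofReal_add (by positivity) (by positivity),
          ← ENNReal.ofReal_mul (by positivity)]
        congr 1; ring

lemma est2 : ∃ M : ℝ, 0 ≤ M ∧ ∀ (σ : ℝ → X) (x : X) (h : ℝ), 0 < h → IntegrableOn σ (Ioc 0 h) →
    (∀ᵐ t ∂(volume.restrict (Ioc 0 h)), R (σ t) = R x - ∫ s in (0:ℝ)..t, σ s) →
    ‖R x - ∫ s in (0:ℝ)..h, σ s‖ ≤ M * ‖R x‖ ∧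
    ∫ s in (0:ℝ)..h, ‖s • σ s‖ ≤ M * ‖R x‖ * h := by
  have hC := D.hC
  set K := 2 ^ (p - 1) * (1 + C) with hK
  have hK0 : 0 ≤ K := by positivity
  refine ⟨2 + K + C * K, by positivity, fun σ x h hh hσ he => ?_⟩
  have hfin : IsFiniteMeasure (volume.restrict (Ioc 0 h)) := ⟨by simp⟩
  have hσt : ∀ t ∈ Ioc 0 h, IntegrableOn σ (Ioc 0 t) := fun t ht =>
    hσ.mono_set (Ioc_subset_Ioc_right ht.2)
  have hii : ∀ t ∈ Ioc 0 h, IntervalIntegrable σ volume 0 t := fun t ht =>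
    (intervalIntegrable_iff_integrableOn_Ioc_of_le ht.1.le).2 (hσt t ht)
  have hRi : ∀ t ∈ Ioc 0 h, IntervalIntegrable (fun s => R (σ s)) volume 0 t := fun t ht =>
    ⟨R.integrable_comp (hii t ht).1, R.integrable_comp (hii t ht).2⟩
  have hsi : ∀ t ∈ Ioc 0 h, IntervalIntegrable (fun s => s • σ s) volume 0 t := fun t ht =>
    (hii t ht).continuousOn_smul continuousOn_id
  have hRint : IntegrableOn (fun s => R (σ s)) (Ioc 0 h) := R.integrable_comp hσ
  have hRe : ∀ᵐ t ∂(volume.restrict (Ioc 0 h)), R (R (σ t)) = R (R x) - ∫ s in (0:ℝ)..t, R (σ s) := by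
    filter_upwards [he, ae_restrict_mem measurableSet_Ioc] with t ht ht0
    rw [ht, map_sub, ContinuousLinearMap.intervalIntegral_comp_comm _ (hii t ht0)]
  have hb1 := D.est1 hh hRint hRe
  have hW : ∀ t ∈ Ioc 0 h, t • (R x - ∫ s in (0:ℝ)..t, σ s) = ∫ s in (0:ℝ)..t, (R (σ s) - s • σ s) := by
    intro t ht
    have e1 : ∫ s in (0:ℝ)..t, R (σ s) = ∫ s in (0:ℝ)..t, (R x - ∫ r in (0:ℝ)..s, σ r) := by
      apply intervalIntegral.integral_congr_ae
      have := (ae_restrict_iff' measurableSet_Ioc).1 he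
      filter_upwards [this] with s hs hs'
      rw [uIoc_of_le ht.1.le] at hs'
      exact hs ⟨hs'.1, hs'.2.trans ht.2⟩
    have hci : IntervalIntegrable (fun s => ∫ r in (0:ℝ)..s, σ r) volume 0 t := by
      apply ContinuousOn.intervalIntegrable
      rw [uIcc_of_le ht.1.le]
      have := intervalIntegral.continuousOn_primitive_interval (a := 0) (b := t) (f := σ)
        (μ := volume) (by rw [uIcc_of_le ht.1.le, integrableOn_Icc_iff_integrableOn_Ioc]; exact hσt t ht)
      rwa [uIcc_of_le ht.1.le] at this
    rw [intervalIntegral.integral_sub (hRi t ht) (hsi t ht), e1,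
      intervalIntegral.integral_sub (by simp) hci, triangle_int ht.1.le (hσt t ht)]
    have e2 : ∫ r in (0:ℝ)..t, (t - r) • σ r = t • (∫ r in (0:ℝ)..t, σ r) - ∫ r in (0:ℝ)..t, r • σ r := by
      rw [← intervalIntegral.integral_smul, ← intervalIntegral.integral_sub (f := fun r => t • σ r) ((hii t ht).smul t) (hsi t ht)]
      simp only [sub_smul]
    rw [e2]; simp only [smul_sub, intervalIntegral.integral_const, sub_zero]; abel
  have hRp : MemLp (fun s => R (σ s)) (ENNReal.ofReal p) (volume.restrict (Ioc 0 h)) := by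
    have hp0 : 0 < p := by linarith [D.hp]
    refine (memLp_norm_rpow_iff (q := ENNReal.ofReal p) hRint.aestronglyMeasurable
      (by simpa using hp0) (by simp)).1 ?_
    rw [ENNReal.div_self (by simpa using hp0) (by simp), memLp_one_iff_integrable,
      ENNReal.toReal_ofReal hp0.le]
    refine ⟨(hRint.aestronglyMeasurable.norm.aemeasurable.pow_const p).aestronglyMeasurable, ?_⟩
    rw [hasFiniteIntegral_iff_ofReal (Filter.Eventually.of_forall fun t => by positivity)]
    exact hb1.trans_lt ENNReal.ofReal_lt_top
  have hb2 := D.ll hh (y := fun t => t • σ t) (f := fun t => R (σ t))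
    ((intervalIntegrable_iff_integrableOn_Ioc_of_le hh.le).1 (hsi h ⟨hh, le_rfl⟩)) hRp (by
      filter_upwards [he, ae_restrict_mem measurableSet_Ioc] with t ht ht0
      rw [map_smul, ht, hW t ht0])
  have hb3 : ∫⁻ t in Ioc 0 h, ENNReal.ofReal (‖t • σ t‖ ^ p) ≤
      ENNReal.ofReal ((C * K) * h * ‖R x‖ ^ p) := by
    refine hb2.trans ((mul_le_mul_right hb1 _).trans (le_of_eq ?_))
    rw [← ENNReal.ofReal_mul hC]; congr 1; ring
  have a1 := avg_int D.hp hK0 (norm_nonneg (R x)) hh hRint.aestronglyMeasurable hb1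
  have a2 := avg_int D.hp (by positivity) (norm_nonneg (R x)) hh
    ((intervalIntegrable_iff_integrableOn_Ioc_of_le hh.le).1 (hsi h ⟨hh, le_rfl⟩)).aestronglyMeasurable hb3
  have hhm : h ∈ Ioc 0 h := ⟨hh, le_rfl⟩
  constructor
  · have h1 : ‖h • (R x - ∫ s in (0:ℝ)..h, σ s)‖ ≤ (1 + K) * ‖R x‖ * h + (1 + C * K) * ‖R x‖ * h := by
      rw [hW h hhm, intervalIntegral.integral_sub (hRi h hhm) (hsi h hhm)]
      refine (norm_sub_le _ _).trans (add_le_add ?_ ?_)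
      · exact (intervalIntegral.norm_integral_le_integral_norm hh.le).trans a1
      · exact (intervalIntegral.norm_integral_le_integral_norm hh.le).trans a2
    rw [norm_smul, Real.norm_of_nonneg hh.le] at h1
    refine le_of_mul_le_mul_left (a := h) ?_ hh
    linarith
  · have : 0 ≤ (1 + K) * ‖R x‖ * h := by positivity
    linarith

end MRR
end


section
variable {X : Type*} [NormedAddCommGroup X] [NormedSpace ℝ X]

/-- Orbit on a finite interval. -/
def Orb (R : X →L[ℝ] X) (h : ℝ) (σ : ℝ → X) (x : X) : Prop :=
  IntegrableOn σ (Ioc 0 h) ∧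
    ∀ᵐ t ∂(volume.restrict (Ioc 0 h)), R (σ t) = R x - ∫ s in (0:ℝ)..t, σ s

namespace MRR
variable [CompleteSpace X] {R : X →L[ℝ] X} {p C : ℝ}

lemma _root_.Orb.ii {h : ℝ} {σ : ℝ → X} {x : X} (H : Orb R h σ x) {t : ℝ} (ht : t ∈ Icc 0 h) :
    IntervalIntegrable σ volume 0 t :=
  (intervalIntegrable_iff_integrableOn_Ioc_of_le ht.1).2 (H.1.mono_set (Ioc_subset_Ioc_right ht.2))

lemma _root_.Orb.comb {h : ℝ} {σ τ : ℝ → X} {x y : X} (H : Orb R h σ x) (H' : Orb R h τ y)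
    (a b : ℝ) : Orb R h (fun t => a • σ t + b • τ t) (a • x + b • y) := by
  refine ⟨(H.1.smul a).add (H'.1.smul b), ?_⟩
  filter_upwards [H.2, H'.2, ae_restrict_mem measurableSet_Ioc] with t h1 h2 ht
  have ht' : t ∈ Icc 0 h := ⟨ht.1.le, ht.2⟩
  rw [intervalIntegral.integral_add (f := fun t => a • σ t) (g := fun t => b • τ t)
    ((H.ii ht').smul a) ((H'.ii ht').smul b), intervalIntegral.integral_smul,
    intervalIntegral.integral_smul]
  simp only [map_add, map_smul, h1, h2]
  module

lemma _root_.Orb.comp {h : ℝ} {σ : ℝ → X} {x : X} (H : Orb R h σ x) :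
    Orb R h (fun t => R (σ t)) (R x) := by
  refine ⟨R.integrable_comp H.1, ?_⟩
  filter_upwards [H.2, ae_restrict_mem measurableSet_Ioc] with t h1 ht
  rw [ContinuousLinearMap.intervalIntegral_comp_comm _ (H.ii ⟨ht.1.le, ht.2⟩), h1, map_sub]

lemma orb_unique (D : MRR R p C) {h : ℝ} (hh : 0 < h) {σ τ : ℝ → X} {x : X} (H : Orb R h σ x)
    (H' : Orb R h τ x) : ∀ᵐ t ∂(volume.restrict (Ioc 0 h)), σ t = τ t := by
  have H2 := H.comb H' 1 (-1)
  have := D.lu hh H2.1 (by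
    filter_upwards [H2.2] with t ht
    rw [ht]; simp)
  filter_upwards [this] with t ht
  rw [one_smul, neg_one_smul] at ht
  exact eq_of_sub_eq_zero (by rw [sub_eq_add_neg]; exact ht)

lemma orb_int (D : MRR R p C) {h : ℝ} {σ τ : ℝ → X} {x : X} (H : Orb R h σ x)
    (H' : Orb R h τ x) {t : ℝ} (ht : t ∈ Icc 0 h) : ∫ s in (0:ℝ)..t, σ s = ∫ s in (0:ℝ)..t, τ s := by
  rcases (ht.1.trans ht.2).eq_or_lt with h0 | h0
  · have : t = 0 := le_antisymm (h0 ▸ ht.2) ht.1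
    simp [this]
  apply intervalIntegral.integral_congr_ae
  filter_upwards [(ae_restrict_iff' measurableSet_Ioc).1 (D.orb_unique h0 H H')] with s hs hs'
  rw [uIoc_of_le ht.1] at hs'
  exact hs ⟨hs'.1, hs'.2.trans ht.2⟩

lemma sg1 (D : MRR R p C) : ∃ (S : ℝ → X →L[ℝ] X) (M : ℝ), 0 ≤ M ∧ (∀ t < 0, S t = 0) ∧
    (∀ t x, ‖S t x‖ ≤ M * ‖x‖) ∧ (∀ x, ContinuousOn (fun t => S t x) (Ici 0)) ∧
    (∀ t ≥ 0, ∀ x, R (S t x) = R x - ∫ s in (0:ℝ)..t, S s x) ∧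
    (∀ h > 0, ∀ x, ∫ s in (0:ℝ)..h, ‖s • S s x‖ ≤ M * ‖R x‖ * h) := by
  choose σ hσ1 hσ2 using D.orbit
  obtain ⟨M, hM, hest⟩ := D.est2
  have hO : ∀ x h, Orb R h (σ x) x := by
    intro x h
    have hsub : Ioc 0 h ⊆ Ioi 0 := fun t ht => ht.1
    refine ⟨?_, ae_restrict_of_ae_restrict_of_subset hsub (hσ2 x)⟩
    rcases le_or_gt h 0 with h0 | h0
    · simp [Ioc_eq_empty (not_lt.2 h0)]
    · exact (intervalIntegrable_iff_integrableOn_Ioc_of_le h0.le).1 (ii_of_memLp D.hp (hσ1 x) le_rfl h0.le)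
  set W : ℝ → X → X := fun t x => R x - ∫ s in (0:ℝ)..t, σ x s with hW
  have hcomb : ∀ t ≥ 0, ∀ (a b : ℝ) x y, W t (a • x + b • y) = a • W t x + b • W t y := by
    intro t ht a b x y
    have hm : t ∈ Icc 0 t := ⟨ht, le_rfl⟩
    simp only [hW]
    rw [D.orb_int (hO (a • x + b • y) t) ((hO x t).comb (hO y t) a b) hm]
    rw [intervalIntegral.integral_add (f := fun t => a • σ x t) (g := fun t => b • σ y t)
      (((hO x t).ii hm).smul a) (((hO y t).ii hm).smul b), intervalIntegral.integral_smul,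
      intervalIntegral.integral_smul]
    simp only [map_add, map_smul]
    module
  have hWb : ∀ t ≥ 0, ∀ x, ‖W t x‖ ≤ max M 1 * ‖R x‖ := by
    intro t ht x
    rcases (show (0:ℝ) ≤ t from ht).eq_or_lt with h0 | h0
    · simp only [hW, ← h0, intervalIntegral.integral_same, sub_zero]
      exact le_mul_of_one_le_left (norm_nonneg _) (le_max_right _ _)
    · exact ((hest (σ x) x t h0 (hO x t).1 (hO x t).2).1).trans (by gcongr; exact le_max_left _ _)
  have hM1 : 0 ≤ max M 1 := hM.trans (le_max_left _ _)
  have hex : ∀ t, ∃ T : X →L[ℝ] X, (t < 0 → T = 0) ∧ (∀ x, ‖T x‖ ≤ max M 1 * ‖x‖) ∧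
      (0 ≤ t → ∀ x, T (R x) = W t x) := by
    intro t
    rcases lt_or_ge t 0 with ht | ht
    · exact ⟨0, fun _ => rfl, fun x => by simpa using mul_nonneg hM1 (norm_nonneg x), fun h => absurd ht (not_lt.2 h)⟩
    · let L : X →ₗ[ℝ] X :=
        { toFun := W t
          map_add' := fun x y => by simpa using hcomb t ht 1 1 x y
          map_smul' := fun a x => by simpa using hcomb t ht a 0 x 0 }
      have hLb : ∀ x, ‖L x‖ ≤ max M 1 * ‖(R : X →ₗ[ℝ] X) x‖ := fun x => hWb t ht x
      refine ⟨L.extendOfNorm (R : X →ₗ[ℝ] X), fun h => absurd h (not_lt.2 ht), fun x => ?_, fun _ x => ?_⟩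
      · exact LinearMap.norm_extendOfNorm_apply_le D.dr _ hLb x
      · exact LinearMap.extendOfNorm_eq D.dr ⟨_, hLb⟩ x
  choose S hS1 hS2 hS3 using hex
  have hSR : ∀ t ≥ 0, ∀ x, S t (R x) = R (S t x) := by
    intro t ht
    have : (fun x => S t (R x)) = fun x => R (S t x) := by
      refine D.dr.equalizer (by fun_prop) (by fun_prop) ?_
      ext x
      have hm : t ∈ Icc 0 t := ⟨ht, le_rfl⟩
      simp only [Function.comp]
      rw [hS3 t ht, hS3 t ht]
      simp only [hW]
      rw [D.orb_int (hO (R x) t) (hO x t).comp hm,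
        ContinuousLinearMap.intervalIntegral_comp_comm _ ((hO x t).ii hm), map_sub]
    exact fun x => congrFun this x
  have hae : ∀ x h, ∀ᵐ t ∂(volume.restrict (Ioc 0 h)), σ x t = S t x := by
    intro x h
    filter_upwards [(hO x h).2, ae_restrict_mem measurableSet_Ioc] with t ht h0
    apply D.inj
    rw [ht, ← hSR t h0.1.le, hS3 t h0.1.le]
  have hint : ∀ x, ∀ t ≥ 0, ∫ s in (0:ℝ)..t, σ x s = ∫ s in (0:ℝ)..t, S s x := by
    intro x t ht
    apply intervalIntegral.integral_congr_ae
    rw [uIoc_of_le ht]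
    exact (ae_restrict_iff' measurableSet_Ioc).1 (hae x t)
  refine ⟨S, max M 1, hM1, hS1, hS2, ?_, ?_, ?_⟩
  · -- continuity
    have hc0 : ∀ x, ContinuousOn (fun t => S t (R x)) (Ici 0) := by
      intro x
      have h1 : ContinuousOn (W · x) (Ici 0) := by
        refine continuousOn_const.sub ?_
        intro t ht
        have ht' : (0:ℝ) ≤ t := ht
        have hi : IntegrableOn (σ x) (uIcc 0 (t + 1)) := by
          rw [uIcc_of_le (by linarith), integrableOn_Icc_iff_integrableOn_Ioc]; exact (hO x (t+1)).1
        have := intervalIntegral.continuousOn_primitive_interval hi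
        rw [uIcc_of_le (by linarith)] at this
        refine (this t ⟨ht', by linarith⟩).mono_of_mem_nhdsWithin ?_
        rw [← Ici_inter_Iic]
        exact inter_mem_nhdsWithin _ (Iic_mem_nhds (by linarith))
      exact h1.congr fun t ht => hS3 t ht x
    intro x
    refine continuousOn_of_uniform_approx_of_continuousOn fun u hu => ?_
    obtain ⟨ε, hε, hu'⟩ := Metric.mem_uniformity_dist.1 hu
    have hpos : 0 < ε / (max M 1 + 1) := by positivity
    obtain ⟨z, hz⟩ := D.dr.exists_dist_lt x hpos
    refine ⟨fun t => S t (R z), hc0 z, fun t _ => hu' ?_⟩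
    rw [dist_eq_norm, ← map_sub]
    rw [dist_eq_norm] at hz
    calc ‖S t (x - R z)‖ ≤ max M 1 * ‖x - R z‖ := hS2 _ _
      _ ≤ (max M 1 + 1) * ‖x - R z‖ := by gcongr; linarith
      _ < (max M 1 + 1) * (ε / (max M 1 + 1)) := by gcongr
      _ = ε := by field_simp
  · intro t ht x
    rw [← hSR t ht, hS3 t ht, ← hint x t ht]
  · intro h hh x
    have h2 := (hest (σ x) x h hh (hO x h).1 (hO x h).2).2
    have e : ∫ s in (0:ℝ)..h, ‖s • S s x‖ = ∫ s in (0:ℝ)..h, ‖s • σ x s‖ := by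
      apply intervalIntegral.integral_congr_ae
      rw [uIoc_of_le hh.le]
      filter_upwards [(ae_restrict_iff' measurableSet_Ioc).1 (hae x h)] with s hs hs'
      rw [hs hs']
    rw [e]
    exact h2.trans (by gcongr; exact le_max_left _ _)

lemma cv_eq {S : ℝ → X →L[ℝ] X} {M : ℝ} (neg : ∀ t < 0, S t = 0)
    (bd : ∀ t x, ‖S t x‖ ≤ M * ‖x‖) (cont : ∀ x, ContinuousOn (fun t => S t x) (Ici 0))
    (K : ∀ t ≥ 0, ∀ x, R (S t x) = R x - ∫ s in (0:ℝ)..t, S s x) {g : ℝ → X} (hg : Nice g)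
    {t : ℝ} (ht : 0 < t) : R (cv S g t) = ∫ s in (0:ℝ)..t, (R (g s) - cv S g s) := by
  have hsm := sm_joint bd cont neg hg.sm
  have hfin : IsFiniteMeasure (volume.restrict (Ioc 0 t)) := ⟨by simp⟩
  obtain ⟨B, hB⟩ := hg.bdd
  have hM : ∀ τ x, ‖S τ x‖ ≤ max M 0 * ‖x‖ := fun τ x =>
    (bd τ x).trans (by gcongr; exact le_max_left _ _)
  have hM0 : 0 ≤ max M 0 := le_max_right _ _
  have hb : ∀ τ s, ‖S τ (g s)‖ ≤ max M 0 * B := fun τ s =>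
    (hM _ _).trans (by gcongr; exact hB s)
  have hcv : ∀ τ ≤ t, cv S g τ = ∫ s in Ioc 0 t, S (τ - s) (g s) := by
    intro τ hτ
    rw [cv, setIntegral_eq_integral_of_forall_compl_eq_zero]
    intro s hs
    rcases le_or_gt s 0 with h | h
    · simp [hg.neg s h]
    · have : t < s := by by_contra h'; exact hs ⟨h, not_lt.1 h'⟩
      simp [neg (τ - s) (by linarith)]
  have hprod : Integrable (Function.uncurry fun s τ => S (τ - s) (g s))
      ((volume.restrict (Ioc 0 t)).prod (volume.restrict (Ioc 0 t))) := by
    refine Integrable.of_bound ?_ (max M 0 * B) (Filter.Eventually.of_forall fun z => hb _ _)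
    exact (hsm.comp_measurable measurable_swap).aestronglyMeasurable
  have hi1 : IntegrableOn (fun s => S (t - s) (g s)) (Ioc 0 t) := by
    refine Integrable.of_bound ?_ (max M 0 * B) (Filter.Eventually.of_forall fun z => hb _ _)
    exact (hsm.comp_measurable (measurable_prodMk_left (x := t))).aestronglyMeasurable
  have hRg : IntegrableOn (fun s => R (g s)) (Ioc 0 t) := R.integrable_comp hg.int.integrableOn
  have hcvi : IntegrableOn (cv S g) (Ioc 0 t) := by
    have := hprod.integral_prod_right
    refine this.congr ?_
    filter_upwards [ae_restrict_mem measurableSet_Ioc] with τ hτ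
    rw [hcv τ hτ.2]; rfl
  rw [intervalIntegral.integral_of_le ht.le, integral_sub hRg hcvi, hcv t le_rfl,
    ← ContinuousLinearMap.integral_comp_comm _ hi1]
  have e1 : ∫ τ in Ioc 0 t, cv S g τ = ∫ s in Ioc 0 t, ∫ τ in Ioc 0 t, S (τ - s) (g s) := by
    rw [integral_integral_swap hprod]
    exact setIntegral_congr_fun measurableSet_Ioc fun τ hτ => hcv τ hτ.2
  have hpl : Integrable (fun s => ∫ τ in Ioc 0 t, S (τ - s) (g s)) (volume.restrict (Ioc 0 t)) :=
    hprod.integral_prod_left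
  rw [e1, ← integral_sub hRg hpl]
  refine setIntegral_congr_fun measurableSet_Ioc fun s hs => ?_
  rw [K (t - s) (by simpa using hs.2)]
  congr 1
  have e2 : ∫ r in (0:ℝ)..(t - s), S r (g s) = ∫ τ in s..t, S (τ - s) (g s) := by
    have := intervalIntegral.integral_comp_sub_right (a := s) (b := t) (fun r => S r (g s)) s
    rw [this, sub_self]
  rw [e2, intervalIntegral.integral_of_le hs.2]
  symm
  apply setIntegral_eq_of_subset_of_ae_diff_eq_zero measurableSet_Ioc.nullMeasurableSet
    (Ioc_subset_Ioc_left hs.1.le)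
  have : ∀ᵐ τ : ℝ, τ ≠ s := by simp [ae_iff]
  filter_upwards [this] with τ h1 h2
  have h3 : τ ≤ s := by
    by_contra h; exact h2.2 ⟨not_le.1 h, h2.1.2⟩
  simp [neg (τ - s) (by have := lt_of_le_of_ne h3 h1; linarith)]

lemma sgdata (D : MRR R p C) : ∃ (S : ℝ → X →L[ℝ] X) (M C' : ℝ), SGData R S M C' p ∧
    ∀ g, Nice g → ∀ t > 0, R (cv S g t) = ∫ s in (0:ℝ)..t, (R (g s) - cv S g s) := by
  obtain ⟨S, M, hM, neg, bd, cont, K, hav⟩ := D.sg1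
  have hC := D.hC
  have ii : ∀ x a b, 0 ≤ a → 0 ≤ b → IntervalIntegrable (fun s => S s x) volume a b := by
    intro x a b ha hb
    apply ContinuousOn.intervalIntegrable
    exact (cont x).mono fun s hs => mem_Ici.2 ((le_min ha hb).trans hs.1)
  have sg : ∀ s t, 0 ≤ s → 0 ≤ t → ∀ x, S (s + t) x = S s (S t x) := by
    intro s t hs ht x
    have hK' : ∀ r ≥ 0, R (S (r + t) x) = R (S t x) - ∫ τ in (0:ℝ)..r, S (τ + t) x := by
      intro r hr
      rw [K (r + t) (by linarith [show (0:ℝ) ≤ r from hr]), K t ht,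
        intervalIntegral.integral_comp_add_right (fun τ => S τ x), zero_add,
        ← intervalIntegral.integral_add_adjacent_intervals (ii x 0 t le_rfl ht)
          (ii x t (r + t) ht (by linarith [show (0:ℝ) ≤ r from hr]))]
      abel
    have O1 : Orb R s (fun r => S (r + t) x) (S t x) := by
      refine ⟨?_, ?_⟩
      · refine ((cont x).comp (by fun_prop) fun r hr => ?_).integrableOn_Icc.mono_set Ioc_subset_Icc_self
        exact mem_Ici.2 (by linarith [hr.1])
      · filter_upwards [ae_restrict_mem measurableSet_Ioc] with r hr
        exact hK' r hr.1.le
    have O2 : Orb R s (fun r => S r (S t x)) (S t x) := by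
      refine ⟨?_, ?_⟩
      · exact ((cont (S t x)).mono fun r hr => mem_Ici.2 hr.1).integrableOn_Icc.mono_set Ioc_subset_Icc_self
      · filter_upwards [ae_restrict_mem measurableSet_Ioc] with r hr
        exact K r hr.1.le _
    apply D.inj
    rw [hK' s hs, K s hs, D.orb_int O1 O2 ⟨hs, le_rfl⟩]
  set C1 := 2 * M ^ 2 with hC1
  have hC10 : 0 ≤ C1 := by positivity
  have dec : ∀ t > 0, ∀ x, ‖S t x‖ ≤ C1 / t * ‖R x‖ := by
    intro t ht x
    have ht' : (0:ℝ) < t := ht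
    have h1 := hav t ht x
    have h2 : ∫ s in (0:ℝ)..t, s * ‖S t x‖ ≤ ∫ s in (0:ℝ)..t, M * ‖s • S s x‖ := by
      refine intervalIntegral.integral_mono_on ht'.le (Continuous.intervalIntegrable (by fun_prop) _ _) ?_ ?_
      · apply ContinuousOn.intervalIntegrable
        rw [uIcc_of_le ht'.le]
        refine continuousOn_const.mul (continuousOn_id.smul ((cont x).mono fun s hs => mem_Ici.2 hs.1)).norm
      · intro s hs
        rw [norm_smul, Real.norm_of_nonneg hs.1]
        have e : S t x = S (t - s) (S s x) := by
          rw [← sg _ _ (by linarith [hs.2]) hs.1]; congr 2; ring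
        have := bd (t - s) (S s x)
        rw [← e] at this
        calc s * ‖S t x‖ ≤ s * (M * ‖S s x‖) := by
              refine mul_le_mul_of_nonneg_left this hs.1
          _ = _ := by ring
    rw [intervalIntegral.integral_mul_const, integral_id, intervalIntegral.integral_const_mul] at h2
    have h3 : M * ∫ s in (0:ℝ)..t, ‖s • S s x‖ ≤ M * (M * ‖R x‖ * t) := by gcongr
    have h4 : t ^ 2 * ‖S t x‖ ≤ t * (C1 * ‖R x‖) := by rw [hC1]; nlinarith
    have h5 : t * ‖S t x‖ ≤ C1 * ‖R x‖ := le_of_mul_le_mul_left (a := t) (by nlinarith) ht'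
    rw [div_mul_eq_mul_div, le_div_iff₀ ht']
    linarith
  have smooth : ∀ s t, 0 < s → s ≤ t → ∀ x, ‖S t x - S s x‖ ≤ (4 * C1 ^ 2) * (t - s) / s ^ 2 * ‖R x‖ := by
    intro s t hs hst x
    set τ := s / 2 with hτ
    have hτ0 : 0 < τ := by positivity
    set z := S (t - τ) x - S (s - τ) x with hz
    have e1 : S t x - S s x = S τ z := by
      rw [hz, map_sub, ← sg _ _ hτ0.le (by linarith), ← sg _ _ hτ0.le (by linarith)]
      congr 3 <;> ring
    have e2 : R z = -∫ r in (s - τ)..(t - τ), S r x := by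
      rw [hz, map_sub, K _ (by linarith : t - τ ≥ 0), K _ (by linarith : s - τ ≥ 0),
        ← intervalIntegral.integral_add_adjacent_intervals (ii x 0 (s - τ) le_rfl (by linarith))
          (ii x (s - τ) (t - τ) (by linarith) (by linarith))]
      abel
    have h1 : ‖R z‖ ≤ C1 / τ * ‖R x‖ * |(t - τ) - (s - τ)| := by
      rw [e2, norm_neg]
      refine intervalIntegral.norm_integral_le_of_norm_le_const fun r hr => ?_
      rw [uIoc_of_le (by linarith)] at hr
      have hr' : τ ≤ r := by linarith [hr.1]
      refine (dec r (by linarith) x).trans ?_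
      gcongr
    rw [e1]
    refine (dec τ hτ0 z).trans ?_
    rw [abs_of_nonneg (by linarith)] at h1
    calc C1 / τ * ‖R z‖ ≤ C1 / τ * (C1 / τ * ‖R x‖ * ((t - τ) - (s - τ))) := by gcongr
      _ = _ := by rw [hτ]; field_simp; ring
  refine ⟨S, M, C + C1 + 4 * C1 ^ 2, ⟨hM, by positivity, D.hp, neg, bd, sg, cont, ?_, ?_, ?_⟩,
    fun g hg t ht => cv_eq neg bd cont K hg ht⟩
  · intro t ht x
    have ht' : (0:ℝ) < t := ht
    refine (dec t ht x).trans ?_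
    gcongr
    nlinarith [sq_nonneg C1]
  · intro s t hs hst x
    refine (smooth s t hs hst x).trans ?_
    have : 0 ≤ t - s := by linarith
    gcongr
    linarith
  · intro g hg
    obtain ⟨B, hB⟩ := hg.bdd
    have hsm := sm_joint bd cont neg hg.sm
    have hcsm : StronglyMeasurable (cv S g) := hsm.integral_prod_right'
    have hcb : ∀ t, ‖cv S g t‖ ≤ M * ∫ s, ‖g s‖ := by
      intro t
      rw [← integral_const_mul]
      exact norm_integral_le_of_norm_le (hg.int.norm.const_mul M)
        (Filter.Eventually.of_forall fun s => bd _ _)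
    have hc0 : ∀ t ≤ 0, cv S g t = 0 := by
      intro t ht
      have : (fun s => S (t - s) (g s)) = fun _ => 0 := by
        ext s
        rcases le_or_gt s 0 with h | h
        · simp [hg.neg s h]
        · simp [neg (t - s) (by linarith)]
      rw [cv, this]; simp
    have hloc : ∀ n : ℕ, ∫⁻ t in Ioc (0:ℝ) n, ENNReal.ofReal (‖cv S g t‖ ^ p) ≤
        ENNReal.ofReal C * ∫⁻ t, ENNReal.ofReal (‖R (g t)‖ ^ p) := by
      intro n
      rcases Nat.eq_zero_or_pos n with rfl | hn
      · simp
      have hn' : (0:ℝ) < n := by exact_mod_cast hn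
      have hfin : IsFiniteMeasure (volume.restrict (Ioc (0:ℝ) n)) := ⟨by simp⟩
      refine (D.ll hn' (y := cv S g) (f := fun t => R (g t)) ?_ ?_ ?_).trans ?_
      · exact Integrable.of_bound hcsm.aestronglyMeasurable _ (Filter.Eventually.of_forall hcb)
      · refine MemLp.of_bound (R.continuous.comp_stronglyMeasurable hg.sm).aestronglyMeasurable (‖R‖ * B)
          (Filter.Eventually.of_forall fun t => (R.le_opNorm _).trans (by gcongr; exact hB t))
      · filter_upwards [ae_restrict_mem measurableSet_Ioc] with t ht
        exact cv_eq neg bd cont K hg ht.1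
      · exact mul_le_mul_right (setLIntegral_le_lintegral _ _) _
    have hU : ⋃ n : ℕ, Ioc (0:ℝ) n = Ioi 0 := by
      ext t; simp only [mem_iUnion, mem_Ioc, mem_Ioi]
      exact ⟨fun ⟨n, h⟩ => h.1, fun h => let ⟨n, hn⟩ := exists_nat_ge t; ⟨n, h, hn⟩⟩
    have hfull : ∫⁻ t, ENNReal.ofReal (‖cv S g t‖ ^ p) = ∫⁻ t in Ioi (0:ℝ), ENNReal.ofReal (‖cv S g t‖ ^ p) := by
      rw [← lintegral_indicator measurableSet_Ioi]
      congr 1; ext t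
      rcases le_or_gt t 0 with h | h
      · simp [hc0 t h, not_lt.2 h, Real.zero_rpow (show p ≠ 0 by linarith [D.hp])]
      · simp [h]
    rw [hfull, ← hU, setLIntegral_iUnion_of_directed]
    · refine (iSup_le hloc).trans (mul_le_mul_left (ENNReal.ofReal_le_ofReal ?_) _)
      nlinarith [sq_nonneg C1]
    · refine Monotone.directed_le fun m n hmn => Ioc_subset_Ioc_right (by exact_mod_cast hmn)

end MRR
end


section
variable {X : Type*} [NormedAddCommGroup X]

/-- Weighted measure. -/
noncomputable def wm (q δ : ℝ) : Measure ℝ :=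
  (volume.restrict (Ioi 0)).withDensity (fun t => ENNReal.ofReal (t ^ (δ * q)))

lemma wm_meas (q δ : ℝ) : Measurable (fun t : ℝ => ENNReal.ofReal (t ^ (δ * q))) :=
  (measurable_id.pow_const _).ennreal_ofReal

lemma wm_ac (q δ : ℝ) : wm q δ ≪ volume.restrict (Ioi 0) := withDensity_absolutelyContinuous _ _

lemma wm_ac' (q δ : ℝ) : volume.restrict (Ioi 0) ≪ wm q δ := by
  refine withDensity_absolutelyContinuous' (wm_meas q δ).aemeasurable ?_
  filter_upwards [ae_restrict_mem measurableSet_Ioi] with t ht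
  have : 0 < t ^ (δ * q) := Real.rpow_pos_of_pos ht _
  simpa using this

lemma wm_lint {q δ : ℝ} (v : ℝ → X) : ∫⁻ t, ENNReal.ofReal (‖v t‖ ^ q) ∂(wm q δ) =
    ∫⁻ t in Ioi 0, ENNReal.ofReal ((t ^ δ * ‖v t‖) ^ q) := by
  rw [wm, lintegral_withDensity_eq_lintegral_mul_non_measurable _ (wm_meas q δ) (by simp)]
  refine setLIntegral_congr_fun measurableSet_Ioi fun t ht => ?_
  have ht' : (0:ℝ) < t := ht
  simp only [Pi.mul_apply]
  rw [← ENNReal.ofReal_mul (by positivity), Real.mul_rpow (by positivity) (by positivity),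
    ← Real.rpow_mul ht'.le]

lemma wm_eLp {q δ : ℝ} (hq : 1 < q) (v : ℝ → X) : eLpNorm v (ENNReal.ofReal q) (wm q δ) ^ q =
    ∫⁻ t in Ioi 0, ENNReal.ofReal ((t ^ δ * ‖v t‖) ^ q) := by
  have hq0 : 0 < q := by linarith
  rw [eLpNorm_eq_lintegral_rpow_enorm_toReal (by simpa using hq0) (by simp),
    ENNReal.toReal_ofReal hq0.le, ← ENNReal.rpow_mul, one_div_mul_cancel hq0.ne', ENNReal.rpow_one,
    ← wm_lint]
  congr 1; ext t
  rw [← ofReal_norm_eq_enorm, ENNReal.ofReal_rpow_of_nonneg (norm_nonneg _) hq0.le]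

lemma wm_memLp {q δ : ℝ} (hq : 1 < q) {v : ℝ → X} : MemLp v (ENNReal.ofReal q) (wm q δ) ↔
    AEStronglyMeasurable v (volume.restrict (Ioi 0)) ∧
    ∫⁻ t in Ioi 0, ENNReal.ofReal ((t ^ δ * ‖v t‖) ^ q) < ⊤ := by
  have hq0 : 0 < q := by linarith
  rw [← wm_eLp hq, MemLp]
  refine and_congr ⟨fun h => h.mono_ac (wm_ac' q δ), fun h => h.mono_ac (wm_ac q δ)⟩ ?_
  rw [ENNReal.rpow_lt_top_iff_of_pos hq0]

lemma wm_emb {q δ : ℝ} (hq : 1 < q) (hδ : δ < 1 - 1 / q) (h : ℝ) :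
    ∃ κ : ENNReal, κ ≠ ⊤ ∧ ∀ v : ℝ → X, AEStronglyMeasurable v (volume.restrict (Ioi 0)) →
      ∫⁻ t in Ioc 0 h, ‖v t‖ₑ ≤ κ * eLpNorm v (ENNReal.ofReal q) (wm q δ) := by
  have hq0 : 0 < q := by linarith
  set r := q / (q - 1) with hr
  have hconj : q.HolderConjugate r := Real.HolderConjugate.conjExponent hq
  have hr0 : 0 < r := hconj.symm.pos
  have hexp : -1 < -δ * r := by
    have : δ * r < 1 := by
      rw [hr, mul_div_assoc', div_lt_one (by linarith)]
      have : δ * q < (1 - 1 / q) * q := by gcongr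
      rwa [sub_mul, one_div_mul_cancel hq0.ne', one_mul] at this
    linarith
  refine ⟨(∫⁻ t in Ioc 0 h, ENNReal.ofReal (t ^ (-δ)) ^ r) ^ (1 / r), ?_, fun v hv => ?_⟩
  · refine ENNReal.rpow_ne_top_of_nonneg (by positivity) ?_
    rcases le_or_gt h 0 with h0 | h0
    · simp [Ioc_eq_empty (not_lt.2 h0)]
    have hi := (intervalIntegrable_iff_integrableOn_Ioc_of_le h0.le).1
      (intervalIntegral.intervalIntegrable_rpow' (a := 0) (b := h) hexp)
    have : ∫⁻ t in Ioc 0 h, ENNReal.ofReal (t ^ (-δ)) ^ r = ∫⁻ t in Ioc 0 h, ENNReal.ofReal (t ^ (-δ * r)) := by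
      refine setLIntegral_congr_fun measurableSet_Ioc fun t ht => ?_
      have := ht.1
      rw [ENNReal.ofReal_rpow_of_nonneg (by positivity) hr0.le, ← Real.rpow_mul ht.1.le]
    rw [this]
    have h2 := hi.2
    rw [hasFiniteIntegral_iff_ofReal] at h2
    · exact h2.ne
    · filter_upwards [ae_restrict_mem measurableSet_Ioc] with t ht
      exact Real.rpow_nonneg ht.1.le _
  · have hsub : Ioc 0 h ⊆ Ioi 0 := fun t ht => ht.1
    have hv' : AEStronglyMeasurable v (volume.restrict (Ioc 0 h)) :=
      hv.mono_measure (Measure.restrict_mono hsub le_rfl)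
    have hm1 : AEMeasurable (fun t : ℝ => ENNReal.ofReal (t ^ (-δ))) (volume.restrict (Ioc 0 h)) :=
      (measurable_id.pow_const _).ennreal_ofReal.aemeasurable
    have hm2 : AEMeasurable (fun t : ℝ => ENNReal.ofReal (t ^ δ * ‖v t‖)) (volume.restrict (Ioc 0 h)) :=
      ((measurable_id.pow_const _).aemeasurable.mul hv'.norm.aemeasurable).ennreal_ofReal
    have H := ENNReal.lintegral_mul_le_Lp_mul_Lq _ hconj.symm hm1 hm2
    have e : ∫⁻ t in Ioc 0 h, ‖v t‖ₑ = ∫⁻ t in Ioc 0 h, ((fun t : ℝ => ENNReal.ofReal (t ^ (-δ))) *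
        (fun t : ℝ => ENNReal.ofReal (t ^ δ * ‖v t‖))) t := by
      refine setLIntegral_congr_fun measurableSet_Ioc fun t ht => ?_
      have := ht.1
      simp only [Pi.mul_apply]
      rw [← ENNReal.ofReal_mul (by positivity), ← mul_assoc, ← Real.rpow_add this]
      simp
    rw [e]
    refine H.trans (mul_le_mul_right ?_ _)
    rw [one_div, ENNReal.rpow_inv_le_iff hq0, wm_eLp hq]
    refine le_trans (le_of_eq ?_) (lintegral_mono_set hsub)
    refine setLIntegral_congr_fun measurableSet_Ioc fun t ht => ?_
    have := ht.1
    exact ENNReal.ofReal_rpow_of_nonneg (by positivity) hq0.le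

lemma wm_intOn {q δ : ℝ} (hq : 1 < q) (hδ : δ < 1 - 1 / q) {v : ℝ → X}
    (hv : MemLp v (ENNReal.ofReal q) (wm q δ)) (h : ℝ) : IntegrableOn v (Ioc 0 h) := by
  obtain ⟨κ, hκ, H⟩ := wm_emb (X := X) hq hδ h
  have hv1 := ((wm_memLp hq).1 hv).1
  refine ⟨hv1.mono_measure (Measure.restrict_mono (fun t ht => ht.1) le_rfl), ?_⟩
  exact (H v hv1).trans_lt (ENNReal.mul_lt_top hκ.lt_top hv.2)

variable [NormedSpace ℝ X]

lemma Nice.add {g h : ℝ → X} (hg : Nice g) (hh : Nice h) : Nice (fun t => g t + h t) := by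
  obtain ⟨B, hB⟩ := hg.bdd
  obtain ⟨B', hB'⟩ := hh.bdd
  refine ⟨hg.sm.add hh.sm, hg.int.add hh.int, ⟨B + B', fun t => ?_⟩, fun t ht => ?_⟩
  · exact (norm_add_le _ _).trans (add_le_add (hB t) (hB' t))
  · simp [hg.neg t ht, hh.neg t ht]

lemma wm_dense {R : X →L[ℝ] X} (hR : DenseRange R) {q δ : ℝ} (hq : 1 < q) {f : ℝ → X}
    (hf : MemLp f (ENNReal.ofReal q) (wm q δ)) {ε : ENNReal} (hε : ε ≠ 0) :
    ∃ g : ℝ → X, Nice g ∧ (∃ T : ℝ, ∀ t > T, g t = 0) ∧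
      eLpNorm (f - fun t => R (g t)) (ENNReal.ofReal q) (wm q δ) ≤ ε := by
  have hq0 : 0 < q := by linarith
  have hqe : ENNReal.ofReal q ≠ 0 := by simpa using hq0
  have key := MemLp.induction_dense (p := ENNReal.ofReal q) (μ := wm q δ) ENNReal.ofReal_ne_top
    (fun G : ℝ → X => ∃ g : ℝ → X, Nice g ∧ (∃ T : ℝ, ∀ t > T, g t = 0) ∧ G = fun t => R (g t))
    ?_ ?_ ?_ hf hε
  · obtain ⟨G, h1, g, h2, h3, rfl⟩ := key
    exact ⟨g, h2, h3, h1⟩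
  · intro c s hs hms ε hε
    have hε2 : (0 : ENNReal) < ε / 2 := by
      rw [ENNReal.div_pos_iff]; exact ⟨hε, by simp⟩
    -- truncation
    have hT : Filter.Tendsto (fun n : ℕ => ‖c‖ₑ * wm q δ (s \ Ioc (0:ℝ) n) ^ (1 / q)) Filter.atTop (nhds 0) := by
      have h1 : Filter.Tendsto (fun n : ℕ => wm q δ (s \ Ioc (0:ℝ) n)) Filter.atTop (nhds 0) := by
        have := tendsto_measure_iInter_atTop (μ := wm q δ) (s := fun n : ℕ => s \ Ioc (0:ℝ) n)
          (fun n => (hs.diff measurableSet_Ioc).nullMeasurableSet)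
          (fun m n hmn => sdiff_subset_sdiff_right (Ioc_subset_Ioc_right (by exact_mod_cast hmn)))
          ⟨0, (lt_of_le_of_lt (measure_mono sdiff_subset) hms).ne⟩
        have h0 : wm q δ (⋂ n : ℕ, s \ Ioc (0:ℝ) n) = 0 := by
          refine measure_mono_null (t := Iic 0) ?_ ?_
          · intro t ht
            by_contra h
            obtain ⟨n, hn⟩ := exists_nat_ge t
            exact (mem_iInter.1 ht n).2 ⟨not_le.1 h, hn⟩
          · refine wm_ac q δ ?_
            rw [Measure.restrict_apply measurableSet_Iic, Iic_inter_Ioi, Ioc_self, measure_empty]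
        rwa [h0] at this
      have h2 := (ENNReal.continuous_rpow_const (y := 1 / q)).tendsto 0 |>.comp h1
      rw [ENNReal.zero_rpow_of_pos (by positivity)] at h2
      have h3 := ENNReal.Tendsto.const_mul (a := ‖c‖ₑ) h2 (Or.inr enorm_ne_top)
      simpa [Function.comp_def] using h3
    obtain ⟨n, hn⟩ := (hT.eventually (gt_mem_nhds hε2)).exists
    have hκ : wm q δ s ^ (1 / q) ≠ ⊤ := ENNReal.rpow_ne_top_of_nonneg (by positivity) hms.ne
    have hU : Filter.Tendsto (fun z : X => ‖z - c‖ₑ * wm q δ s ^ (1 / q)) (nhds c) (nhds 0) := by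
      have h1 : Filter.Tendsto (fun z : X => ‖z - c‖ₑ) (nhds c) (nhds 0) := by
        have : Continuous (fun z : X => ‖z - c‖ₑ) := by fun_prop
        simpa using this.tendsto c
      simpa using ENNReal.Tendsto.mul_const h1 (Or.inr hκ)
    obtain ⟨x, hx⟩ := hR.mem_nhds (hU.eventually (gt_mem_nhds hε2))
    have hx' : ‖R x - c‖ₑ * wm q δ s ^ (1 / q) < ε / 2 := hx
    have hm : MeasurableSet (s ∩ Ioc (0:ℝ) n) := hs.inter measurableSet_Ioc
    refine ⟨fun t => R ((s ∩ Ioc (0:ℝ) n).indicator (fun _ => x) t), ?_,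
      (s ∩ Ioc (0:ℝ) n).indicator (fun _ => x), ⟨?_, ?_, ⟨‖x‖, fun t => ?_⟩, fun t ht => ?_⟩, ⟨n, fun t ht => ?_⟩, rfl⟩
    · have e : ((fun t => R ((s ∩ Ioc (0:ℝ) n).indicator (fun _ => x) t)) - s.indicator fun _ => c) =
          (s ∩ Ioc (0:ℝ) n).indicator (fun _ => R x - c) - (s \ Ioc (0:ℝ) n).indicator (fun _ => c) := by
        ext t
        by_cases h1 : t ∈ s <;> by_cases h2 : t ∈ Ioc (0:ℝ) n <;>
          simp only [Pi.sub_apply, Set.indicator, mem_inter_iff, mem_sdiff, h1, h2, and_self, and_true, and_false,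
            if_true, if_false, map_zero, not_true, not_false_iff, true_and, false_and] <;> simp
      rw [e]
      refine (eLpNorm_sub_le (aestronglyMeasurable_const.indicator hm)
        (aestronglyMeasurable_const.indicator (hs.diff measurableSet_Ioc)) (by
          rw [← ENNReal.ofReal_one]; exact ENNReal.ofReal_le_ofReal hq.le)).trans ?_
      rw [eLpNorm_indicator_const hm hqe ENNReal.ofReal_ne_top,
        eLpNorm_indicator_const (hs.diff measurableSet_Ioc) hqe ENNReal.ofReal_ne_top,
        ENNReal.toReal_ofReal hq0.le, ← ENNReal.add_halves ε]
      refine add_le_add (le_trans (mul_le_mul_right ?_ _) hx'.le) hn.le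
      exact ENNReal.rpow_le_rpow (measure_mono inter_subset_left) (by positivity)
    · exact stronglyMeasurable_const.indicator hm
    · rw [integrable_indicator_iff hm]
      refine IntegrableOn.mono_set (t := Ioc (0:ℝ) n) ?_ inter_subset_right
      have hfin : IsFiniteMeasure (volume.restrict (Ioc (0:ℝ) n)) := ⟨by simp⟩
      exact integrable_const _
    · exact norm_indicator_le_norm_self (fun _ => x) t
    · exact indicator_of_notMem (fun h => absurd h.2.1 (not_lt.2 ht)) _
    · exact indicator_of_notMem (fun h => absurd h.2.2 (not_le.2 ht)) _
  · rintro _ _ ⟨g, h1, ⟨T, hT⟩, rfl⟩ ⟨g', h1', ⟨T', hT'⟩, rfl⟩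
    refine ⟨fun t => g t + g' t, h1.add h1', ⟨max T T', fun t ht => ?_⟩, ?_⟩
    · simp only [hT t (lt_of_le_of_lt (le_max_left _ _) ht), hT' t (lt_of_le_of_lt (le_max_right _ _) ht), add_zero]
    · ext t; simp
  · rintro _ ⟨g, h1, -, rfl⟩
    exact (R.continuous.comp_stronglyMeasurable h1.sm).aestronglyMeasurable

namespace MRR
variable [CompleteSpace X] {R : X →L[ℝ] X} {p C : ℝ}

lemma w_unique (D : MRR R p C) {q δ : ℝ} (hq : 1 < q) (hδ : δ < 1 - 1 / q) {y : ℝ → X}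
    (hy : MemLp y (ENNReal.ofReal q) (wm q δ))
    (he : ∀ᵐ t ∂(volume.restrict (Ioi 0)), R (y t) = -∫ s in (0:ℝ)..t, y s) :
    ∀ᵐ t ∂(volume.restrict (Ioi 0)), y t = 0 := by
  have h1 : ∀ n : ℕ, ∀ᵐ t ∂(volume : Measure ℝ), t ∈ Ioc (0:ℝ) (n + 1) → y t = 0 := fun n =>
    (ae_restrict_iff' measurableSet_Ioc).1 (D.lu (by positivity) (wm_intOn hq hδ hy _)
      (ae_restrict_of_ae_restrict_of_subset (fun t ht => ht.1) he))
  rw [ae_restrict_iff' measurableSet_Ioi]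
  filter_upwards [ae_all_iff.2 h1] with t ht h0
  obtain ⟨n, hn⟩ := exists_nat_ge t
  exact ht n ⟨h0, by linarith⟩

lemma w_exists (D : MRR R p C) {q δ : ℝ} (hq : 1 < q) (hδ0 : 0 ≤ δ) (hδ : δ < 1 - 1 / q) {f : ℝ → X}
    (hf : MemLp f (ENNReal.ofReal q) (wm q δ)) :
    ∃ y : ℝ → X, MemLp y (ENNReal.ofReal q) (wm q δ) ∧
      ∀ᵐ t ∂(volume.restrict (Ioi 0)), R (y t) = ∫ s in (0:ℝ)..t, (f s - y s) := by
  obtain ⟨S, M, C', DS, hcv⟩ := D.sgdata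
  obtain ⟨K, hK0, hK⟩ := DS.lw_all hq hδ0 hδ
  have hq0 : 0 < q := by linarith
  have hqe : ENNReal.ofReal q ≠ 0 := by simpa using hq0
  have hq1 : 1 ≤ ENNReal.ofReal q := by
    rw [← ENNReal.ofReal_one]; exact ENNReal.ofReal_le_ofReal hq.le
  set K1 : ENNReal := ENNReal.ofReal K ^ (1 / q) with hK1
  have hK1t : K1 ≠ ⊤ := ENNReal.rpow_ne_top_of_nonneg (by positivity) ENNReal.ofReal_ne_top
  set N : (ℝ → X) → ENNReal := fun v => eLpNorm v (ENNReal.ofReal q) (wm q δ) with hN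
  have hest : ∀ g, Nice g → (∃ T : ℝ, ∀ t > T, g t = 0) → N (cv S g) ≤ K1 * N (fun t => R (g t)) := by
    intro g hg hT
    have := hK g hg hT
    rw [← wm_eLp hq, ← wm_eLp hq] at this
    rw [← ENNReal.rpow_le_rpow_iff hq0, ENNReal.mul_rpow_of_nonneg _ _ hq0.le, hK1,
      ← ENNReal.rpow_mul, one_div_mul_cancel hq0.ne', ENNReal.rpow_one]
    exact this
  choose g hg hgT hgf using fun n : ℕ => wm_dense D.dr hq hf (ε := (2⁻¹ : ENNReal) ^ n) (by simp)
  have hRm : ∀ n, AEStronglyMeasurable (fun t => R (g n t)) (wm q δ) := fun n =>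
    (R.continuous.comp_stronglyMeasurable (hg n).sm).aestronglyMeasurable
  have hRLp : ∀ n, MemLp (fun t => R (g n t)) (ENNReal.ofReal q) (wm q δ) := by
    intro n
    have h1 : MemLp (f - fun t => R (g n t)) (ENNReal.ofReal q) (wm q δ) :=
      ⟨hf.1.sub (hRm n), (hgf n).trans_lt (ENNReal.pow_lt_top (by simp))⟩
    simpa using hf.sub h1
  have hyLp : ∀ n, MemLp (cv S (g n)) (ENNReal.ofReal q) (wm q δ) := fun n =>
    ⟨(DS.cv_sm (hg n)).aestronglyMeasurable,
      (hest _ (hg n) (hgT n)).trans_lt (ENNReal.mul_lt_top hK1t.lt_top (hRLp n).2)⟩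
  have hcau : ∀ L n m : ℕ, L ≤ n → L ≤ m →
      eLpNorm (cv S (g n) - cv S (g m)) (ENNReal.ofReal q) (wm q δ) < (2 * K1 + 1) * (2⁻¹ : ENNReal) ^ L := by
    intro L n m hn hm
    have e1 : cv S (g n) - cv S (g m) = cv S (fun t => g n t - g m t) := by
      ext t
      simp only [cv, map_sub, Pi.sub_apply]
      exact (integral_sub (DS.integrable (hg n) t) (DS.integrable (hg m) t)).symm
    obtain ⟨T, hT⟩ := hgT n
    obtain ⟨T', hT'⟩ := hgT m
    have h1 := hest (fun t => g n t - g m t) ((hg n).sub (hg m)) ⟨max T T', fun t ht => by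
      rw [hT t (lt_of_le_of_lt (le_max_left _ _) ht), hT' t (lt_of_le_of_lt (le_max_right _ _) ht), sub_zero]⟩
    have e2 : (fun t => R (g n t - g m t)) = (f - fun t => R (g m t)) - (f - fun t => R (g n t)) := by
      ext t; simp
    have hpw : ∀ k, L ≤ k → (2⁻¹ : ENNReal) ^ k ≤ 2⁻¹ ^ L := fun k hk =>
      pow_le_pow_right_of_le_one' (by simp) hk
    have h2 : N (fun t => R (g n t - g m t)) ≤ 2 * (2⁻¹ : ENNReal) ^ L := by
      rw [e2, two_mul]
      exact (eLpNorm_sub_le (hf.1.sub (hRm m)) (hf.1.sub (hRm n)) hq1).trans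
        (add_le_add ((hgf m).trans (hpw m hm)) ((hgf n).trans (hpw n hn)))
    rw [e1]
    refine (h1.trans (mul_le_mul_right h2 _)).trans_lt ?_
    have hL : (2⁻¹ : ENNReal) ^ L ≠ 0 := by simp
    have hL' : (2⁻¹ : ENNReal) ^ L ≠ ⊤ := (ENNReal.pow_lt_top (by simp)).ne
    rw [add_mul, one_mul, show K1 * (2 * (2⁻¹ : ENNReal) ^ L) = 2 * K1 * 2⁻¹ ^ L by ring]
    exact ENNReal.lt_add_right (ENNReal.mul_ne_top (ENNReal.mul_ne_top (by simp) hK1t) hL') hL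
  have hsum : ∑' L : ℕ, (2 * K1 + 1) * (2⁻¹ : ENNReal) ^ L ≠ ⊤ := by
    rw [ENNReal.tsum_mul_left, ENNReal.tsum_geometric]
    refine ENNReal.mul_ne_top (ENNReal.add_ne_top.2 ⟨ENNReal.mul_ne_top (by simp) hK1t, by simp⟩) ?_
    simp
  obtain ⟨y, hy, hlim⟩ := Lp.cauchy_complete_eLpNorm hq1 hyLp hsum hcau
  refine ⟨y, hy, ?_⟩
  obtain ⟨ns, hns, hae⟩ := (tendstoInMeasure_of_tendsto_eLpNorm hqe (fun n => (hyLp n).1) hy.1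
    hlim).exists_seq_tendsto_ae
  have hpow0 : Filter.Tendsto (fun n : ℕ => (2⁻¹ : ENNReal) ^ n) Filter.atTop (nhds 0) :=
    ENNReal.tendsto_pow_atTop_nhds_zero_of_lt_one (by simp)
  filter_upwards [(wm_ac' q δ).ae_le hae, ae_restrict_mem measurableSet_Ioi] with t ht ht0
  have ht0' : (0:ℝ) < t := ht0
  have hl : Filter.Tendsto (fun k => R (cv S (g (ns k)) t)) Filter.atTop (nhds (R (y t))) :=
    (R.continuous.tendsto _).comp ht
  refine tendsto_nhds_unique hl ?_
  have e : (fun k => R (cv S (g (ns k)) t)) = fun k => ∫ s in Ioc 0 t, (R (g (ns k) s) - cv S (g (ns k)) s) := by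
    ext k; rw [hcv _ (hg _) t ht0, intervalIntegral.integral_of_le ht0'.le]
  rw [e, intervalIntegral.integral_of_le ht0'.le]
  have hF : ∀ n, MemLp (fun s => R (g n s) - cv S (g n) s) (ENNReal.ofReal q) (wm q δ) := fun n =>
    (hRLp n).sub (hyLp n)
  have hFl : MemLp (fun s => f s - y s) (ENNReal.ofReal q) (wm q δ) := hf.sub hy
  have main : Filter.Tendsto (fun n => ∫ s in Ioc 0 t, (R (g n s) - cv S (g n) s)) Filter.atTop
      (nhds (∫ s in Ioc 0 t, (f s - y s))) := by
    refine tendsto_integral_of_L1 _ (wm_intOn hq hδ hFl t).aestronglyMeasurable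
      (Filter.Eventually.of_forall fun n => wm_intOn hq hδ (hF n) t) ?_
    obtain ⟨κ, hκ, H⟩ := wm_emb (X := X) hq hδ t
    have hb : ∀ n, ∫⁻ s in Ioc 0 t, ‖(R (g n s) - cv S (g n) s) - (f s - y s)‖ₑ ≤
        κ * ((2⁻¹ : ENNReal) ^ n + eLpNorm (cv S (g n) - y) (ENNReal.ofReal q) (wm q δ)) := by
      intro n
      refine (H (fun s => (R (g n s) - cv S (g n) s) - (f s - y s))
        ((wm_memLp hq).1 ((hF n).sub hFl)).1).trans (mul_le_mul_right ?_ _)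
      have e3 : (fun s => (R (g n s) - cv S (g n) s) - (f s - y s)) =
          -((f - fun t => R (g n t)) + (cv S (g n) - y)) := by
        ext s; simp only [Pi.neg_apply, Pi.add_apply, Pi.sub_apply]; abel
      rw [e3, eLpNorm_neg]
      exact (eLpNorm_add_le (hf.1.sub (hRm n)) ((hyLp n).1.sub hy.1) hq1).trans
        (add_le_add (hgf n) le_rfl)
    have hz : Filter.Tendsto (fun n : ℕ => κ * ((2⁻¹ : ENNReal) ^ n +
        eLpNorm (cv S (g n) - y) (ENNReal.ofReal q) (wm q δ))) Filter.atTop (nhds 0) := by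
      have := ENNReal.Tendsto.const_mul (a := κ) (hpow0.add hlim) (Or.inr hκ)
      simpa using this
    exact tendsto_of_tendsto_of_tendsto_of_le_of_le tendsto_const_nhds hz (fun _ => zero_le) hb
  exact main.comp hns.tendsto_atTop

end MRR
end


section
variable {X : Type*} [NormedAddCommGroup X] [NormedSpace ℝ X] [CompleteSpace X]

lemma ibp {g : ℝ → X} {T : ℝ} (hT : 0 ≤ T) (hg : IntegrableOn g (Ioc 0 T)) {φ : ℝ → ℝ}
    (hφ : ContDiff ℝ 1 φ) (hφT : φ T = 0) :
    ∫ s in Ioc 0 T, deriv φ s • ∫ r in (0:ℝ)..s, g r = -∫ r in Ioc 0 T, φ r • g r := by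
  have hfin : IsFiniteMeasure (volume.restrict (Ioc 0 T)) := ⟨by simp⟩
  have hdc : Continuous (deriv φ) := hφ.continuous_deriv le_rfl
  obtain ⟨B, hB⟩ := isCompact_Icc.exists_bound_of_continuousOn (s := Icc 0 T) hdc.continuousOn
  have e1 : ∫ s in Ioc 0 T, deriv φ s • ∫ r in (0:ℝ)..s, g r =
      ∫ s in Ioc 0 T, ∫ r in Ioc 0 T, (Iic s).indicator (fun r => deriv φ s • g r) r := by
    refine setIntegral_congr_fun measurableSet_Ioc fun s hs => ?_
    have e0 : Ioc 0 s = Ioc 0 T ∩ Iic s := by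
      ext r; simp only [mem_inter_iff, mem_Ioc, mem_Iic]
      constructor
      · rintro ⟨a, b⟩; exact ⟨⟨a, b.trans hs.2⟩, b⟩
      · rintro ⟨⟨a, b⟩, c⟩; exact ⟨a, c⟩
    rw [intervalIntegral.integral_of_le hs.1.le, setIntegral_indicator measurableSet_Iic, integral_smul, ← e0]
  have hint : Integrable (Function.uncurry fun s r => (Iic s).indicator (fun r => deriv φ s • g r) r)
      ((volume.restrict (Ioc 0 T)).prod (volume.restrict (Ioc 0 T))) := by
    have hd : Integrable (deriv φ) (volume.restrict (Ioc 0 T)) :=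
      Integrable.of_bound hdc.aestronglyMeasurable B
        ((ae_restrict_mem measurableSet_Ioc).mono fun t ht => hB t ⟨ht.1.le, ht.2⟩)
    have h0 : Integrable (fun z : ℝ × ℝ => deriv φ z.1 • g z.2)
      ((volume.restrict (Ioc 0 T)).prod (volume.restrict (Ioc 0 T))) := hd.smul_prod hg
    have hs : MeasurableSet {z : ℝ × ℝ | z.2 ≤ z.1} := measurableSet_le measurable_snd measurable_fst
    refine (h0.indicator hs).congr (Filter.Eventually.of_forall fun z => ?_)
    simp [Function.uncurry, Set.indicator]
  rw [e1, integral_integral_swap hint, ← integral_neg]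
  refine setIntegral_congr_fun measurableSet_Ioc fun r hr => ?_
  have e2 : (fun s => (Iic s).indicator (fun r => deriv φ s • g r) r) =
      (Ici r).indicator (fun s => deriv φ s • g r) := by
    ext s; simp [Set.indicator]
  simp only [e2]
  have : Ioc 0 T ∩ Ici r = Icc r T := by
    ext s; simp only [mem_inter_iff, mem_Ioc, mem_Icc, mem_Ici]
    constructor
    · rintro ⟨⟨a, b⟩, c⟩; exact ⟨c, b⟩
    · rintro ⟨a, b⟩; exact ⟨⟨hr.1.trans_le a, b⟩, a⟩
  rw [setIntegral_indicator measurableSet_Ici, this, integral_Icc_eq_integral_Ioc,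
    ← intervalIntegral.integral_of_le hr.2, intervalIntegral.integral_smul_const,
    intervalIntegral.integral_deriv_eq_sub (fun x _ => (hφ.differentiable one_ne_zero) x)
      (hdc.intervalIntegrable _ _), hφT]
  simp

lemma supp_T {φ : ℝ → ℝ} (hc : HasCompactSupport φ) : ∃ T : ℝ, 0 < T ∧ ∀ t ≥ T, φ t = 0 ∧ deriv φ t = 0 := by
  obtain ⟨T, hT⟩ := hc.isCompact.bddAbove
  refine ⟨max T 0 + 1, by positivity, fun t ht => ?_⟩
  have hn : t ∉ tsupport φ := fun h => by
    have := hT h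
    have := le_max_left T 0
    linarith [show max T 0 + 1 ≤ t from ht]
  refine ⟨image_eq_zero_of_notMem_tsupport hn, ?_⟩
  by_contra h
  exact hn (support_deriv_subset h)

lemma int_T {F : ℝ → X} {T : ℝ} (hT : 0 < T) (h : ∀ t ≥ T, F t = 0) :
    ∫ t in Ioi 0, F t = ∫ t in Ioc 0 T, F t := by
  symm
  refine setIntegral_eq_of_subset_of_forall_diff_eq_zero measurableSet_Ioi (fun t ht => ht.1) ?_ |>.symm
  intro t ht
  refine h t ?_
  by_contra h'
  exact ht.2 ⟨ht.1, (not_le.1 h').le⟩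

lemma ibp' {g : ℝ → X} (hg : ∀ h : ℝ, IntegrableOn g (Ioc 0 h)) {φ : ℝ → ℝ}
    (hφ : ContDiff ℝ 1 φ) (hc : HasCompactSupport φ) :
    ∫ s in Ioi 0, deriv φ s • ∫ r in (0:ℝ)..s, g r = -∫ r in Ioi 0, φ r • g r := by
  obtain ⟨T, hT, h⟩ := supp_T hc
  rw [int_T hT (fun t ht => by rw [(h t ht).2, zero_smul]),
    int_T hT (fun t ht => by rw [(h t ht).1, zero_smul])]
  exact ibp hT.le (hg T) hφ (h T le_rfl).1

lemma prim_cont {g : ℝ → X} (hg : ∀ h : ℝ, IntegrableOn g (Ioc 0 h)) :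
    ContinuousOn (fun t => ∫ r in (0:ℝ)..t, g r) (Ici 0) := by
  intro t ht
  have ht' : (0:ℝ) ≤ t := ht
  have hi : IntegrableOn g (uIcc 0 (t + 1)) := by
    rw [uIcc_of_le (by linarith), integrableOn_Icc_iff_integrableOn_Ioc]; exact hg (t+1)
  have := intervalIntegral.continuousOn_primitive_interval hi
  rw [uIcc_of_le (by linarith)] at this
  refine (this t ⟨ht', by linarith⟩).mono_of_mem_nhdsWithin ?_
  rw [← Ici_inter_Iic]
  exact inter_mem_nhdsWithin _ (Iic_mem_nhds (by linarith))

lemma loc_of_Ioc {g : ℝ → X} (hg : ∀ h : ℝ, IntegrableOn g (Ioc 0 h)) : LocallyIntegrableOn g (Ioi 0) := by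
  intro x hx
  refine ⟨Ioc 0 (x + 1), ?_, hg _⟩
  rw [← Ioi_inter_Iic]
  exact inter_mem_nhdsWithin _ (Iic_mem_nhds (by linarith))

/-- Vanishing weak derivative implies constant. -/
lemma dbr {w : ℝ → X} (hw : LocallyIntegrableOn w (Ioi 0))
    (H : ∀ φ : ℝ → ℝ, ContDiff ℝ (⊤ : ℕ∞) φ → HasCompactSupport φ → tsupport φ ⊆ Ioi 0 →
      ∫ t in Ioi 0, deriv φ t • w t = 0) :
    ∃ c : X, ∀ᵐ t ∂(volume.restrict (Ioi 0)), w t = c := by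
  let b : ContDiffBump (2:ℝ) := ⟨1/2, 1, by norm_num, by norm_num⟩
  have hηs : tsupport (b.normed volume) ⊆ Ioi 0 := by
    rw [b.tsupport_normed_eq]
    intro t ht
    rw [Metric.mem_closedBall, Real.dist_eq, abs_le] at ht
    have := ht.1
    simp only [b] at this
    exact mem_Ioi.2 (by linarith)
  set η : ℝ → ℝ := b.normed volume with hη
  have hηc : ContDiff ℝ (⊤ : ℕ∞) η := b.contDiff_normed
  have hηk : HasCompactSupport η := b.hasCompactSupport_normed
  have hη1 : ∫ t, η t = 1 := b.integral_normed
  refine ⟨∫ t in Ioi 0, η t • w t, ?_⟩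
  set c := ∫ t in Ioi 0, η t • w t with hc
  have hψi : ∀ ψ : ℝ → ℝ, Continuous ψ → HasCompactSupport ψ → tsupport ψ ⊆ Ioi 0 →
      IntegrableOn (fun t => ψ t • w t) (Ioi 0) := by
    intro ψ h1 h2 h3
    have h4 : IntegrableOn (fun t => ψ t • w t) (tsupport ψ) :=
      (hw.integrableOn_compact_subset h3 h2.isCompact).continuousOn_smul h1.continuousOn h2.isCompact
    refine h4.of_forall_sdiff_eq_zero measurableSet_Ioi fun t ht => ?_
    rw [image_eq_zero_of_notMem_tsupport ht.2, zero_smul]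
  have hz : LocallyIntegrableOn (fun t => w t - c) (Ioi 0) :=
    hw.sub (locallyIntegrableOn_const c)
  have := isOpen_Ioi.ae_eq_zero_of_integral_contDiff_smul_eq_zero hz (fun ψ h1 h2 h3 => ?_)
  · rw [ae_restrict_iff' measurableSet_Ioi]
    filter_upwards [this] with t ht h0
    exact sub_eq_zero.1 (ht h0)
  · have hfull : ∀ {Y : Type _} [NormedAddCommGroup Y] [NormedSpace ℝ Y] (χ : ℝ → ℝ) (v : ℝ → Y), tsupport χ ⊆ Ioi 0 →
        ∫ t in Ioi 0, χ t • v t = ∫ t, χ t • v t := by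
      intro Y _ _ χ v h
      refine setIntegral_eq_integral_of_forall_compl_eq_zero fun t ht => ?_
      rw [image_eq_zero_of_notMem_tsupport (fun h' => ht (h h')), zero_smul]
    rw [← hfull ψ _ h3]
    set m : ℝ := ∫ t, ψ t with hm
    have hψc : Continuous ψ := h1.continuous
    have hηcc : Continuous η := hηc.continuous
    set χ : ℝ → ℝ := fun t => ψ t - m * η t with hχ
    have hχc : ContDiff ℝ (⊤ : ℕ∞) χ := h1.sub (contDiff_const.mul hηc)
    have hχcc : Continuous χ := hχc.continuous
    have hχk : HasCompactSupport χ := h2.sub hηk.mul_left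
    have hχs : tsupport χ ⊆ Ioi 0 := by
      refine (tsupport_sub ψ _).trans (union_subset h3 ?_)
      exact (tsupport_mul_subset_right).trans hηs
    have hχ0 : ∫ t, χ t = 0 := by
      rw [hχ, integral_sub (hψc.integrable_of_hasCompactSupport h2)
        ((hηcc.integrable_of_hasCompactSupport hηk).const_mul m), integral_const_mul, hη1, mul_one, sub_self]
    obtain ⟨a, ha0, ha⟩ : ∃ a > 0, ∀ t ≤ a, χ t = 0 := by
      obtain ⟨a, ha, hb⟩ : ∃ a > 0, ∀ t ∈ tsupport χ, a < t := by
        by_cases hne : (tsupport χ).Nonempty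
        · obtain ⟨x, hx, hx'⟩ := hχk.isCompact.exists_isLeast hne
          have : 0 < x := hχs hx
          exact ⟨x / 2, by positivity, fun t ht => by linarith [hx' ht]⟩
        · exact ⟨1, one_pos, fun t ht => (hne ⟨t, ht⟩).elim⟩
      exact ⟨a, ha, fun t ht => image_eq_zero_of_notMem_tsupport fun h => by linarith [hb t h]⟩
    obtain ⟨T, hT, hT'⟩ := supp_T hχk
    set φ : ℝ → ℝ := fun t => ∫ s in (0:ℝ)..t, χ s with hφ
    have hd : ∀ t, HasDerivAt φ (χ t) t := fun t =>
      intervalIntegral.integral_hasDerivAt_right (hχcc.intervalIntegrable _ _)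
        (hχcc.stronglyMeasurableAtFilter _ _) hχcc.continuousAt
    have hdφ : deriv φ = χ := funext fun t => (hd t).deriv
    have hφc : ContDiff ℝ (⊤ : ℕ∞) φ := by
      rw [contDiff_infty_iff_deriv, hdφ]
      exact ⟨fun t => (hd t).differentiableAt, hχc⟩
    have hφa : ∀ t ≤ a, φ t = 0 := by
      intro t ht
      refine (intervalIntegral.integral_congr (g := fun _ => (0:ℝ)) fun s hs => ?_).trans (by simp)
      refine ha s (hs.2.trans ?_)
      exact max_le ha0.le ht
    have hφT : ∀ t ≥ T, φ t = 0 := by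
      intro t ht
      have ht0 : 0 < t := hT.trans_le ht
      rw [hφ]
      simp only
      rw [intervalIntegral.integral_of_le ht0.le]
      refine Eq.trans ?_ hχ0
      refine setIntegral_eq_integral_of_forall_compl_eq_zero fun s hs => ?_
      by_cases h : s ≤ 0
      · exact ha s (h.trans ha0.le)
      · refine (hT' s ?_).1
        by_contra h'
        exact hs ⟨not_le.1 h, by linarith [not_le.1 h']⟩
    have hsub : tsupport φ ⊆ Icc a T := by
      refine closure_minimal (fun t ht => ?_) isClosed_Icc
      refine ⟨?_, ?_⟩
      · by_contra h; exact ht (hφa t (not_le.1 h).le)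
      · by_contra h; exact ht (hφT t (not_le.1 h).le)
    have hφk : HasCompactSupport φ := isCompact_Icc.of_isClosed_subset (isClosed_tsupport φ) hsub
    have key := H φ hφc hφk (fun t ht => ha0.trans_le (hsub ht).1)
    rw [hdφ] at key
    have i1 := hψi ψ hψc h2 h3
    have i2 := hψi η hηcc hηk hηs
    have e1 : ∫ t in Ioi 0, χ t • w t = (∫ t in Ioi 0, ψ t • w t) - m • c := by
      rw [hc, ← integral_smul, ← integral_sub (g := fun t => m • η t • w t) i1 (i2.smul m)]
      refine integral_congr_ae (Filter.Eventually.of_forall fun t => ?_)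
      simp only [hχ, sub_smul, mul_smul]
    have e2 : ∫ t in Ioi 0, ψ t • (w t - c) = (∫ t in Ioi 0, ψ t • w t) - m • c := by
      have i3 : Integrable (fun t => ψ t • c) := (hψc.integrable_of_hasCompactSupport h2).smul_const c
      rw [show m • c = ∫ t in Ioi 0, ψ t • c by rw [hfull ψ (fun _ => c) h3, integral_smul_const], ← integral_sub i1 i3.integrableOn]
      refine integral_congr_ae (Filter.Eventually.of_forall fun t => ?_)
      simp only [smul_sub]
    rw [e2, ← e1, key]
end


section
variable {Y Z : Type*} [NormedAddCommGroup Y] [NormedSpace ℂ Y] [CompleteSpace Y]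
  [NormedAddCommGroup Z] [NormedSpace ℂ Z] [CompleteSpace Z]

lemma memWLp_iff {q ν : ℝ} (hq : 1 < q) {v : ℝ → Y} :
    MemWLp q ν (Ioi 0) v ↔ MemLp v (ENNReal.ofReal q) (wm q (1 - ν)) := by
  rw [wm_memLp hq, MemWLp]
  refine and_congr_right fun hv => ?_
  have hm : AEStronglyMeasurable (fun t : ℝ => (t ^ (1 - ν) * ‖v t‖) ^ q) (volume.restrict (Ioi 0)) := by
    have h1 : AEMeasurable (fun t : ℝ => (t ^ (1 - ν) * ‖v t‖) ^ q) (volume.restrict (Ioi 0)) :=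
      ((measurable_id.pow_const (1 - ν)).aemeasurable.mul hv.norm.aemeasurable).pow_const q
    exact h1.aestronglyMeasurable
  have h0 : 0 ≤ᵐ[volume.restrict (Ioi 0)] fun t : ℝ => (t ^ (1 - ν) * ‖v t‖) ^ q := by
    filter_upwards [ae_restrict_mem measurableSet_Ioi] with t ht
    have : (0:ℝ) < t := ht
    simp only [Pi.zero_apply]
    positivity
  rw [IntegrableOn, Integrable, hasFiniteIntegral_iff_ofReal h0]
  exact and_iff_right hm

/-- two continuous functions on `[0,∞)` agreeing a.e. agree at `0`. -/
lemma eq_zero_of_ae {v w : ℝ → Y} (hv : ContinuousOn v (Ici 0)) (hw : ContinuousOn w (Ici 0))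
    (h : ∀ᵐ t ∂(volume.restrict (Ioi 0)), v t = w t) : v 0 = w 0 := by
  have hfr : ∃ᶠ t in nhdsWithin (0:ℝ) (Ioi 0), v t = w t := by
    rw [Filter.frequently_iff]
    intro U hU
    obtain ⟨e, he, hs⟩ := mem_nhdsGT_iff_exists_Ioo_subset.1 hU
    by_contra hcon
    push Not at hcon
    rw [ae_restrict_iff' measurableSet_Ioi, ae_iff] at h
    have : (Ioo 0 e : Set ℝ) ⊆ {a | ¬(a ∈ Ioi 0 → v a = w a)} := fun t ht h' =>
      hcon t (hs ht) (h' ht.1)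
    have h2 := measure_mono_null this h
    simp only [Real.volume_Ioo, ENNReal.ofReal_eq_zero] at h2
    linarith [show (0:ℝ) < e from he]
  have h1 : Filter.Tendsto (fun t => v t - w t) (nhdsWithin (0:ℝ) (Ioi 0)) (nhds (v 0 - w 0)) :=
    ((hv 0 (mem_Ici.2 le_rfl)).mono Ioi_subset_Ici_self).tendsto.sub ((hw 0 (mem_Ici.2 le_rfl)).mono Ioi_subset_Ici_self).tendsto
  by_contra hne
  have h2 := h1.eventually_ne (sub_ne_zero.2 hne)
  obtain ⟨t, ht, ht'⟩ := (hfr.and_eventually h2).exists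
  exact ht' (sub_eq_zero.2 ht)

lemma sol_to_int {q ν : ℝ} (hq : 1 < q) (hν : 1 / q < ν) {ι A : Y →L[ℂ] Z} {f : ℝ → Z} {u : ℝ → Y} {u' : ℝ → Z}
    (hs : IsLinSol q ν (Ioi 0) ι A f 0 u u') :
    MemLp u (ENNReal.ofReal q) (wm q (1 - ν)) ∧
      ∀ᵐ t ∂(volume.restrict (Ioi 0)), ι (u t) = ∫ s in (0:ℝ)..t, (f s - A (u s)) := by
  obtain ⟨⟨h1, h2, h3, h4, h5, h6⟩, he, w, hw, hwe, hw0⟩ := hs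
  have hδ : 1 - ν < 1 - 1 / q := by linarith
  refine ⟨(memWLp_iff hq).1 h1, ?_⟩
  have hg : ∀ h : ℝ, IntegrableOn u' (Ioc 0 h) := wm_intOn hq hδ ((memWLp_iff hq).1 h3)
  have hP := prim_cont hg
  have hPl : LocallyIntegrableOn (fun t => ∫ r in (0:ℝ)..t, u' r) (Ioi 0) :=
    (hP.mono Ioi_subset_Ici_self).locallyIntegrableOn measurableSet_Ioi
  obtain ⟨c, hc⟩ := dbr (h4.sub hPl) (by
    intro φ a b d
    have hT := supp_T b
    have hk : HasCompactSupport (deriv φ) := b.deriv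
    have hks : tsupport (deriv φ) ⊆ Ioi 0 := (tsupport_deriv_subset).trans d
    have hdc : Continuous (deriv φ) := a.continuous_deriv (by simp)
    have hi : ∀ w : ℝ → Z, LocallyIntegrableOn w (Ioi 0) → IntegrableOn (fun t => deriv φ t • w t) (Ioi 0) := by
      intro w hw
      have h4 : IntegrableOn (fun t => deriv φ t • w t) (tsupport (deriv φ)) :=
        (hw.integrableOn_compact_subset hks hk.isCompact).continuousOn_smul hdc.continuousOn hk.isCompact
      refine h4.of_forall_sdiff_eq_zero measurableSet_Ioi fun t ht => ?_
      rw [image_eq_zero_of_notMem_tsupport ht.2, zero_smul]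
    have e := ibp' hg (a.of_le (by simp)) b
    simp only [Pi.sub_apply, smul_sub]
    rw [integral_sub (hi _ h4) (hi _ hPl), h6 φ a b d, e, sub_self])
  have hc0 : c = 0 := by
    have hic : (insert 0 (Ioi 0) : Set ℝ) = Ici 0 := by ext; simp [le_iff_eq_or_lt, eq_comm]
    rw [hic] at hw
    have := eq_zero_of_ae (hw.sub hP) (continuousOn_const (c := c)) (by
      filter_upwards [hc, hwe] with t ht ht'
      simp only [Pi.sub_apply] at ht ⊢
      rw [ht', ht])
    simpa [hw0] using this.symm
  subst hc0
  filter_upwards [hc, ae_restrict_mem measurableSet_Ioi] with t ht ht0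
  have ht0' : (0:ℝ) < t := ht0
  simp only [Pi.sub_apply] at ht
  rw [sub_eq_zero.1 ht, intervalIntegral.integral_of_le ht0'.le, intervalIntegral.integral_of_le ht0'.le]
  refine integral_congr_ae ?_
  filter_upwards [ae_restrict_of_ae_restrict_of_subset (fun x hx => hx.1) he] with s hs
  rw [← hs]; abel

lemma int_to_sol {q ν : ℝ} (hq : 1 < q) (hν : 1 / q < ν) {ι A : Y →L[ℂ] Z} {f : ℝ → Z} {u : ℝ → Y}
    (hf : MemLp f (ENNReal.ofReal q) (wm q (1 - ν))) (hu : MemLp u (ENNReal.ofReal q) (wm q (1 - ν)))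
    (he : ∀ᵐ t ∂(volume.restrict (Ioi 0)), ι (u t) = ∫ s in (0:ℝ)..t, (f s - A (u s))) :
    IsLinSol q ν (Ioi 0) ι A f 0 u (fun t => f t - A (u t)) := by
  have hδ : 1 - ν < 1 - 1 / q := by linarith
  have hgm : MemLp (fun t => f t - A (u t)) (ENNReal.ofReal q) (wm q (1 - ν)) :=
    hf.sub (A.comp_memLp' hu)
  have hg := wm_intOn hq hδ hgm
  have hι : MemLp (fun t => ι (u t)) (ENNReal.ofReal q) (wm q (1 - ν)) := ι.comp_memLp' hu
  have hic : (insert 0 (Ioi 0) : Set ℝ) = Ici 0 := by ext; simp [le_iff_eq_or_lt, eq_comm]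
  refine ⟨⟨(memWLp_iff hq).2 hu, (memWLp_iff hq).2 hι, (memWLp_iff hq).2 hgm, ?_, loc_of_Ioc hg, ?_⟩,
    Filter.Eventually.of_forall fun t => sub_add_cancel _ _, _, hic ▸ prim_cont hg, ?_, by simp⟩
  · exact loc_of_Ioc (wm_intOn hq hδ hι)
  · intro φ a b d
    rw [← ibp' hg (a.of_le (by simp)) b]
    refine integral_congr_ae ?_
    filter_upwards [he] with t ht
    rw [ht]
  · filter_upwards [he] with t ht using ht.symm
end


lemma wm_zero (p : ℝ) : wm p 0 = volume.restrict (Ioi 0) := by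
  simp [wm]

section
variable {Y Z : Type*} [NormedAddCommGroup Y] [NormedSpace ℂ Y] [CompleteSpace Y]
  [NormedAddCommGroup Z] [NormedSpace ℂ Z] [CompleteSpace Z]

/-- integral solutions -/
def IntSol (ι A : Y →L[ℂ] Z) (f : ℝ → Z) (u : ℝ → Y) : Prop :=
  ∀ᵐ t ∂(volume.restrict (Ioi (0:ℝ))), ι (u t) = ∫ s in (0:ℝ)..t, (f s - A (u s))

lemma IntSol.congr {ι A : Y →L[ℂ] Z} {f f' : ℝ → Z} {u u' : ℝ → Y} (h : IntSol ι A f u)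
    (hf : ∀ᵐ t ∂(volume.restrict (Ioi (0:ℝ))), f t = f' t)
    (hu : ∀ᵐ t ∂(volume.restrict (Ioi (0:ℝ))), u t = u' t) : IntSol ι A f' u' := by
  unfold IntSol at h ⊢
  filter_upwards [h, hu, ae_restrict_mem measurableSet_Ioi] with t ht ht' ht0
  have ht0' : (0:ℝ) < t := ht0
  rw [← ht', ht, intervalIntegral.integral_of_le ht0'.le, intervalIntegral.integral_of_le ht0'.le]
  refine integral_congr_ae ?_
  filter_upwards [ae_restrict_of_ae_restrict_of_subset (fun x hx => hx.1) hf,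
    ae_restrict_of_ae_restrict_of_subset (fun x hx => hx.1) hu] with s h1 h2
  rw [h1, h2]

lemma intOn_Lp {p : ℝ} (hp : 1 < p) {v : ℝ → Z} (hv : MemLp v (ENNReal.ofReal p) (volume.restrict (Ioi 0))) (t : ℝ) :
    IntegrableOn v (Ioc 0 t) := by
  rw [← wm_zero p] at hv
  exact wm_intOn hp (by rw [sub_pos, div_lt_one (by linarith)]; exact hp) hv t

/-- the primitive at time `t` as a bounded operator on `L_p` -/
lemma prim_clm {p : ℝ} (hp : 1 < p) (t : ℝ) [Fact (1 ≤ ENNReal.ofReal p)] :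
    ∃ I : Lp Z (ENNReal.ofReal p) (volume.restrict (Ioi (0:ℝ))) →L[ℂ] Z,
      ∀ g, I g = ∫ s in Ioc 0 t, g s := by
  have hδ : 0 < 1 - 1 / p := by rw [sub_pos, div_lt_one (by linarith)]; exact hp
  obtain ⟨κ, hκ, H⟩ := wm_emb (X := Z) hp hδ t
  rw [wm_zero] at H
  have hi := fun g : Lp Z (ENNReal.ofReal p) (volume.restrict (Ioi (0:ℝ))) => intOn_Lp hp (Lp.memLp g) t
  refine ⟨LinearMap.mkContinuous
    { toFun := fun g => ∫ s in Ioc 0 t, g s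
      map_add' := fun g g' => ?_
      map_smul' := fun c g => ?_ } κ.toReal (fun g => ?_), fun g => rfl⟩
  · rw [← integral_add (hi g) (hi g')]
    refine integral_congr_ae (ae_restrict_of_ae_restrict_of_subset (fun x hx => hx.1) (Lp.coeFn_add g g'))
  · rw [RingHom.id_apply, ← integral_smul]
    refine integral_congr_ae (ae_restrict_of_ae_restrict_of_subset (fun x hx => hx.1) (Lp.coeFn_smul c g))
  · simp only [LinearMap.coe_mk, AddHom.coe_mk]
    rw [Lp.norm_def, ← ENNReal.toReal_mul, ← toReal_enorm]
    refine ENNReal.toReal_mono (ENNReal.mul_ne_top hκ (Lp.memLp g).2.ne) ?_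
    exact (enorm_integral_le_lintegral_enorm _).trans (H g (Lp.memLp g).1)

lemma K_closed {p : ℝ} (hp : 1 < p) [Fact (1 ≤ ENNReal.ofReal p)] :
    ∃ K : Submodule ℂ (Lp Z (ENNReal.ofReal p) (volume.restrict (Ioi (0:ℝ))) ×
      Lp Z (ENNReal.ofReal p) (volume.restrict (Ioi (0:ℝ)))), IsClosed K.carrier ∧
      ∀ z, z ∈ K ↔ ∀ᵐ t ∂(volume.restrict (Ioi (0:ℝ))), z.1 t = ∫ s in Ioc 0 t, z.2 s := by
  choose I hI using fun t => prim_clm (Z := Z) hp t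
  refine ⟨{ carrier := {z | ∀ᵐ t ∂(volume.restrict (Ioi (0:ℝ))), z.1 t = I t z.2}
            add_mem' := ?_, zero_mem' := ?_, smul_mem' := ?_ }, ?_, fun z => by simp only [← hI]; rfl⟩
  · intro a b ha hb
    simp only [mem_ofPred_eq] at ha hb ⊢
    filter_upwards [ha, hb, Lp.coeFn_add a.1 b.1] with t h1 h2 h3
    rw [Prod.fst_add, h3, Pi.add_apply, h1, h2, Prod.snd_add, map_add]
  · simp only [mem_ofPred_eq]
    filter_upwards [Lp.coeFn_zero Z (ENNReal.ofReal p) (volume.restrict (Ioi (0:ℝ)))] with t h1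
    rw [Prod.fst_zero, h1, Prod.snd_zero, map_zero]; rfl
  · intro c a ha
    simp only [mem_ofPred_eq] at ha ⊢
    filter_upwards [ha, Lp.coeFn_smul c a.1] with t h1 h2
    rw [Prod.smul_fst, h2, Pi.smul_apply, h1, Prod.smul_snd, map_smul]
  · refine IsSeqClosed.isClosed ?_
    intro z z0 hz hlim
    have hz' : ∀ n, ∀ᵐ t ∂(volume.restrict (Ioi (0:ℝ))), (z n).1 t = I t (z n).2 := hz
    have h1 : Filter.Tendsto (fun n => (z n).1) Filter.atTop (nhds z0.1) := (continuous_fst.tendsto _).comp hlim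
    have h2 : Filter.Tendsto (fun n => (z n).2) Filter.atTop (nhds z0.2) := (continuous_snd.tendsto _).comp hlim
    have h3 := (Lp.tendsto_Lp_iff_tendsto_eLpNorm' _ _).1 h1
    have hq0 : ENNReal.ofReal p ≠ 0 := by simp; linarith
    obtain ⟨ns, hns, hae⟩ := (tendstoInMeasure_of_tendsto_eLpNorm hq0 (fun n => (Lp.memLp (z n).1).1)
      (Lp.memLp z0.1).1 h3).exists_seq_tendsto_ae
    show ∀ᵐ t ∂(volume.restrict (Ioi (0:ℝ))), z0.1 t = I t z0.2
    filter_upwards [hae, ae_all_iff.2 hz'] with t ht hzt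
    refine tendsto_nhds_unique ht ?_
    simp only [hzt]
    exact (((I t).continuous.tendsto _).comp h2).comp hns.tendsto_atTop

lemma apriori {p : ℝ} (hp : 1 < p) {ι A : Y →L[ℂ] Z}
    (hE : ∀ f, MemLp f (ENNReal.ofReal p) (volume.restrict (Ioi (0:ℝ))) →
      ∃ u, MemLp u (ENNReal.ofReal p) (volume.restrict (Ioi (0:ℝ))) ∧ IntSol ι A f u) :
    ∃ C : ℝ, 0 ≤ C ∧ ∀ f, MemLp f (ENNReal.ofReal p) (volume.restrict (Ioi (0:ℝ))) →
      ∃ u, MemLp u (ENNReal.ofReal p) (volume.restrict (Ioi (0:ℝ))) ∧ IntSol ι A f u ∧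
        eLpNorm u (ENNReal.ofReal p) (volume.restrict (Ioi (0:ℝ))) ≤
          ENNReal.ofReal C * eLpNorm f (ENNReal.ofReal p) (volume.restrict (Ioi (0:ℝ))) := by
  haveI : Fact (1 ≤ ENNReal.ofReal p) := ⟨by
    rw [← ENNReal.ofReal_one]; exact ENNReal.ofReal_le_ofReal hp.le⟩
  set P := ENNReal.ofReal p
  set μ := volume.restrict (Ioi (0:ℝ)) with hμ
  obtain ⟨K, hK, hKm⟩ := K_closed (Z := Z) hp
  let Ψ : (Lp Y P μ × Lp Z P μ) →L[ℂ] (Lp Z P μ × Lp Z P μ) :=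
    ((ι.compLpL P μ).comp (ContinuousLinearMap.fst ℂ _ _)).prod
      (ContinuousLinearMap.snd ℂ _ _ - (A.compLpL P μ).comp (ContinuousLinearMap.fst ℂ _ _))
  let G : Submodule ℂ (Lp Y P μ × Lp Z P μ) := K.comap Ψ.toLinearMap
  have hG : IsClosed G.carrier := hK.preimage Ψ.continuous
  haveI : CompleteSpace G := hG.completeSpace_coe
  have hGm : ∀ z, z ∈ G ↔ IntSol ι A z.2 z.1 := by
    intro z
    have e1 : ∀ᵐ t ∂μ, (Ψ z).1 t = ι (z.1 t) := ContinuousLinearMap.coeFn_compLpL ι z.1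
    have e2 : ∀ᵐ t ∂μ, (Ψ z).2 t = z.2 t - A (z.1 t) := by
      have a1 := Lp.coeFn_sub z.2 (A.compLpL P μ z.1)
      have a2 := ContinuousLinearMap.coeFn_compLpL (p := P) (μ := μ) A z.1
      filter_upwards [a1, a2] with t h1 h2
      exact h1.trans (by rw [Pi.sub_apply, h2])
    have e3 : ∀ t, ∫ s in Ioc 0 t, (Ψ z).2 s = ∫ s in Ioc 0 t, (z.2 s - A (z.1 s)) := fun t =>
      integral_congr_ae (ae_restrict_of_ae_restrict_of_subset (fun x hx => hx.1) e2)
    refine (hKm (Ψ z)).trans ?_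
    simp only [e3]
    constructor
    · intro h
      unfold IntSol
      filter_upwards [h, e1, ae_restrict_mem measurableSet_Ioi] with t h1 h2 h3
      rw [← h2, h1, intervalIntegral.integral_of_le (le_of_lt h3)]
    · intro h
      unfold IntSol at h
      filter_upwards [h, e1, ae_restrict_mem measurableSet_Ioi] with t h1 h2 h3
      rw [h2, h1, intervalIntegral.integral_of_le (le_of_lt h3)]
  let π : G →L[ℂ] Lp Z P μ := (ContinuousLinearMap.snd ℂ _ _).comp G.subtypeL
  have hπ : Function.Surjective π := by
    intro f
    obtain ⟨u, hu, hs⟩ := hE f (Lp.memLp f)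
    refine ⟨⟨(hu.toLp u, f), (hGm _).2 ?_⟩, rfl⟩
    exact hs.congr (Filter.Eventually.of_forall fun _ => rfl) (hu.coeFn_toLp.mono fun t ht => ht.symm)
  obtain ⟨C, hC, H⟩ := π.exists_preimage_norm_le hπ
  refine ⟨C, hC.le, fun f hf => ?_⟩
  obtain ⟨z, hz, hzn⟩ := H (hf.toLp f)
  have hzs := (hGm _).1 z.2
  have hz2 : z.1.2 = hf.toLp f := hz
  refine ⟨z.1.1, Lp.memLp _, hzs.congr ?_ (Filter.Eventually.of_forall fun _ => rfl), ?_⟩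
  · rw [hz2]; exact hf.coeFn_toLp
  · have h1 : ‖z.1.1‖ ≤ C * ‖hf.toLp f‖ := (norm_fst_le z.1).trans hzn
    rw [Lp.norm_toLp, Lp.norm_def] at h1
    rw [← ENNReal.ofReal_toReal (Lp.memLp z.1.1).2.ne, ← ENNReal.ofReal_toReal hf.2.ne,
      ← ENNReal.ofReal_mul hC.le]
    exact ENNReal.ofReal_le_ofReal h1
end


section
variable {Y Z : Type*} [NormedAddCommGroup Y] [NormedSpace ℂ Y] [CompleteSpace Y]
  [NormedAddCommGroup Z] [NormedSpace ℂ Z] [CompleteSpace Z]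

lemma exp_norm {p : ℝ} (hp : 1 < p) {a : ℝ} (ha : 0 < a) (c : ℝ) (x : Z) :
    eLpNorm (fun t => (c * Real.exp (-(a * t))) • x) (ENNReal.ofReal p) (volume.restrict (Ioi (0:ℝ))) =
      ENNReal.ofReal (|c| * (1 / (p * a)) ^ (1 / p) * ‖x‖) := by
  have hp0 : 0 < p := by linarith
  have h1 : ∫⁻ t in Ioi (0:ℝ), ENNReal.ofReal (Real.exp (-(p * a) * t)) = ENNReal.ofReal (1 / (p * a)) := by
    have hi := integrableOn_exp_mul_Ioi (a := -(p * a)) (by nlinarith) 0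
    rw [← ofReal_integral_eq_lintegral_ofReal hi (Filter.Eventually.of_forall fun t => (Real.exp_pos _).le),
      integral_exp_mul_Ioi (by nlinarith) 0]
    congr 1
    simp [neg_div_neg_eq]
  rw [eLpNorm_eq_lintegral_rpow_enorm_toReal (by simpa using hp0) (by simp), ENNReal.toReal_ofReal hp0.le]
  have h2 : ∀ t : ℝ, ‖(c * Real.exp (-(a * t))) • x‖ₑ ^ p =
      ENNReal.ofReal ((|c| * ‖x‖) ^ p) * ENNReal.ofReal (Real.exp (-(p * a) * t)) := by
    intro t
    rw [← ofReal_norm_eq_enorm, ENNReal.ofReal_rpow_of_nonneg (norm_nonneg _) hp0.le, ← ENNReal.ofReal_mul (by positivity)]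
    congr 1
    rw [norm_smul, Real.norm_eq_abs, abs_mul, abs_of_pos (Real.exp_pos _),
      show |c| * Real.exp (-(a * t)) * ‖x‖ = (|c| * ‖x‖) * Real.exp (-(a * t)) by ring,
      Real.mul_rpow (by positivity) (Real.exp_pos _).le, ← Real.exp_mul]
    congr 2; ring
  simp only [h2]
  rw [lintegral_const_mul _ (by fun_prop), h1, ← ENNReal.ofReal_mul (by positivity),
    ENNReal.ofReal_rpow_of_nonneg (by positivity) (by positivity), Real.mul_rpow (by positivity) (by positivity),
    ← Real.rpow_mul (by positivity), mul_one_div_cancel hp0.ne', Real.rpow_one]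
  congr 1; ring

lemma exp_memLp {p : ℝ} (hp : 1 < p) {a : ℝ} (ha : 0 < a) (c : ℝ) (x : Z) :
    MemLp (fun t => (c * Real.exp (-(a * t))) • x) (ENNReal.ofReal p) (volume.restrict (Ioi (0:ℝ))) :=
  ⟨(by fun_prop : Continuous fun t => (c * Real.exp (-(a * t))) • x).aestronglyMeasurable, by
    rw [exp_norm hp ha]; exact ENNReal.ofReal_lt_top⟩

lemma int_exp (a : ℝ) (x : Z) (t : ℝ) :
    ∫ s in (0:ℝ)..t, ((-a) * Real.exp (-(a * s))) • x = (Real.exp (-(a * t)) - 1) • x := by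
  rw [intervalIntegral.integral_smul_const]
  congr 1
  have hd : ∀ s : ℝ, HasDerivAt (fun s => Real.exp (-(a * s))) (-a * Real.exp (-(a * s))) s := by
    intro s
    have h0 : HasDerivAt (fun s : ℝ => -(a * s)) (-a) s := by
      simpa using (hasDerivAt_id s).const_mul (-a)
    have := h0.exp
    rwa [mul_comm] at this
  rw [intervalIntegral.integral_eq_sub_of_hasDerivAt (fun s _ => hd s)
    ((by fun_prop : Continuous fun s => -a * Real.exp (-(a * s))).intervalIntegrable _ _)]
  simp

variable {p : ℝ} {ι A : Y →L[ℂ] Z}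

lemma lower_bd (hp : 1 < p) {C : ℝ} (hC : 0 ≤ C)
    (hb : ∀ f u, MemLp f (ENNReal.ofReal p) (volume.restrict (Ioi (0:ℝ))) →
      MemLp u (ENNReal.ofReal p) (volume.restrict (Ioi (0:ℝ))) → IntSol ι A f u →
        eLpNorm u (ENNReal.ofReal p) (volume.restrict (Ioi (0:ℝ))) ≤
          ENNReal.ofReal C * eLpNorm f (ENNReal.ofReal p) (volume.restrict (Ioi (0:ℝ)))) (x : Y) :
    ‖x‖ ≤ C * ‖A x‖ := by
  have hp0 : 0 < p := by linarith
  have hP1 : 1 ≤ ENNReal.ofReal p := by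
    rw [← ENNReal.ofReal_one]; exact ENNReal.ofReal_le_ofReal hp.le
  set e : ℝ := (1 / (p * 1)) ^ (1 / p) with he
  have he0 : 0 ≤ e := by positivity
  have key : ∀ K : ℝ, 1 ≤ K → K * ‖x‖ ≤ e * ‖x‖ + C * ((1 + e) * ‖ι x‖ + (K + e) * ‖A x‖) := by
    intro K hK
    have hK0 : 0 < K := by linarith
    set a : ℝ := 1 / (p * K ^ p) with ha
    have ha0 : 0 < a := by positivity
    have haK : (1 / (p * a)) ^ (1 / p) = K := by
      rw [ha]
      have : 1 / (p * (1 / (p * K ^ p))) = K ^ p := by field_simp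
      rw [this, ← Real.rpow_mul hK0.le, mul_one_div_cancel hp0.ne', Real.rpow_one]
    have haK' : a * K ≤ 1 := by
      have : K ≤ K ^ p := by
        conv_lhs => rw [← Real.rpow_one K]
        exact Real.rpow_le_rpow_of_exponent_le hK hp.le
      rw [ha, div_mul_eq_mul_div, one_mul, div_le_one (by positivity)]
      nlinarith [Real.rpow_pos_of_pos hK0 p]
    let u1 : ℝ → Y := fun t => (1 * Real.exp (-(a * t))) • x
    let u2 : ℝ → Y := fun t => ((-1) * Real.exp (-(1 * t))) • x
    let u3 : ℝ → Y := fun t => (1 * Real.exp (-(1 * t))) • x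
    let f1 : ℝ → Z := fun t => (-a * Real.exp (-(a * t))) • ι x
    let f2 : ℝ → Z := fun t => (1 * Real.exp (-(1 * t))) • ι x
    let f3 : ℝ → Z := fun t => (1 * Real.exp (-(a * t))) • A x
    let f4 : ℝ → Z := fun t => ((-1) * Real.exp (-(1 * t))) • A x
    have mu1 : MemLp u1 _ _ := exp_memLp hp ha0 1 x
    have mu2 : MemLp u2 _ _ := exp_memLp hp one_pos (-1) x
    have mu3 : MemLp u3 _ _ := exp_memLp hp one_pos 1 x
    have mf1 : MemLp f1 _ _ := exp_memLp hp ha0 (-a) (ι x)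
    have mf2 : MemLp f2 _ _ := exp_memLp hp one_pos 1 (ι x)
    have mf3 : MemLp f3 _ _ := exp_memLp hp ha0 1 (A x)
    have mf4 : MemLp f4 _ _ := exp_memLp hp one_pos (-1) (A x)
    have nu1 := exp_norm hp ha0 1 x
    have nu3 := exp_norm hp one_pos 1 x
    have nf1 := exp_norm hp ha0 (-a) (ι x)
    have nf2 := exp_norm hp one_pos 1 (ι x)
    have nf3 := exp_norm hp ha0 1 (A x)
    have nf4 := exp_norm hp one_pos (-1) (A x)
    rw [haK] at nu1 nf1 nf3
    rw [← he] at nu3 nf2 nf4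
    have hA : ∀ (r : ℝ) (z : Y), A (r • z) = r • A z := fun r z => A.map_smul_of_tower r z
    have hι : ∀ (r : ℝ) (z : Y), ι (r • z) = r • ι z := fun r z => ι.map_smul_of_tower r z
    have hsol : IntSol ι A (f1 + f2 + (f3 + f4)) (u1 + u2) := by
      refine Filter.Eventually.of_forall fun t => ?_
      have e1 : ∀ s, (f1 + f2 + (f3 + f4)) s - A ((u1 + u2) s) =
          (-a * Real.exp (-(a * s))) • ι x - ((-1) * Real.exp (-(1 * s))) • ι x := by
        intro s
        simp only [f1, f2, f3, f4, u1, u2, Pi.add_apply, map_add, hA]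
        module
      simp only [e1]
      rw [intervalIntegral.integral_sub
        ((by fun_prop : Continuous fun s => (-a * Real.exp (-(a * s))) • ι x).intervalIntegrable _ _)
        ((by fun_prop : Continuous fun s => (-1 * Real.exp (-(1 * s))) • ι x).intervalIntegrable _ _),
        int_exp, int_exp]
      simp only [u1, u2, Pi.add_apply, map_add, hι]
      module
    have h1 := hb _ _ ((mf1.add mf2).add (mf3.add mf4)) (mu1.add mu2) hsol
    have h2 : eLpNorm u1 (ENNReal.ofReal p) (volume.restrict (Ioi (0:ℝ))) ≤
        eLpNorm (u1 + u2) (ENNReal.ofReal p) (volume.restrict (Ioi (0:ℝ))) +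
        eLpNorm u3 (ENNReal.ofReal p) (volume.restrict (Ioi (0:ℝ))) := by
      have : u1 = (u1 + u2) + u3 := by
        ext t; simp only [u1, u2, u3, Pi.add_apply]; module
      conv_lhs => rw [this]
      exact eLpNorm_add_le (mu1.add mu2).1 mu3.1 hP1
    have h3 : eLpNorm (f1 + f2 + (f3 + f4)) (ENNReal.ofReal p) (volume.restrict (Ioi (0:ℝ))) ≤
        ENNReal.ofReal (|-a| * K * ‖ι x‖ + |1| * e * ‖ι x‖ + (|1| * K * ‖A x‖ + |-1| * e * ‖A x‖)) := by
      rw [ENNReal.ofReal_add (by positivity) (by positivity), ENNReal.ofReal_add (by positivity) (by positivity),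
        ENNReal.ofReal_add (by positivity) (by positivity), ← nf1, ← nf2, ← nf3, ← nf4]
      refine (eLpNorm_add_le (mf1.add mf2).1 (mf3.add mf4).1 hP1).trans (add_le_add ?_ ?_)
      · exact eLpNorm_add_le mf1.1 mf2.1 hP1
      · exact eLpNorm_add_le mf3.1 mf4.1 hP1
    have h4 := h2.trans (add_le_add (h1.trans (mul_le_mul_right h3 _)) le_rfl)
    rw [show eLpNorm u1 _ _ = _ from nu1, show eLpNorm u3 _ _ = _ from nu3, ← ENNReal.ofReal_mul hC,
      ← ENNReal.ofReal_add (by positivity) (by positivity), ENNReal.ofReal_le_ofReal_iff (by positivity)] at h4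
    rw [abs_neg, abs_neg, abs_one, abs_of_pos ha0] at h4
    have h5 : C * (a * K * ‖ι x‖ + 1 * e * ‖ι x‖ + (1 * K * ‖A x‖ + 1 * e * ‖A x‖)) ≤
        C * ((1 + e) * ‖ι x‖ + (K + e) * ‖A x‖) := by
      refine mul_le_mul_of_nonneg_left ?_ hC
      nlinarith [mul_le_mul_of_nonneg_right haK' (norm_nonneg (ι x))]
    linarith
  by_contra hcon
  rw [not_le] at hcon
  set d := ‖x‖ - C * ‖A x‖ with hd
  have hd0 : 0 < d := by rw [hd]; linarith
  set M := e * ‖x‖ + C * ((1 + e) * ‖ι x‖ + e * ‖A x‖) with hM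
  have hM0 : 0 ≤ M := by positivity
  have := key (M / d + 1) (by linarith [div_nonneg hM0 hd0.le])
  have h2 : (M / d + 1) * d ≤ M := by rw [hd, hM] at *; nlinarith
  rw [add_mul, div_mul_cancel₀ _ hd0.ne'] at h2
  linarith

lemma dense_A (hp : 1 < p) (hdense : DenseRange ι)
    (hE : ∀ f, MemLp f (ENNReal.ofReal p) (volume.restrict (Ioi (0:ℝ))) →
      ∃ u, MemLp u (ENNReal.ofReal p) (volume.restrict (Ioi (0:ℝ))) ∧ IntSol ι A f u) :
    DenseRange A := by
  have hp0 : 0 < p := by linarith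
  have hA : ∀ (r : ℝ) (z : Y), A (r • z) = r • A z := fun r z => A.map_smul_of_tower r z
  have hι : ∀ (r : ℝ) (z : Y), ι (r • z) = r • ι z := fun r z => ι.map_smul_of_tower r z
  suffices h : ∀ x : Y, ι x ∈ closure (range A) by
    have h2 : closure (range ι) ⊆ closure (range A) :=
      closure_minimal (by rintro _ ⟨x, rfl⟩; exact h x) isClosed_closure
    intro z
    exact h2 (hdense z)
  intro x
  have mf := exp_memLp hp one_pos 1 (ι x - A x)
  obtain ⟨w, hw, hs⟩ := hE _ mf
  have mx := exp_memLp hp one_pos 1 x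
  let u : ℝ → Y := (fun t => (1 * Real.exp (-(1 * t))) • x) + w
  have hu : MemLp u _ _ := mx.add hw
  have heq : ∀ᵐ t ∂(volume.restrict (Ioi (0:ℝ))), ι x = ι (u t) + A (∫ s in Ioc 0 t, u s) := by
    unfold IntSol at hs
    filter_upwards [hs, ae_restrict_mem measurableSet_Ioi] with t ht ht0
    have ht0' : (0:ℝ) < t := ht0
    rw [← A.integral_comp_comm (intOn_Lp hp hu t), ← intervalIntegral.integral_of_le ht0'.le]
    have hi1 : IntervalIntegrable (fun s => A (u s)) volume 0 t := by
      rw [intervalIntegrable_iff_integrableOn_Ioc_of_le ht0'.le]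
      exact A.integrable_comp (intOn_Lp hp hu t)
    have e1 : ∀ s, (1 * Real.exp (-(1 * s))) • (ι x - A x) - A (w s) =
        -((-1 * Real.exp (-(1 * s))) • ι x) - A (u s) := by
      intro s
      simp only [u, Pi.add_apply, map_add, hA]
      module
    simp only [e1] at ht
    rw [intervalIntegral.integral_sub (f := fun s => -((-1 * Real.exp (-(1 * s))) • ι x))
      ((by fun_prop : Continuous fun s => -((-1 * Real.exp (-(1 * s))) • ι x)).intervalIntegrable _ _) hi1,
      intervalIntegral.integral_neg, int_exp] at ht
    have e2 : ι (u t) = (1 * Real.exp (-(1 * t))) • ι x + ι (w t) := by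
      simp only [u, Pi.add_apply, map_add, hι]
    rw [e2, ht]
    module
  rw [Metric.mem_closure_iff]
  intro ε hε
  have hfr : ∃ t, ‖ι (u t)‖ < ε ∧ ι x = ι (u t) + A (∫ s in Ioc 0 t, u s) := by
    by_contra hcon
    push Not at hcon
    have hιu : MemLp (fun t => ι (u t)) (ENNReal.ofReal p) (volume.restrict (Ioi (0:ℝ))) := ι.comp_memLp' hu
    have hc : MemLp (fun _ : ℝ => ε) (ENNReal.ofReal p) (volume.restrict (Ioi (0:ℝ))) := by
      refine hιu.mono aestronglyMeasurable_const ?_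
      filter_upwards [heq] with t ht
      by_contra h
      rw [not_le, Real.norm_eq_abs, abs_of_pos hε] at h
      exact hcon t h ht
    rw [memLp_const_iff (by simpa using hp0) (by simp)] at hc
    simp [hε.ne'] at hc
  obtain ⟨t, h1, h2⟩ := hfr
  refine ⟨A (∫ s in Ioc 0 t, u s), ⟨_, rfl⟩, ?_⟩
  rw [dist_eq_norm, h2, add_sub_cancel_right]
  exact h1
end


section
variable {Y Z : Type*} [NormedAddCommGroup Y] [NormedSpace ℂ Y] [CompleteSpace Y]
  [NormedAddCommGroup Z] [NormedSpace ℂ Z] [CompleteSpace Z]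

lemma lint_eLp {p : ℝ} (hp : 1 < p) (v : ℝ → Z) :
    ∫⁻ t in Ioi (0:ℝ), ENNReal.ofReal (‖v t‖ ^ p) =
      eLpNorm v (ENNReal.ofReal p) (volume.restrict (Ioi (0:ℝ))) ^ p := by
  have h := wm_eLp (δ := 0) hp v
  rw [wm_zero] at h
  rw [h]
  simp

lemma mrw_main {p : ℝ} (hp : 1 < p) (ι A : Y →L[ℂ] Z) (hinj : Function.Injective ι)
    (hdense : DenseRange ι) (hMR : MRw p 1 ι A) {q ν : ℝ} (hq : 1 < q) (hν : 1 / q < ν) (hν1 : ν ≤ 1) :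
    MRw q ν ι A := by
  have hp0 : 0 < p := by linarith
  have hp1 : 1 / p < 1 := by rw [div_lt_one hp0]; exact hp
  have hw0 : wm p (1 - 1) = volume.restrict (Ioi 0) := by rw [sub_self, wm_zero]
  have hE : ∀ f, MemLp f (ENNReal.ofReal p) (volume.restrict (Ioi (0:ℝ))) →
      ∃ u, MemLp u (ENNReal.ofReal p) (volume.restrict (Ioi (0:ℝ))) ∧ IntSol ι A f u := by
    intro f hf
    obtain ⟨u, u', hs⟩ := (hMR f ((memWLp_iff hp).2 (by rw [hw0]; exact hf))).1
    have := sol_to_int hp hp1 hs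
    rw [hw0] at this
    exact ⟨u, this⟩
  have hU : ∀ f u v, MemLp f (ENNReal.ofReal p) (volume.restrict (Ioi (0:ℝ))) →
      MemLp u (ENNReal.ofReal p) (volume.restrict (Ioi (0:ℝ))) →
      MemLp v (ENNReal.ofReal p) (volume.restrict (Ioi (0:ℝ))) → IntSol ι A f u → IntSol ι A f v →
      ∀ᵐ t ∂(volume.restrict (Ioi (0:ℝ))), u t = v t := by
    intro f u v hf hu hv h1 h2
    rw [← hw0] at hf hu hv
    exact (hMR f ((memWLp_iff hp).2 hf)).2 _ _ _ _ (int_to_sol hp hp1 hf hu h1) (int_to_sol hp hp1 hf hv h2)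
  obtain ⟨C, hC, hap⟩ := apriori hp hE
  have hb : ∀ f u, MemLp f (ENNReal.ofReal p) (volume.restrict (Ioi (0:ℝ))) →
      MemLp u (ENNReal.ofReal p) (volume.restrict (Ioi (0:ℝ))) → IntSol ι A f u →
        eLpNorm u (ENNReal.ofReal p) (volume.restrict (Ioi (0:ℝ))) ≤
          ENNReal.ofReal C * eLpNorm f (ENNReal.ofReal p) (volume.restrict (Ioi (0:ℝ))) := by
    intro f u hf hu hs
    obtain ⟨v, hv, hvs, hvb⟩ := hap f hf
    rw [eLpNorm_congr_ae (hU f u v hf hu hv hs hvs)]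
    exact hvb
  have hlb := lower_bd hp hC hb
  have hAl : AntilipschitzWith ⟨C, hC⟩ A := AddMonoidHomClass.antilipschitz_of_bound A hlb
  have hAcl : IsClosed (range A) := hAl.isClosed_range A.uniformContinuous
  have hAs : Function.Surjective A := by
    rw [← range_eq_univ, ← hAcl.closure_eq]
    exact (dense_A hp hdense hE).closure_eq
  let e : Y ≃L[ℂ] Z := ContinuousLinearEquiv.ofBijective A
    (LinearMap.ker_eq_bot.2 hAl.injective) (LinearMap.range_eq_top.2 hAs)
  let B : Z →L[ℂ] Y := e.symm.toContinuousLinearMap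
  have hBA : ∀ y, B (A y) = y := fun y => e.symm_apply_apply y
  have hAB : ∀ z, A (B z) = z := fun z => e.apply_symm_apply z
  let R : Z →L[ℝ] Z := (ι.comp B).restrictScalars ℝ
  have hR : ∀ z, R z = ι (B z) := fun z => rfl
  have D : MRR R p ((‖A‖ * C) ^ p) := by
    refine ⟨hp, by positivity, ?_, ?_, ?_, ?_⟩
    · intro z z' h
      have := hinj (show ι (B z) = ι (B z') from h)
      rw [← hAB z, this, hAB]
    · have : range R = range ι := by
        ext z; constructor
        · rintro ⟨y, rfl⟩; exact ⟨B y, rfl⟩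
        · rintro ⟨y, rfl⟩; exact ⟨A y, by rw [hR, hBA]⟩
      rw [DenseRange, this]; exact hdense
    · intro f hf
      obtain ⟨u, hu, hs, hbd⟩ := hap f hf
      refine ⟨fun t => A (u t), A.comp_memLp' hu, ?_, ?_⟩
      · unfold IntSol at hs
        filter_upwards [hs] with t ht
        rw [hR, hBA, ht]
      · rw [lint_eLp hp, lint_eLp hp, ← ENNReal.ofReal_rpow_of_nonneg (by positivity) hp0.le,
          ← ENNReal.mul_rpow_of_nonneg _ _ hp0.le]
        refine ENNReal.rpow_le_rpow ?_ hp0.le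
        rw [ENNReal.ofReal_mul (norm_nonneg _), mul_assoc]
        refine (eLpNorm_le_mul_eLpNorm_of_ae_le_mul (g := u) (c := ‖A‖)
          (Filter.Eventually.of_forall fun t => A.le_opNorm _) _).trans (mul_le_mul_right hbd _)
    · intro y hy h
      have hBy : MemLp (fun t => B (y t)) (ENNReal.ofReal p) (volume.restrict (Ioi (0:ℝ))) := B.comp_memLp' hy
      have h1 : IntSol ι A (fun _ => 0) (fun t => B (y t)) := by
        unfold IntSol
        filter_upwards [h] with t ht
        simp only [hAB, zero_sub, intervalIntegral.integral_neg]
        exact ht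
      have h2 : IntSol ι A (fun _ => 0) (fun _ => 0) := Filter.Eventually.of_forall fun t => by simp
      filter_upwards [hU _ _ _ MemLp.zero' hBy MemLp.zero' h1 h2] with t ht
      rw [← hAB (y t), ht, map_zero]
  have hδ : 1 - ν < 1 - 1 / q := by linarith
  intro f hf
  have hf' := (memWLp_iff hq).1 hf
  constructor
  · obtain ⟨y, hy, he⟩ := D.w_exists hq (by linarith) hδ hf'
    refine ⟨fun t => B (y t), _, int_to_sol hq hν hf' (B.comp_memLp' hy) ?_⟩
    filter_upwards [he] with t ht
    simp only [hAB]
    exact ht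
  · intro u₁ u₁' u₂ u₂' h1 h2
    obtain ⟨m1, s1⟩ := sol_to_int hq hν h1
    obtain ⟨m2, s2⟩ := sol_to_int hq hν h2
    have hA1 : MemLp (fun t => A (u₁ t)) (ENNReal.ofReal q) (wm q (1 - ν)) := A.comp_memLp' m1
    have hA2 : MemLp (fun t => A (u₂ t)) (ENNReal.ofReal q) (wm q (1 - ν)) := A.comp_memLp' m2
    have := D.w_unique hq hδ (y := fun t => A (u₁ t) - A (u₂ t)) (hA1.sub hA2) (by
      filter_upwards [s1, s2, ae_restrict_mem measurableSet_Ioi] with t e1 e2 ht0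
      have ht0' : (0:ℝ) < t := ht0
      rw [hR, map_sub, map_sub, hBA, hBA, e1, e2, intervalIntegral.integral_of_le ht0'.le,
        intervalIntegral.integral_of_le ht0'.le, intervalIntegral.integral_of_le ht0'.le,
        ← integral_sub (f := fun x => f x - A (u₁ x)) (g := fun x => f x - A (u₂ x)) (wm_intOn hq hδ (hf'.sub hA1) t) (wm_intOn hq hδ (hf'.sub hA2) t), ← integral_neg]
      refine integral_congr_ae (Filter.Eventually.of_forall fun s => ?_)
      simp only []
      abel)
    filter_upwards [this] with t ht
    exact hAl.injective (sub_eq_zero.1 ht)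
end

/-- **Sobolevskii; independence of the integrability exponent.** If
`A ∈ MR_p(X₀)` for some `p ∈ (1,∞)`, then `A ∈ MR_q(X₀)` for every `q ∈ (1,∞)`.
Consequently, membership of `A` in `MR_{q,ν}(X₀)` is independent of both `q ∈ (1,∞)`
and `ν ∈ (1/q, 1]`. -/
theorem statement4 (p : ℝ) (hp : 1 < p)
    (ι A : X₁ →L[ℂ] X₀) (hinj : Function.Injective ι) (hdense : DenseRange ι)
    (hgraph : GraphNormEquiv ι A) (hMR : MRw p 1 ι A) :
    (∀ q : ℝ, 1 < q → MRw q 1 ι A) ∧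
    ∀ q ν : ℝ, 1 < q → 1 / q < ν → ν ≤ 1 → MRw q ν ι A := by
  exact ⟨fun q hq => mrw_main hp ι A hinj hdense hMR hq (by rw [div_lt_one (by linarith)]; exact hq) le_rfl,
    fun q ν hq h1 h2 => mrw_main hp ι A hinj hdense hMR hq h1 h2⟩
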